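/- arXiv:1110.5030 — 2 statements merged into one kernel-verified Lean document; each statement's English description precedes it below -/
import Mathlib

section
/- Let p ≥ 1 and let α = (α₁ ≥ … ≥ α_p) and β = (β₁ ≥ … ≥ β_p) be fixed decreasing p-tuples of real numbers. Then the set of decreasing p-tuples (ν₁ ≥ … ≥ ν_p) ∈ ℝ^p that arise as the ordered spectrum of a sum a + b, where a and b range over all real symmetric p×p matrices with ordered spectra α and β respectively, is a convex subset of ℝ^p. -/
open Matrix

namespace HornConvexity

section Spectral

variable {n : Type*} [Fintype n] [DecidableEq n]

theorem exists_orthogonal_diagonalization {a : Matrix n n ℝ} (ha : a.IsSymm) :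
    ∃ (u : Matrix n n ℝ) (d : n → ℝ), uᵀ * u = 1 ∧ a = u * diagonal d * uᵀ ∧
      ∀ ha : a.IsHermitian, d = ha.eigenvalues := by
  have hH : a.IsHermitian := by rw [IsHermitian, conjTranspose_eq_transpose_of_trivial]; exact ha
  refine ⟨hH.eigenvectorUnitary, hH.eigenvalues, ?_, ?_, fun _ => rfl⟩
  · have := Unitary.coe_star_mul_self hH.eigenvectorUnitary
    rwa [star_eq_conjTranspose, conjTranspose_eq_transpose_of_trivial] at this
  · conv_lhs => rw [hH.spectral_theorem]
    rw [Unitary.conjStarAlgAut_apply, star_eq_conjTranspose,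
      conjTranspose_eq_transpose_of_trivial]
    rfl

theorem exists_orthogonal_of_charpoly_eq {a : Matrix n n ℝ} (ha : a.IsSymm) {α : n → ℝ}
    (h : a.charpoly = ∏ i, (Polynomial.X - Polynomial.C (α i))) :
    ∃ u : Matrix n n ℝ, uᵀ * u = 1 ∧ a = u * diagonal α * uᵀ := by
  obtain ⟨u, d, hu, hud, hd⟩ := exists_orthogonal_diagonalization ha
  obtain ⟨v, d', hv, hvd, hd'⟩ :=
    exists_orthogonal_diagonalization (isSymm_diagonal α : (diagonal α).IsSymm)
  have hH : a.IsHermitian := by rw [IsHermitian, conjTranspose_eq_transpose_of_trivial]; exact ha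
  have hD : (diagonal α).IsHermitian := by
    rw [IsHermitian, conjTranspose_eq_transpose_of_trivial]; exact isSymm_diagonal α
  have hdd : d = d' := by
    rw [hd hH, hd' hD]
    exact (hH.eigenvalues_eq_eigenvalues_iff hD).2 (by rw [h, charpoly_diagonal])
  subst hdd
  refine ⟨u * vᵀ, ?_, ?_⟩
  · rw [transpose_mul, transpose_transpose, Matrix.mul_assoc, ← Matrix.mul_assoc uᵀ, hu,
      Matrix.one_mul, mul_eq_one_comm.1 hv]
  · rw [hvd, hud, transpose_mul, transpose_transpose]
    have e : u * vᵀ * (v * diagonal d * vᵀ) * (v * uᵀ) =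
      u * (vᵀ * v) * diagonal d * (vᵀ * v) * uᵀ := by simp only [Matrix.mul_assoc]
    rw [e, hv, Matrix.mul_one, Matrix.mul_one]

theorem charpoly_orthogonal_conj {u : Matrix n n ℝ} (hu : uᵀ * u = 1) (α : n → ℝ) :
    (u * diagonal α * uᵀ).charpoly = ∏ i, (Polynomial.X - Polynomial.C (α i)) := by
  rw [charpoly_mul_comm, ← Matrix.mul_assoc, hu, Matrix.one_mul, charpoly_diagonal]

theorem isSymm_conj_diagonal (u : Matrix n n ℝ) (α : n → ℝ) :
    (u * diagonal α * uᵀ).IsSymm := by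
  simp [IsSymm, Matrix.mul_assoc]

theorem conj_diagonal_reindex (u : Matrix n n ℝ) (d : n → ℝ) (σ : Equiv.Perm n) :
    u.submatrix id σ * diagonal (d ∘ σ) * (u.submatrix id σ)ᵀ = u * diagonal d * uᵀ := by
  rw [transpose_submatrix, ← submatrix_diagonal_equiv, submatrix_mul_equiv, submatrix_mul_equiv,
    submatrix_id_id]

theorem orthogonal_reindex {u : Matrix n n ℝ} (hu : uᵀ * u = 1) (σ : Equiv.Perm n) :
    (u.submatrix id σ)ᵀ * u.submatrix id σ = 1 := by
  rw [transpose_submatrix, ← submatrix_mul _ _ _ id _ Function.bijective_id, hu,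
    submatrix_one_equiv]

theorem det_sq_of_orthogonal {u : Matrix n n ℝ} (hu : uᵀ * u = 1) : u.det ^ 2 = 1 := by
  have := congrArg det hu
  rwa [det_mul, det_transpose, det_one, ← sq] at this

theorem isCompact_orthogonal : IsCompact {u : Matrix n n ℝ | uᵀ * u = 1} := by
  have hc : IsClosed {u : Matrix n n ℝ | uᵀ * u = 1} :=
    isClosed_eq (by fun_prop) continuous_const
  refine (isCompact_univ_pi fun _ : n => isCompact_univ_pi fun _ : n =>
    (isCompact_Icc : IsCompact (Set.Icc (-1 : ℝ) 1))).of_isClosed_subset hc ?_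
  intro (u : Matrix n n ℝ) (hu : uᵀ * u = 1) i _ j _
  have h1 : ∑ k, u k j * u k j = 1 := by
    have := congrFun (congrFun hu j) j
    simpa [mul_apply] using this
  have h2 : u i j * u i j ≤ 1 := h1 ▸
    Finset.single_le_sum (f := fun k => u k j * u k j) (fun k _ => mul_self_nonneg _)
      (Finset.mem_univ i)
  exact abs_le.1 (abs_le_one_iff_mul_self_le_one.2 h2)

end Spectral

theorem exists_sorted_diagonalization {n : ℕ} {h : Matrix (Fin n) (Fin n) ℝ} (hh : h.PosDef) :
    ∃ (u : Matrix (Fin n) (Fin n) ℝ) (d : Fin n → ℝ), uᵀ * u = 1 ∧ Antitone d ∧ (∀ i, 0 < d i) ∧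
      h = u * diagonal d * uᵀ := by
  have hs : h.IsSymm := by
    have := hh.1
    rwa [IsHermitian, conjTranspose_eq_transpose_of_trivial] at this
  obtain ⟨u, d, hu, hd, he⟩ := exists_orthogonal_diagonalization hs
  refine ⟨u.submatrix id (Tuple.sort (-d)), d ∘ Tuple.sort (-d), orthogonal_reindex hu _, ?_,
    ?_, ?_⟩
  · intro i j hij
    have := Tuple.monotone_sort (-d) hij
    simpa using this
  · intro i
    simp only [Function.comp, he hh.1]
    exact hh.eigenvalues_pos _
  · rw [conj_diagonal_reindex, hd]

section TensorPower

variable {n R : Type*} [CommRing R]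

/-- The `r`-th tensor power of a square matrix, indexed by `r`-tuples of indices. -/
def tensorPow (r : ℕ) (M : Matrix n n R) : Matrix (Fin r → n) (Fin r → n) R :=
  of fun f g => ∏ s, M (f s) (g s)

theorem tensorPow_mul [Fintype n] (r : ℕ) (M N : Matrix n n R) :
    tensorPow r M * tensorPow r N = tensorPow r (M * N) := by
  ext f g
  simp only [tensorPow, mul_apply, of_apply, ← Finset.prod_mul_distrib]
  rw [Finset.prod_univ_sum, Fintype.piFinset_univ]

theorem tensorPow_one [DecidableEq n] (r : ℕ) : tensorPow r (1 : Matrix n n R) = 1 := by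
  ext f g
  simp only [tensorPow, of_apply, one_apply, Finset.prod_ite_zero, Finset.prod_const_one,
    Finset.mem_univ, true_imp_iff, funext_iff]

theorem tensorPow_transpose (r : ℕ) (M : Matrix n n R) :
    (tensorPow r M)ᵀ = tensorPow r Mᵀ := rfl

/-- The antisymmetric tensor of the maximal minors of an `n × r` matrix. -/
def minorTensor {r : ℕ} (v : Matrix n (Fin r) R) : (Fin r → n) → R :=
  fun f => (v.submatrix f id).det

theorem tensorPow_mulVec_minorTensor [Fintype n] {r : ℕ} (M : Matrix n n R)
    (v : Matrix n (Fin r) R) :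
    tensorPow r M *ᵥ minorTensor v = minorTensor (M * v) := by
  ext f
  simp only [mulVec, dotProduct, tensorPow, minorTensor, of_apply]
  simp_rw [← det_transpose (submatrix _ _ _), det_apply', Finset.mul_sum]
  rw [Finset.sum_comm]
  refine Finset.sum_congr rfl fun σ _ => ?_
  simp only [transpose_apply, submatrix_apply, id, mul_apply]
  rw [Finset.prod_univ_sum, Fintype.piFinset_univ, Finset.mul_sum]
  refine Finset.sum_congr rfl fun g _ => ?_
  rw [Finset.prod_mul_distrib]
  ring

/-- The derivation on `r`-fold tensors induced by a matrix. -/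
def tensorDerivation [DecidableEq n] (r : ℕ) : Matrix n n R →ₗ[R]
    Matrix (Fin r → n) (Fin r → n) R where
  toFun a := of fun f g =>
    ∑ s, a (f s) (g s) * ∏ t ∈ Finset.univ.erase s, (1 : Matrix n n R) (f t) (g t)
  map_add' a b := by
    ext f g
    simp [add_mul, Finset.sum_add_distrib]
  map_smul' c a := by
    ext f g
    simp [Finset.mul_sum, mul_assoc]

theorem tensorPow_diagonal_conj [Fintype n] [DecidableEq n] (r : ℕ) {u : Matrix n n R}
    (hu : uᵀ * u = 1) (α : n → R) :
    tensorPow r u * diagonal (fun f => ∑ s, α (f s)) * (tensorPow r u)ᵀ =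
      tensorDerivation r (u * diagonal α * uᵀ) := by
  have hu' : u * uᵀ = 1 := mul_eq_one_comm.1 hu
  have conj_apply : ∀ i k, (u * diagonal α * uᵀ) i k = ∑ y, u i y * α y * u k y := by
    intro i k
    rw [mul_apply]
    simp only [mul_diagonal, transpose_apply]
  ext f g
  rw [mul_apply]
  simp only [mul_diagonal, transpose_apply, tensorPow, tensorDerivation, of_apply,
    LinearMap.coe_mk, AddHom.coe_mk, Finset.mul_sum, Finset.sum_mul, conj_apply]
  rw [Finset.sum_comm]
  refine Finset.sum_congr rfl fun s _ => ?_
  have key : ∀ x : Fin r → n, (∏ t, u (f t) (x t)) * α (x s) * ∏ t, u (g t) (x t) =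
      ∏ t, (u (f t) (x t) * (if t = s then α (x t) else 1) * u (g t) (x t)) := by
    intro x
    rw [Finset.prod_mul_distrib, Finset.prod_mul_distrib, Finset.prod_ite_eq',
      if_pos (Finset.mem_univ s)]
  simp_rw [key]
  rw [← Fintype.piFinset_univ, ← Finset.prod_univ_sum (fun _ => Finset.univ)
    (fun t y => u (f t) y * (if t = s then α y else 1) * u (g t) y),
    ← Finset.mul_prod_erase _ _ (Finset.mem_univ s), Finset.sum_mul]
  simp only [if_true]
  refine Finset.sum_congr rfl fun y _ => ?_
  congr 1
  refine Finset.prod_congr rfl fun t ht => ?_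
  simp [Finset.ne_of_mem_erase ht, ← hu', mul_apply]

end TensorPower

section WeightInequality

variable {n J : Type*} [Fintype n] [DecidableEq n] [Fintype J]

theorem sum_nonneg_of_tensor_weights_le {r : ℕ} {u : J → Matrix n n ℝ}
    (hu : ∀ j, (u j)ᵀ * u j = 1) {α : J → n → ℝ}
    (hsum : ∑ j, u j * diagonal (α j) * (u j)ᵀ = 0) {ω : (Fin r → n) → ℝ} (hω : ω ≠ 0)
    {b : J → ℝ}
    (hb : ∀ j f, ((tensorPow r (u j))ᵀ *ᵥ ω) f ≠ 0 → ∑ s, α j (f s) ≤ b j) :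
    0 ≤ ∑ j, b j := by
  set η : J → (Fin r → n) → ℝ := fun j => (tensorPow r (u j))ᵀ *ᵥ ω with hη
  have hpos : 0 < ω ⬝ᵥ ω := by
    rw [← star_trivial ω]
    simpa using dotProduct_star_self_pos_iff.2 hω
  have hnorm : ∀ j, η j ⬝ᵥ η j = ω ⬝ᵥ ω := fun j => by
    rw [hη]
    simp only
    rw [dotProduct_mulVec, vecMul_transpose, mulVec_mulVec, tensorPow_transpose, tensorPow_mul,
      mul_eq_one_comm.1 (hu j), tensorPow_one, one_mulVec]
  have hweight : ∀ j, η j ⬝ᵥ (diagonal (fun f => ∑ s, α j (f s)) *ᵥ η j) =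
      ω ⬝ᵥ (tensorDerivation r (u j * diagonal (α j) * (u j)ᵀ) *ᵥ ω) := fun j => by
    rw [← tensorPow_diagonal_conj r (hu j), ← mulVec_mulVec, ← mulVec_mulVec]
    conv_rhs => rw [dotProduct_mulVec, ← mulVec_transpose]
  have hzero : ∑ j, η j ⬝ᵥ (diagonal (fun f => ∑ s, α j (f s)) *ᵥ η j) = 0 := by
    simp_rw [hweight]
    rw [← dotProduct_sum, ← sum_mulVec, ← map_sum, hsum, map_zero, zero_mulVec, dotProduct_zero]
  have hle : ∀ j, η j ⬝ᵥ (diagonal (fun f => ∑ s, α j (f s)) *ᵥ η j) ≤ b j * (ω ⬝ᵥ ω) := by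
    intro j
    rw [← hnorm j, dotProduct, dotProduct, Finset.mul_sum]
    refine Finset.sum_le_sum fun f _ => ?_
    rw [mulVec_diagonal]
    by_cases h0 : η j f = 0
    · simp [h0]
    · nlinarith [hb j f h0, mul_self_nonneg (η j f)]
  have := Finset.sum_le_sum fun j (_ : j ∈ Finset.univ) => hle j
  rw [hzero, ← Finset.sum_mul] at this
  exact nonneg_of_mul_nonneg_left this hpos

end WeightInequality

section Generic

theorem finite_setOf_not_injective {ρ κ : Type*} [Fintype ρ] [Fintype κ]
    (A : Matrix ρ κ (Polynomial ℝ)) (t₀ : ℝ)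
    (h : ¬ ∃ ω ≠ 0, A.map (Polynomial.eval t₀) *ᵥ ω = 0) :
    {t : ℝ | ∃ ω ≠ 0, A.map (Polynomial.eval t) *ᵥ ω = 0}.Finite := by
  classical
  have hdet : ∀ t, (Aᵀ * A).det.eval t = 0 ↔ ∃ ω ≠ 0, A.map (Polynomial.eval t) *ᵥ ω = 0 := by
    intro t
    have h1 : (Aᵀ * A).det.eval t =
        ((A.map (Polynomial.eval t))ᵀ * A.map (Polynomial.eval t)).det := by
      rw [← Polynomial.coe_evalRingHom, RingHom.map_det, RingHom.mapMatrix_apply, Matrix.map_mul,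
        transpose_map]
    rw [h1, ← exists_mulVec_eq_zero_iff]
    refine exists_congr fun ω => and_congr_right fun _ => ?_
    rw [← conjTranspose_eq_transpose_of_trivial, conjTranspose_mul_self_mulVec_eq_zero]
  have hp : (Aᵀ * A).det ≠ 0 := fun h0 => h ((hdet t₀).1 (by rw [h0, Polynomial.eval_zero]))
  refine (Polynomial.finite_setOfPred_isRoot hp).subset fun t ht => (hdet t).2 ht

variable {n J : Type*} [Fintype n]

/-- Some nonzero tensor has coordinates, with respect to the flags `G j`, supported in `S j`. -/
def HasTensorSupportedIn (r : ℕ) (G : J → Matrix n n ℝ) (S : J → Set (Fin r → n)) : Prop :=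
  ∃ ω : (Fin r → n) → ℝ, ω ≠ 0 ∧ ∀ j, ∀ f ∉ S j, ((tensorPow r (G j))ᵀ *ᵥ ω) f = 0

theorem finite_setOf_hasTensorSupportedIn [Fintype J] (r : ℕ)
    (G : J → Matrix n n (Polynomial ℝ)) (S : J → Set (Fin r → n)) (t₀ : ℝ)
    (h : ¬ HasTensorSupportedIn r (fun j => (G j).map (Polynomial.eval t₀)) S) :
    {t : ℝ | HasTensorSupportedIn r (fun j => (G j).map (Polynomial.eval t)) S}.Finite := by
  classical
  let A : Matrix (J × (Fin r → n)) (Fin r → n) (Polynomial ℝ) :=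
    of fun p g => if p.2 ∈ S p.1 then 0 else (tensorPow r (G p.1))ᵀ p.2 g
  have hA : ∀ t, HasTensorSupportedIn r (fun j => (G j).map (Polynomial.eval t)) S ↔
      ∃ ω ≠ 0, A.map (Polynomial.eval t) *ᵥ ω = 0 := by
    intro t
    refine exists_congr fun ω => and_congr_right fun _ => ?_
    rw [funext_iff, Prod.forall]
    refine forall_congr' fun j => forall_congr' fun f => ?_
    by_cases hf : f ∈ S j
    · simp [hf, A, mulVec, dotProduct]
    · simp [hf, A, mulVec, dotProduct, tensorPow, Polynomial.eval_prod]
  simp_rw [hA] at h ⊢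
  exact finite_setOf_not_injective A t₀ h

theorem exists_common_generic [Fintype J] [DecidableEq n] (N : ℕ) {G₀ G₁ : J → Matrix n n ℝ}
    (h₀ : ∀ j, (G₀ j).det ≠ 0) :
    ∃ G : J → Matrix n n ℝ, (∀ j, (G j).det ≠ 0) ∧ ∀ r ≤ N, ∀ S : J → Set (Fin r → n),
      HasTensorSupportedIn r G S →
        HasTensorSupportedIn r G₀ S ∧ HasTensorSupportedIn r G₁ S := by
  classical
  let P : J → Matrix n n (Polynomial ℝ) := fun j =>
    of fun a b => (1 - Polynomial.X) * Polynomial.C (G₀ j a b) +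
      Polynomial.X * Polynomial.C (G₁ j a b)
  have hP0 : (fun j => (P j).map (Polynomial.eval 0)) = G₀ := by
    ext j a b; simp [P]
  have hP1 : (fun j => (P j).map (Polynomial.eval 1)) = G₁ := by
    ext j a b; simp [P]
  have hdet : ∀ j, {t : ℝ | ((P j).map (Polynomial.eval t)).det = 0}.Finite := by
    intro j
    have := finite_setOf_not_injective (P j) 0 (by
      rw [exists_mulVec_eq_zero_iff, congrFun hP0 j]; exact h₀ j)
    simpa only [exists_mulVec_eq_zero_iff] using this
  have hbad : ∀ x : ℝ, (Set.Finite {t : ℝ | ∃ (r : Fin (N + 1)) (S : J → Set (Fin r → n)),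
      HasTensorSupportedIn r (fun j => (P j).map (Polynomial.eval t)) S ∧
      ¬ HasTensorSupportedIn r (fun j => (P j).map (Polynomial.eval x)) S}) := by
    intro x
    simp only [Set.ofPred_exists]
    refine Set.finite_iUnion fun r => Set.finite_iUnion fun S => ?_
    by_cases h : HasTensorSupportedIn r (fun j => (P j).map (Polynomial.eval x)) S
    · simp [h]
    · exact (finite_setOf_hasTensorSupportedIn r P S x h).subset fun t ht => ht.1
  obtain ⟨t, ht⟩ := ((Set.finite_iUnion hdet).union ((hbad 0).union (hbad 1))).exists_notMem
  simp only [Set.mem_union, not_or, Set.mem_iUnion, not_exists, Set.mem_ofPred_eq, not_and,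
    not_not] at ht
  refine ⟨fun j => (P j).map (Polynomial.eval t), ht.1, fun r hr S hS => ⟨?_, ?_⟩⟩
  · have := ht.2.1 ⟨r, Nat.lt_succ_of_le hr⟩ S hS
    rwa [hP0] at this
  · have := ht.2.2 ⟨r, Nat.lt_succ_of_le hr⟩ S hS
    rwa [hP1] at this

end Generic

section Greedy

theorem exists_greedy_columns {m : Type*} [Fintype m] [DecidableEq m] {n : ℕ}
    (N : Matrix m (Fin n) ℝ) {L : Matrix (Fin n) m ℝ} (hN : N * L = 1) :
    ∃ e : m → Fin n, (N.submatrix id e).det ≠ 0 ∧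
      ∀ (r : ℕ) (hr : r ≤ n), (N.submatrix id (Fin.castLE hr)).rank ≤
        (Finset.univ.filter fun p => (e p : ℕ) < r).card := by
  classical
  set I : Set (Fin n) := {l | N.col l ∉ Submodule.span ℝ (N.col '' {k | k < l})} with hI
  let T : ℕ → Set (Fin n) := fun r => I ∩ {l | (l : ℕ) < r}
  have claim : ∀ r ≤ n, LinearIndepOn ℝ N.col (T r) ∧
      N.col '' {l | (l : ℕ) < r} ⊆ Submodule.span ℝ (N.col '' (T r)) := by
    intro r
    induction r with
    | zero => intro _; simp [T, linearIndepOn_empty]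
    | succ r ih =>
      intro hr
      obtain ⟨h1, h2⟩ := ih (by omega)
      let x : Fin n := ⟨r, by omega⟩
      have hlt : {l : Fin n | (l : ℕ) < r + 1} = insert x {l : Fin n | (l : ℕ) < r} := by
        ext l; simp [x, Fin.ext_iff]; omega
      have hx : {k | k < x} = {l : Fin n | (l : ℕ) < r} := by
        ext l; simp [x, Fin.lt_def]
      have hmono : Submodule.span ℝ (N.col '' (T r)) ≤ Submodule.span ℝ (N.col '' (T (r + 1))) :=
        Submodule.span_mono (Set.image_mono fun l hl => ⟨hl.1, Nat.lt_succ_of_lt hl.2⟩)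
      have hsame : Submodule.span ℝ (N.col '' {l : Fin n | (l : ℕ) < r}) =
          Submodule.span ℝ (N.col '' (T r)) :=
        le_antisymm (Submodule.span_le.2 h2)
          (Submodule.span_mono (Set.image_mono Set.inter_subset_right))
      by_cases hxI : x ∈ I
      · have hT : T (r + 1) = insert x (T r) := by
          simp only [T]
          rw [hlt, Set.inter_insert_of_mem hxI]
        have hxs : N.col x ∉ Submodule.span ℝ (N.col '' (T r)) := by
          rw [← hsame, ← hx]; exact hxI
        refine ⟨hT ▸ h1.insert hxs, ?_⟩
        rw [hlt, Set.image_insert_eq, Set.insert_subset_iff]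
        refine ⟨Submodule.subset_span ⟨x, hT ▸ Set.mem_insert _ _, rfl⟩, h2.trans hmono⟩
      · have hT : T (r + 1) = T r := by
          simp only [T]
          rw [hlt, Set.inter_insert_of_notMem hxI]
        have hxs : N.col x ∈ Submodule.span ℝ (N.col '' (T r)) := by
          rw [← hsame, ← hx]; simpa [hI] using hxI
        rw [hT]
        refine ⟨h1, ?_⟩
        rw [hlt, Set.image_insert_eq, Set.insert_subset_iff]
        exact ⟨hxs, h2⟩
  have hTn : T n = I := by
    ext l; simp [T]
  obtain ⟨hli, hsp⟩ := claim n le_rfl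
  rw [hTn] at hli hsp
  have htop : ⊤ ≤ Submodule.span ℝ (Set.range fun l : I => N.col l) := by
    intro v _
    have hv : v = ∑ l, (L *ᵥ v) l • N.col l := by
      have : N *ᵥ (L *ᵥ v) = v := by rw [mulVec_mulVec, hN, one_mulVec]
      conv_lhs => rw [← this, mulVec_eq_sum]
      simp
      rfl
    rw [hv]
    refine Submodule.sum_mem _ fun l _ => Submodule.smul_mem _ _ ?_
    have := hsp ⟨l, l.2, rfl⟩
    rwa [Set.image_eq_range] at this
  have hcard : Fintype.card m = Fintype.card I := by
    have := (Module.finrank_eq_card_basis (Module.Basis.mk hli htop))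
    rwa [Module.finrank_fintype_fun_eq_card] at this
  let e : m ≃ I := Fintype.equivOfCardEq hcard
  refine ⟨fun p => e p, ?_, fun r hr => ?_⟩
  · have h3 : LinearIndependent ℝ (N.submatrix id fun p => (e p : Fin n)).col := by
      have := hli.comp e e.injective
      exact this
    exact ((Matrix.isUnit_iff_isUnit_det _).1
      (Matrix.linearIndependent_cols_iff_isUnit.1 h3)).ne_zero
  · rw [rank_eq_finrank_span_cols]
    have h4 : Submodule.span ℝ (Set.range (N.submatrix id (Fin.castLE hr)).col) ≤
        Submodule.span ℝ (N.col '' (T r)) := by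
      rw [Submodule.span_le]
      rintro _ ⟨q, rfl⟩
      exact (claim r hr).2 ⟨Fin.castLE hr q, q.2, rfl⟩
    refine (Submodule.finrank_mono h4).trans ?_
    have h5 : N.col '' (T r) = (((Finset.univ.filter fun p => (e p : ℕ) < r).image
        fun p => N.col (e p)) : Set (m → ℝ)) := by
      ext v
      simp only [Set.mem_image, Finset.coe_image, Finset.coe_filter, Finset.mem_univ, true_and]
      constructor
      · rintro ⟨l, ⟨hl, hlr⟩, rfl⟩
        exact ⟨e.symm ⟨l, hl⟩, by simpa using hlr, by simp⟩
      · rintro ⟨p, hp, rfl⟩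
        exact ⟨e p, ⟨(e p).2, hp⟩, rfl⟩
    rw [h5]
    exact (finrank_span_finset_le_card _).trans Finset.card_image_le

end Greedy

section Rank

theorem card_filter_le_rank {m k : Type*} [Fintype m] {r : ℕ} (A : Matrix m (Fin r) ℝ)
    (f : Fin r → k)
    (q : k → Prop) [DecidablePred q] (ι : m → k) (B : Matrix k (Fin r) ℝ)
      (hB : A = B.submatrix ι id)
    (hι : ∀ x, q x → ∃ y, ι y = x) (hf : (B.submatrix f id).det ≠ 0) :
    (Finset.univ.filter fun s => q (f s)).card ≤ A.rank := by
  have hli : LinearIndependent ℝ (B.submatrix f id).row :=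
    Matrix.linearIndependent_rows_iff_isUnit.2
      ((Matrix.isUnit_iff_isUnit_det _).2 (isUnit_iff_ne_zero.2 hf))
  choose y hy using fun s : {s // q (f s)} => hι (f s) s.2
  have h2 : LinearIndependent ℝ (A.submatrix y id).row := by
    have h3 := hli.comp (Subtype.val : {s // q (f s)} → Fin r) Subtype.val_injective
    convert h3 using 2 with s
    ext c
    simp [hB, hy, Matrix.row]
    rfl
  have h4 := h2.rank_matrix
  rw [Fintype.card_subtype] at h4
  rw [← h4]
  exact rank_submatrix_le _ _ _

end Rank

section Flags

theorem eq_last_add_sum_gaps {m : ℕ} (x : Fin (m + 1) → ℝ) (l : Fin (m + 1)) :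
    x l = x (Fin.last m) +
      ∑ i : Fin m, if l ≤ i.castSucc then x i.castSucc - x i.succ else 0 := by
  induction m with
  | zero => simp [Fin.fin_one_eq_zero l]
  | succ m ih =>
    rw [Fin.sum_univ_castSucc]
    induction l using Fin.lastCases with
    | last => simp [Fin.not_le.2 (Fin.castSucc_lt_last _)]
    | cast l =>
      have := ih (fun k => x k.castSucc) l
      simp only [Fin.castSucc_le_castSucc_iff, Fin.le_last, if_true, Fin.succ_castSucc,
        Fin.succ_last]
      rw [this]
      ring

/-- The first `i + 1` columns of a square matrix, spanning the `i`-th member of its column flag. -/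
def flagFrame {m : ℕ} (G : Matrix (Fin (m + 1)) (Fin (m + 1)) ℝ) (i : Fin m) :
    Matrix (Fin (m + 1)) {l : Fin (m + 1) // l ≤ i.castSucc} ℝ :=
  G.submatrix id Subtype.val

theorem minorTensor_submatrix_castLE_ne_zero {n r : ℕ} (hr : r ≤ n) {u : Matrix (Fin n) (Fin n) ℝ}
    (hu : uᵀ * u = 1) : minorTensor (u.submatrix id (Fin.castLE hr)) ≠ 0 := by
  intro h
  have h1 := congrFun (tensorPow_mulVec_minorTensor uᵀ (u.submatrix id (Fin.castLE hr)))
    (Fin.castLE hr)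
  have h2 : uᵀ * u.submatrix id (Fin.castLE hr) =
    (1 : Matrix _ _ ℝ).submatrix id (Fin.castLE hr) := by
    rw [← hu]; rfl
  rw [h, mulVec_zero, h2, minorTensor, submatrix_submatrix, Function.id_comp, Function.comp_id,
    submatrix_one _ (Fin.castLE_injective hr), det_one] at h1
  exact zero_ne_one h1

theorem sum_gap_mul_rank_nonneg {J : Type*} [Fintype J] {m : ℕ}
    {G G₀ : J → Matrix (Fin (m + 1)) (Fin (m + 1)) ℝ} {r : ℕ} (hr : r ≤ m + 1)
    (hG : ∀ S, HasTensorSupportedIn r G S → HasTensorSupportedIn r G₀ S)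
    (hG₀ : ∀ j, (G₀ j)ᵀ * G₀ j = 1) {α : J → Fin (m + 1) → ℝ} (hα : ∀ j, Antitone (α j))
    (hsum : ∑ j, G₀ j * diagonal (α j) * (G₀ j)ᵀ = 0)
    {u : Matrix (Fin (m + 1)) (Fin (m + 1)) ℝ} (hu : uᵀ * u = 1) :
    0 ≤ ∑ j, (∑ i : Fin m, (α j i.castSucc - α j i.succ) *
      ((((flagFrame (G j) i)ᵀ * u).submatrix id (Fin.castLE hr)).rank : ℝ) +
        α j (Fin.last m) * r) := by
  classical
  set v := u.submatrix id (Fin.castLE hr) with hv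
  have h1 : HasTensorSupportedIn r G fun j => {f | minorTensor ((G j)ᵀ * v) f ≠ 0} := by
    refine ⟨minorTensor v, minorTensor_submatrix_castLE_ne_zero hr hu, fun j f hf => ?_⟩
    rw [tensorPow_transpose, tensorPow_mulVec_minorTensor]
    exact not_not.1 hf
  obtain ⟨ω, hω, hS⟩ := hG _ h1
  refine sum_nonneg_of_tensor_weights_le hG₀ hsum hω fun j f hf => ?_
  have hfS : minorTensor ((G j)ᵀ * v) f ≠ 0 := by
    by_contra hc
    exact hf (hS j f fun h => h hc)
  calc ∑ s, α j (f s) = ∑ i : Fin m, (α j i.castSucc - α j i.succ) *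
        ((Finset.univ.filter fun s => f s ≤ i.castSucc).card : ℝ) + α j (Fin.last m) * r := by
        rw [Finset.sum_congr rfl fun s _ => eq_last_add_sum_gaps (α j) (f s),
          Finset.sum_add_distrib, Finset.sum_comm, add_comm]
        congr 1
        · refine Finset.sum_congr rfl fun i _ => ?_
          rw [← Finset.sum_filter, Finset.sum_const, nsmul_eq_mul, mul_comm]
        · simp [mul_comm]
    _ ≤ _ := by
        gcongr with i
        · exact sub_nonneg.2 (hα j (Fin.castSucc_lt_succ).le)
        · exact card_filter_le_rank _ f (fun l => l ≤ i.castSucc) Subtype.val ((G j)ᵀ * v) rfl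
            (fun x hx => ⟨⟨x, hx⟩, rfl⟩) hfS

theorem sum_conj_diagonal_trace {J : Type*} [Fintype J] {n : ℕ}
    {u : J → Matrix (Fin n) (Fin n) ℝ} (hu : ∀ j, (u j)ᵀ * u j = 1) {α : J → Fin n → ℝ}
    (hsum : ∑ j, u j * diagonal (α j) * (u j)ᵀ = 0) : ∑ j, ∑ l, α j l = 0 := by
  have h := congrArg trace hsum
  rw [trace_sum, trace_zero] at h
  rw [← h]
  refine Finset.sum_congr rfl fun j _ => ?_
  rw [trace_mul_comm, ← Matrix.mul_assoc, hu, Matrix.one_mul, trace_diagonal]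

end Flags

section Determinant

variable {ι : Type*} [Fintype ι] [DecidableEq ι]

theorem one_le_det_one_add {P : Matrix ι ι ℝ} (hP : P.PosSemidef) : 1 ≤ (1 + P).det := by
  obtain ⟨u, d, hu, hPd, hd⟩ := exists_orthogonal_diagonalization
    (a := P) (by rw [IsSymm, ← conjTranspose_eq_transpose_of_trivial]; exact hP.1)
  have h1 : 1 + P = u * diagonal (1 + d) * uᵀ := by
    have h2 : diagonal (1 + d) = 1 + diagonal d := by
      rw [← diagonal_one, diagonal_add]; rfl
    rw [h2, mul_add, add_mul, Matrix.mul_one, mul_eq_one_comm.1 hu, ← hPd]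
  rw [h1, det_mul, det_mul, det_transpose, mul_right_comm, ← sq, det_sq_of_orthogonal hu, one_mul,
    det_diagonal]
  refine Finset.prod_induction _ (fun x => 1 ≤ x) (fun _ _ => one_le_mul_of_one_le_of_one_le) le_rfl
    fun i _ => ?_
  have := hP.eigenvalues_nonneg i
  rw [← hd hP.1] at this
  simpa using this

theorem det_mul_transpose_le_det_add {M P : Matrix ι ι ℝ} (hM : M.det ≠ 0) (hP : P.PosSemidef) :
    (M * Mᵀ).det ≤ (M * Mᵀ + P).det := by
  have hu : IsUnit M.det := isUnit_iff_ne_zero.2 hM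
  have hut : IsUnit Mᵀ.det := by rwa [det_transpose]
  have h1 : M * Mᵀ + P = M * (1 + M⁻¹ * P * (M⁻¹)ᵀ) * Mᵀ := by
    rw [mul_add, add_mul, Matrix.mul_one, transpose_nonsing_inv]
    congr 1
    rw [Matrix.mul_assoc M⁻¹, mul_nonsing_inv_cancel_left _ _ hu,
      nonsing_inv_mul_cancel_right _ _ hut]
  have h2 : (M⁻¹ * P * (M⁻¹)ᵀ).PosSemidef := by
    rw [← conjTranspose_eq_transpose_of_trivial]
    exact hP.mul_mul_conjTranspose_same _
  rw [h1, det_mul, det_mul, det_mul, mul_right_comm]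
  refine le_mul_of_one_le_right ?_ (one_le_det_one_add h2)
  rw [det_transpose]
  exact mul_self_nonneg _

theorem prod_mul_det_sq_le_det {n : Type*} [Fintype n] [DecidableEq n] (N : Matrix ι n ℝ)
    (e : ι → n) (hN : (N.submatrix id e).det ≠ 0) {d : n → ℝ} (hd : ∀ l, 0 < d l) :
    (∏ p, d (e p)) * (N.submatrix id e).det ^ 2 ≤ (N * diagonal d * Nᵀ).det := by
  have he : Function.Injective e := by
    intro p q hpq
    by_contra hne
    exact hN (det_zero_of_column_eq hne fun i => by simp [hpq])
  set M := N.submatrix id e * diagonal (fun p => √(d (e p))) with hMdef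
  have hMM : M * Mᵀ = N.submatrix id e * diagonal (fun p => d (e p)) * (N.submatrix id e)ᵀ := by
    rw [hMdef, transpose_mul, diagonal_transpose, Matrix.mul_assoc, ← Matrix.mul_assoc (diagonal _),
      diagonal_mul_diagonal, ← Matrix.mul_assoc]
    simp [Real.mul_self_sqrt (hd _).le]
  have hM : M.det ≠ 0 := by
    rw [hMdef, det_mul, det_diagonal]
    exact mul_ne_zero hN (Finset.prod_ne_zero_iff.2 fun p _ => (Real.sqrt_pos.2 (hd _)).ne')
  set P := N * diagonal (fun l => if l ∈ Finset.univ.image e then 0 else d l) * Nᵀ with hPdef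
  have hP : P.PosSemidef := by
    rw [hPdef, ← conjTranspose_eq_transpose_of_trivial]
    refine (PosSemidef.diagonal fun l => ?_).mul_mul_conjTranspose_same _
    simp only [Pi.zero_apply]
    split_ifs
    exacts [le_rfl, (hd l).le]
  have hsum : N * diagonal d * Nᵀ = M * Mᵀ + P := by
    rw [hMM, hPdef]
    ext i j
    rw [Matrix.add_apply, mul_apply, mul_apply, mul_apply]
    simp only [mul_diagonal, transpose_apply, submatrix_apply, id]
    rw [← Finset.sum_image (f := fun l => N i l * d l * N j l) (g := e) fun p _ q _ h => he h]
    rw [← Finset.sum_filter_add_sum_filter_not Finset.univ (fun l => l ∈ Finset.univ.image e)]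
    congr 1
    · rw [Finset.filter_mem_eq_inter, Finset.univ_inter]
    · rw [Finset.sum_filter]
      refine Finset.sum_congr rfl fun l _ => ?_
      split_ifs <;> simp_all
  calc _ = (M * Mᵀ).det := by
        rw [hMM, det_mul, det_mul, det_transpose, det_diagonal]; ring
    _ ≤ _ := by rw [hsum]; exact det_mul_transpose_le_det_add hM hP

end Determinant

section LowerBound

variable {κ : Type*} [Fintype κ] {ι : κ → Type*} [∀ k, Fintype (ι k)]

theorem weighted_sum_nonneg {m : ℕ} {w : κ → ℝ} {c : ℝ} {e : ∀ k, ι k → Fin (m + 1)}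
    (hpart : ∀ r ≤ m + 1,
      0 ≤ ∑ k, w k * ((Finset.univ.filter fun p => (e k p : ℕ) < r).card : ℝ) + c * r)
    (htot : ∑ k, w k * (Fintype.card (ι k) : ℝ) + c * (m + 1) = 0)
    {x : Fin (m + 1) → ℝ} (hx : Antitone x) :
    0 ≤ ∑ k, w k * ∑ p, x (e k p) + c * ∑ l, x l := by
  have hgap : ∀ k, ∑ p, x (e k p) = x (Fin.last m) * Fintype.card (ι k) +
      ∑ i : Fin m, (x i.castSucc - x i.succ) *
        ((Finset.univ.filter fun p => (e k p : ℕ) < i + 1).card : ℝ) := by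
    intro k
    rw [Finset.sum_congr rfl fun p _ => eq_last_add_sum_gaps x (e k p), Finset.sum_add_distrib,
      Finset.sum_comm]
    congr 1
    · simp [mul_comm]
    · refine Finset.sum_congr rfl fun i _ => ?_
      rw [← Finset.sum_filter, Finset.sum_const, nsmul_eq_mul, mul_comm]
      simp only [Fin.le_def, Fin.val_castSucc, Nat.lt_succ_iff]
  have hid : ∑ l, x l = x (Fin.last m) * (m + 1) + ∑ i : Fin m, (x i.castSucc - x i.succ) *
      ((i : ℝ) + 1) := by
    rw [Finset.sum_congr rfl fun p _ => eq_last_add_sum_gaps x p, Finset.sum_add_distrib,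
      Finset.sum_comm]
    congr 1
    · simp [mul_comm]
    · refine Finset.sum_congr rfl fun i _ => ?_
      rw [← Finset.sum_filter, Finset.sum_const, nsmul_eq_mul, mul_comm]
      congr 1
      have : (Finset.univ.filter fun l => l ≤ i.castSucc) = Finset.Iic i.castSucc := by ext; simp
      rw [this, Fin.card_Iic]
      simp
  have key : ∑ k, w k * ∑ p, x (e k p) + c * ∑ l, x l =
      x (Fin.last m) * (∑ k, w k * (Fintype.card (ι k) : ℝ) + c * (m + 1)) +
      ∑ i : Fin m, (x i.castSucc - x i.succ) *
        (∑ k, w k * ((Finset.univ.filter fun p => (e k p : ℕ) < i + 1).card : ℝ) +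
          c * ((i + 1 : ℕ) : ℝ)) := by
    have h1 : ∑ k, w k * ∑ p, x (e k p) = x (Fin.last m) * ∑ k, w k * (Fintype.card (ι k) : ℝ) +
        ∑ i : Fin m, (x i.castSucc - x i.succ) *
          ∑ k, w k * ((Finset.univ.filter fun p => (e k p : ℕ) < i + 1).card : ℝ) := by
      simp only [hgap, mul_add, Finset.sum_add_distrib, Finset.mul_sum]
      rw [Finset.sum_comm (γ := Fin m)]
      simp only [mul_left_comm]
    have h2 : c * ∑ i : Fin m, (x i.castSucc - x i.succ) * ((i : ℝ) + 1) =
        ∑ i : Fin m, (x i.castSucc - x i.succ) * (c * ((i + 1 : ℕ) : ℝ)) := by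
      rw [Finset.mul_sum]
      exact Finset.sum_congr rfl fun i _ => by push_cast; ring
    rw [h1, hid, mul_add c, h2]
    simp only [mul_add, Finset.sum_add_distrib]
    ring
  rw [key, htot, mul_zero, zero_add]
  refine Finset.sum_nonneg fun i _ => mul_nonneg ?_ (hpart _ (by omega))
  exact sub_nonneg.2 (hx (Fin.castSucc_lt_succ).le)

variable [∀ k, DecidableEq (ι k)] {n : Type*} [Fintype n] [DecidableEq n]

/-- The potential `∑ w_k log det (F_kᵀ h F_k) + c log det h` on positive definite matrices. -/
noncomputable def logPotential (w : κ → ℝ) (c : ℝ) (F : ∀ k, Matrix n (ι k) ℝ)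
    (h : Matrix n n ℝ) : ℝ :=
  ∑ k, w k * Real.log ((F k)ᵀ * h * F k).det + c * Real.log h.det

theorem exists_le_logPotential {m : ℕ} {w : κ → ℝ} (hw : ∀ k, 0 ≤ w k) {c : ℝ}
    {F : ∀ k, Matrix (Fin (m + 1)) (ι k) ℝ} {E : ∀ k, Matrix (ι k) (Fin (m + 1)) ℝ}
    (hEF : ∀ k, E k * F k = 1)
    (hrank : ∀ u : Matrix (Fin (m + 1)) (Fin (m + 1)) ℝ, uᵀ * u = 1 → ∀ r (hr : r ≤ m + 1),
      0 ≤ ∑ k, w k * ((((F k)ᵀ * u).submatrix id (Fin.castLE hr)).rank : ℝ) + c * r)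
    (htot : ∑ k, w k * (Fintype.card (ι k) : ℝ) + c * (m + 1) = 0) :
    ∃ C : ℝ, ∀ (u : Matrix (Fin (m + 1)) (Fin (m + 1)) ℝ) (d : Fin (m + 1) → ℝ), uᵀ * u = 1 →
      Antitone d → (∀ i, 0 < d i) → C ≤ logPotential w c F (u * diagonal d * uᵀ) := by
  suffices H : ∃ C : ℝ, ∀ u ∈ {u : Matrix (Fin (m + 1)) (Fin (m + 1)) ℝ | uᵀ * u = 1}, uᵀ * u = 1 →
      ∀ d : Fin (m + 1) → ℝ, Antitone d → (∀ i, 0 < d i) →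
        C ≤ logPotential w c F (u * diagonal d * uᵀ) by
    obtain ⟨C, hC⟩ := H
    exact ⟨C, fun u d hu => hC u hu hu d⟩
  refine IsCompact.induction_on
    (p := fun s => ∃ C : ℝ, ∀ u ∈ s, uᵀ * u = 1 →
      ∀ d : Fin (m + 1) → ℝ, Antitone d → (∀ i, 0 < d i) →
        C ≤ logPotential w c F (u * diagonal d * uᵀ)) isCompact_orthogonal ⟨0, by simp⟩ ?_ ?_ ?_
  · rintro s t hst ⟨C, hC⟩
    exact ⟨C, fun u hu => hC u (hst hu)⟩
  · rintro s t ⟨C, hC⟩ ⟨C', hC'⟩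
    refine ⟨min C C', fun u hu huo d hd hd0 => ?_⟩
    rcases hu with hu | hu
    · exact (min_le_left _ _).trans (hC u hu huo d hd hd0)
    · exact (min_le_right _ _).trans (hC' u hu huo d hd hd0)
  · intro u₀ hu₀
    have hgreedy : ∀ k, ∃ e : ι k → Fin (m + 1), (((F k)ᵀ * u₀).submatrix id e).det ≠ 0 ∧
        ∀ (r : ℕ) (hr : r ≤ m + 1), (((F k)ᵀ * u₀).submatrix id (Fin.castLE hr)).rank ≤
          (Finset.univ.filter fun p => (e p : ℕ) < r).card := by
      intro k
      refine exists_greedy_columns _ (L := u₀ᵀ * (E k)ᵀ) ?_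
      rw [Matrix.mul_assoc, ← Matrix.mul_assoc u₀, mul_eq_one_comm.1 hu₀, Matrix.one_mul,
        ← transpose_mul, hEF, transpose_one]
    choose e he1 he2 using hgreedy
    let δ : κ → ℝ := fun k => (((F k)ᵀ * u₀).submatrix id (e k)).det ^ 2
    have hδ : ∀ k, 0 < δ k := fun k => by have := he1 k; positivity
    refine ⟨{u | ∀ k, δ k / 2 < (((F k)ᵀ * u).submatrix id (e k)).det ^ 2}, ?_,
      ∑ k, w k * Real.log (δ k / 2), ?_⟩
    · refine mem_nhdsWithin_of_mem_nhds (Filter.eventually_all.2 fun k => ?_)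
      have hcont : Continuous fun u : Matrix (Fin (m + 1)) (Fin (m + 1)) ℝ =>
          (((F k)ᵀ * u).submatrix id (e k)).det ^ 2 := by fun_prop
      exact hcont.continuousAt.eventually_const_lt (half_lt_self (hδ k))
    · intro u hu huo d hd hd0
      have hlog : Antitone fun l => Real.log (d l) := fun i j hij =>
        Real.log_le_log (hd0 j) (hd hij)
      have hnn := weighted_sum_nonneg (e := e) (w := w) (c := c) (fun r hr =>
        (hrank u₀ hu₀ r hr).trans (by
          gcongr with k
          · exact hw k
          · exact he2 k r hr)) htot hlog
      have hdet : (u * diagonal d * uᵀ).det = ∏ l, d l := by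
        rw [det_mul, det_mul, det_transpose, mul_right_comm, ← sq, det_sq_of_orthogonal huo,
          one_mul, det_diagonal]
      have hk : ∀ k, Real.log (δ k / 2) + ∑ p, Real.log (d (e k p)) ≤
          Real.log ((F k)ᵀ * (u * diagonal d * uᵀ) * F k).det := by
        intro k
        have hne : (((F k)ᵀ * u).submatrix id (e k)).det ≠ 0 := fun h0 => by
          have := hu k
          rw [h0] at this
          have := hδ k
          norm_num at *
          linarith
        rw [← Real.log_prod fun p _ => (hd0 _).ne', ← Real.log_mul (by have := hδ k; positivity)
          (Finset.prod_ne_zero_iff.2 fun p _ => (hd0 _).ne')]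
        have hpr : 0 < ∏ p, d (e k p) := Finset.prod_pos fun p _ => hd0 _
        refine Real.log_le_log (mul_pos (half_pos (hδ k)) hpr) ?_
        have h3 := prod_mul_det_sq_le_det ((F k)ᵀ * u) (e k) hne hd0
        have h4 : (F k)ᵀ * u * diagonal d * ((F k)ᵀ * u)ᵀ =
            (F k)ᵀ * (u * diagonal d * uᵀ) * F k := by
          simp only [transpose_mul, transpose_transpose, Matrix.mul_assoc]
        rw [h4] at h3
        refine le_trans ?_ h3
        rw [mul_comm]
        exact mul_le_mul_of_nonneg_left (hu k).le hpr.le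
      rw [logPotential, hdet, Real.log_prod fun p _ => (hd0 _).ne']
      calc ∑ k, w k * Real.log (δ k / 2) ≤ ∑ k, w k * Real.log (δ k / 2) +
            (∑ k, w k * ∑ p, Real.log (d (e k p)) + c * ∑ l, Real.log (d l)) := by linarith
        _ = ∑ k, w k * (Real.log (δ k / 2) + ∑ p, Real.log (d (e k p))) +
            c * ∑ l, Real.log (d l) := by
          simp only [mul_add, Finset.sum_add_distrib]; ring
        _ ≤ _ := by
          gcongr with k
          · exact hw k
          · exact hk k

end LowerBound

section PosDefCone

theorem posDef_orthogonal_conj {n : Type*} [Fintype n] [DecidableEq n] {u : Matrix n n ℝ}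
    (hu : uᵀ * u = 1) {d : n → ℝ} (hd : ∀ i, 0 < d i) : (u * diagonal d * uᵀ).PosDef := by
  have h := (PosDef.diagonal hd).conjTranspose_mul_mul_same (B := uᵀ)
    (mulVec_injective_of_isUnit ((Matrix.isUnit_iff_isUnit_det _).2 (by
      rw [det_transpose, isUnit_iff_ne_zero]
      intro h0
      have := det_sq_of_orthogonal hu
      simp [h0] at this)))
  rwa [conjTranspose_eq_transpose_of_trivial, transpose_transpose] at h

variable {n : ℕ} {h : Matrix (Fin n) (Fin n) ℝ}

theorem exists_eq_transpose_mul_self (hh : h.PosDef) :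
    ∃ g : Matrix (Fin n) (Fin n) ℝ, g.det ≠ 0 ∧ h = gᵀ * g := by
  obtain ⟨u, d, hu, -, hd, rfl⟩ := exists_sorted_diagonalization hh
  have h1 : u * diagonal d * uᵀ =
      (diagonal (fun i => √(d i)) * uᵀ)ᵀ * (diagonal (fun i => √(d i)) * uᵀ) := by
    rw [transpose_mul, diagonal_transpose, transpose_transpose, ← Matrix.mul_assoc,
      Matrix.mul_assoc u (diagonal fun i => √(d i)), diagonal_mul_diagonal]
    simp [Real.mul_self_sqrt (hd _).le]
  refine ⟨_, fun h0 => ?_, h1⟩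
  have := hh.det_pos
  rw [h1, det_mul, h0, mul_zero] at this
  exact lt_irrefl _ this

theorem eventually_posDef_add_smul (hh : h.PosDef) {y : Matrix (Fin n) (Fin n) ℝ} (hy : y.IsSymm) :
    ∀ᶠ s in nhds (0 : ℝ), (h + s • y).PosDef := by
  obtain ⟨g, hg, rfl⟩ := exists_eq_transpose_mul_self hh
  have hu : IsUnit g.det := isUnit_iff_ne_zero.2 hg
  have hut : IsUnit gᵀ.det := by rwa [det_transpose]
  obtain ⟨v, x, hv, hx, -⟩ := exists_orthogonal_diagonalization (a := (g⁻¹)ᵀ * y * g⁻¹) (by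
    rw [IsSymm, transpose_mul, transpose_mul, transpose_transpose, hy.eq, Matrix.mul_assoc])
  have hpos : ∀ᶠ s in nhds (0 : ℝ), ∀ i, 0 < 1 + s * x i := by
    refine Filter.eventually_all.2 fun i => ?_
    have hc : Continuous fun s : ℝ => 1 + s * x i := by fun_prop
    exact hc.continuousAt.eventually_const_lt (by simp)
  filter_upwards [hpos] with s hs
  have h1 : gᵀ * g + s • y = gᵀ * (v * diagonal (fun i => 1 + s * x i) * vᵀ) * g := by
    have h2 : diagonal (fun i => 1 + s * x i) = 1 + s • diagonal x := by
      rw [← diagonal_one, ← diagonal_smul, diagonal_add]; rfl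
    rw [h2, mul_add, add_mul, Matrix.mul_one, mul_eq_one_comm.1 hv, Matrix.mul_smul, Matrix.smul_mul,
      ← hx,
      mul_add, add_mul, Matrix.mul_one, Matrix.mul_smul, Matrix.smul_mul, transpose_nonsing_inv]
    congr 2
    rw [Matrix.mul_assoc (gᵀ)⁻¹, mul_nonsing_inv_cancel_left _ _ hut,
      nonsing_inv_mul_cancel_right _ _ hu]
  rw [h1, ← conjTranspose_eq_transpose_of_trivial]
  exact (posDef_orthogonal_conj hv hs).conjTranspose_mul_mul_same
    (mulVec_injective_of_isUnit ((Matrix.isUnit_iff_isUnit_det _).2 hu))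

theorem hasDerivAt_log_det {ι : Type*} [Fintype ι] [DecidableEq ι] {A : Matrix ι ι ℝ}
    (hA : A.det ≠ 0) (Y : Matrix ι ι ℝ) :
    HasDerivAt (fun s : ℝ => Real.log (A + s • Y).det) (A⁻¹ * Y).trace 0 := by
  let p : Polynomial ℝ := (1 + (Polynomial.X : Polynomial ℝ) • (A⁻¹ * Y).map Polynomial.C).det
  have hp : ∀ s, (A + s • Y).det = A.det * p.eval s := by
    intro s
    have h1 : p.eval s = (1 + s • (A⁻¹ * Y)).det := by
      rw [← Polynomial.coe_evalRingHom, RingHom.map_det]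
      congr 1
      ext i j
      by_cases hij : i = j <;> simp [hij, -Matrix.map_mul, mul_comm s]
    rw [h1, ← det_mul, mul_add, Matrix.mul_one, Matrix.mul_smul,
      mul_nonsing_inv_cancel_left _ _ (isUnit_iff_ne_zero.2 hA)]
  have h2 : HasDerivAt (fun s : ℝ => (A + s • Y).det) (A.det * (A⁻¹ * Y).trace) 0 := by
    simp only [hp]
    rw [← derivative_det_one_add_X_smul]
    exact (p.hasDerivAt 0).const_mul _
  have h3 := h2.log (by simpa using hA)
  convert h3 using 1
  simp only [zero_smul, add_zero]
  field_simp

/-- A lower bounded continuous function on the positive definite cone, penalized by a multiple of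
`tr h - log det h`, attains its minimum. -/
theorem exists_min_penalized {φ : Matrix (Fin n) (Fin n) ℝ → ℝ}
    (hφ : ContinuousOn φ {h | h.PosDef}) {C : ℝ}
      (hC : ∀ h : Matrix (Fin n) (Fin n) ℝ, h.PosDef → C ≤ φ h)
    {ε : ℝ} (hε : 0 < ε) : ∃ h₀ : Matrix (Fin n) (Fin n) ℝ, h₀.PosDef ∧
      ∀ h : Matrix (Fin n) (Fin n) ℝ, h.PosDef →
        φ h₀ + ε * (h₀.trace - Real.log h₀.det) ≤ φ h + ε * (h.trace - Real.log h.det) := by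
  set ψ : Matrix (Fin n) (Fin n) ℝ → ℝ := fun h => φ h + ε * (h.trace - Real.log h.det) with hψ
  have hψc : ContinuousOn ψ {h | h.PosDef} := by
    refine hφ.add (continuousOn_const.mul (Continuous.continuousOn (by fun_prop) |>.sub ?_))
    exact ContinuousOn.log (Continuous.continuousOn (by fun_prop)) fun h hh =>
      (PosDef.det_pos hh).ne'
  set R : ℝ := (ψ 1 - C) / ε with hR
  let q : Matrix (Fin n) (Fin n) ℝ × (Fin n → ℝ) → Matrix (Fin n) (Fin n) ℝ :=
    fun z => z.1 * diagonal z.2 * z.1ᵀ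
  let K : Set (Matrix (Fin n) (Fin n) ℝ × (Fin n → ℝ)) :=
    {u | uᵀ * u = 1} ×ˢ Set.univ.pi fun _ => Set.Icc (Real.exp (-R)) (2 * R)
  have hK : IsCompact K := isCompact_orthogonal.prod (isCompact_univ_pi fun _ => isCompact_Icc)
  have hpos : ∀ z ∈ K, (q z).PosDef := fun z hz =>
    posDef_orthogonal_conj hz.1 fun i => (Real.exp_pos _).trans_le (hz.2 i trivial).1
  have hqc : Continuous q := by fun_prop
  have hmem : ∀ h : Matrix (Fin n) (Fin n) ℝ, h.PosDef → ψ h ≤ ψ 1 → ∃ z ∈ K, q z = h := by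
    intro h hh hle
    obtain ⟨u, d, hu, -, hd, rfl⟩ := exists_sorted_diagonalization hh
    refine ⟨(u, d), ⟨hu, fun i _ => ?_⟩, rfl⟩
    have htr : (u * diagonal d * uᵀ).trace - Real.log (u * diagonal d * uᵀ).det =
        ∑ l, (d l - Real.log (d l)) := by
      rw [trace_mul_comm, ← Matrix.mul_assoc, hu, Matrix.one_mul, trace_diagonal, det_mul, det_mul,
        det_transpose, mul_right_comm, ← sq, det_sq_of_orthogonal hu, one_mul, det_diagonal,
        Real.log_prod fun p _ => (hd _).ne', Finset.sum_sub_distrib]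
    have h1 : d i - Real.log (d i) ≤ ∑ l, (d l - Real.log (d l)) :=
      Finset.single_le_sum (f := fun l => d l - Real.log (d l))
        (fun l _ => by have := Real.log_le_sub_one_of_pos (hd l); linarith) (Finset.mem_univ i)
    have h2 : d i - Real.log (d i) ≤ R := by
      rw [hR, le_div_iff₀ hε]
      have h3 := hC _ hh
      have h4 : φ (u * diagonal d * uᵀ) + ε * ∑ l, (d l - Real.log (d l)) ≤ ψ 1 := by
        rw [← htr]; exact hle
      nlinarith
    constructor
    · rw [← Real.le_log_iff_exp_le (hd i)]
      linarith [hd i]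
    · have h5 := Real.log_le_sub_one_of_pos (half_pos (hd i))
      have h6 := Real.log_le_sub_one_of_pos (x := 2) two_pos
      rw [Real.log_div (hd i).ne' two_ne_zero] at h5
      linarith
  obtain ⟨z₁, hz₁, hqz₁⟩ := hmem 1 PosDef.one le_rfl
  obtain ⟨z₀, hz₀, hmin⟩ := hK.exists_isMinOn ⟨z₁, hz₁⟩
    (hψc.comp hqc.continuousOn hpos)
  refine ⟨q z₀, hpos z₀ hz₀, fun h hh => ?_⟩
  change ψ (q z₀) ≤ ψ h
  by_cases hle : ψ h ≤ ψ 1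
  · obtain ⟨z, hz, rfl⟩ := hmem h hh hle
    exact hmin hz
  · refine le_trans ?_ (not_le.1 hle).le
    rw [← hqz₁]
    exact hmin hz₁

end PosDefCone

section CriticalPoint

variable {κ : Type*} [Fintype κ] {ι : κ → Type*} [∀ k, Fintype (ι k)] [∀ k, DecidableEq (ι k)]
  {n : ℕ}

theorem posDef_compress {τ : Type*} [Fintype τ] [DecidableEq τ] {F : Matrix (Fin n) τ ℝ}
    {E : Matrix τ (Fin n) ℝ} (hEF : E * F = 1) {h : Matrix (Fin n) (Fin n) ℝ} (hh : h.PosDef) :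
    (Fᵀ * h * F).PosDef := by
  rw [← conjTranspose_eq_transpose_of_trivial]
  refine hh.conjTranspose_mul_mul_same fun x y hxy => ?_
  have := congrArg (E *ᵥ ·) hxy
  simpa [mulVec_mulVec, hEF] using this

theorem exists_critical_point {w : κ → ℝ} {c : ℝ}
    {F : ∀ k, Matrix (Fin n) (ι k) ℝ} {E : ∀ k, Matrix (ι k) (Fin n) ℝ}
    (hEF : ∀ k, E k * F k = 1) (htot : ∑ k, w k * (Fintype.card (ι k) : ℝ) + c * n = 0) {C : ℝ}
    (hC : ∀ h : Matrix (Fin n) (Fin n) ℝ, h.PosDef → C ≤ logPotential w c F h) {ε : ℝ}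
    (hε : 0 < ε) : ∃ h : Matrix (Fin n) (Fin n) ℝ, h.PosDef ∧ h.trace = n ∧
      ∑ k, w k • (F k * ((F k)ᵀ * h * F k)⁻¹ * (F k)ᵀ) + c • h⁻¹ + ε • (1 - h⁻¹) = 0 := by
  have hcont : ContinuousOn (logPotential w c F) {h | h.PosDef} := by
    unfold logPotential
    refine ContinuousOn.add (continuousOn_finsetSum _ fun k _ => continuousOn_const.mul ?_)
      (continuousOn_const.mul ?_)
    · exact ContinuousOn.log (Continuous.continuousOn (by fun_prop)) fun h hh =>
        (posDef_compress (hEF k) hh).det_pos.ne'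
    · exact ContinuousOn.log (Continuous.continuousOn (by fun_prop)) fun h hh =>
        (PosDef.det_pos hh).ne'
  obtain ⟨h, hh, hmin⟩ := exists_min_penalized hcont hC hε
  have hsymm : hᵀ = h := by
    rw [← conjTranspose_eq_transpose_of_trivial]; exact hh.1
  set W := ∑ k, w k • (F k * ((F k)ᵀ * h * F k)⁻¹ * (F k)ᵀ) + c • h⁻¹ + ε • (1 - h⁻¹) with hW
  have hWs : W.IsSymm := by
    rw [IsSymm, hW]
    simp only [transpose_add, transpose_sum, transpose_smul, transpose_sub, transpose_one,
      transpose_nonsing_inv, transpose_mul, transpose_transpose, hsymm, Matrix.mul_assoc]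
  have hcrit : ∀ y : Matrix (Fin n) (Fin n) ℝ, y.IsSymm → (W * y).trace = 0 := by
    intro y hy
    have hder : HasDerivAt (fun s : ℝ => logPotential w c F (h + s • y) +
        ε * ((h + s • y).trace - Real.log (h + s • y).det))
        ((∑ k, w k * (((F k)ᵀ * h * F k)⁻¹ * ((F k)ᵀ * y * F k)).trace + c * (h⁻¹ * y).trace) +
          ε * (y.trace - (h⁻¹ * y).trace)) 0 := by
      have hld := hasDerivAt_log_det hh.det_pos.ne' y
      unfold logPotential
      refine HasDerivAt.add (HasDerivAt.add (HasDerivAt.fun_sum fun k _ =>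
        HasDerivAt.const_mul _ ?_)
        (hld.const_mul _)) (HasDerivAt.const_mul _ (HasDerivAt.sub ?_ hld))
      · have := hasDerivAt_log_det (posDef_compress (hEF k) hh).det_pos.ne' ((F k)ᵀ * y * F k)
        simpa only [Matrix.mul_add, Matrix.add_mul, Matrix.mul_smul, Matrix.smul_mul] using this
      · simp only [trace_add, trace_smul, smul_eq_mul]
        simpa using ((hasDerivAt_id (0 : ℝ)).mul_const y.trace).const_add h.trace
    have hloc : IsLocalMin (fun s : ℝ => logPotential w c F (h + s • y) +
        ε * ((h + s • y).trace - Real.log (h + s • y).det)) 0 := by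
      filter_upwards [eventually_posDef_add_smul hh hy] with s hs
      simpa using hmin _ hs
    rw [← hloc.hasDerivAt_eq_zero hder, hW]
    simp only [add_mul, Matrix.sum_mul, trace_add, trace_sum, Matrix.smul_mul, trace_smul,
      smul_eq_mul,
      sub_mul, Matrix.one_mul, trace_sub]
    congr 2
    refine Finset.sum_congr rfl fun k _ => ?_
    congr 1
    simp only [Matrix.mul_assoc]
    rw [trace_mul_comm]
    simp only [Matrix.mul_assoc]
  have hW0 : W = 0 := by
    have := hcrit W hWs
    nth_rewrite 1 [← hWs.eq] at this
    rwa [← conjTranspose_eq_transpose_of_trivial, trace_conjTranspose_mul_self_eq_zero_iff] at this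
  refine ⟨h, hh, ?_, hW0⟩
  have htr := hcrit h hsymm
  have hinv : h⁻¹ * h = 1 := nonsing_inv_mul _ (isUnit_iff_ne_zero.2 hh.det_pos.ne')
  have hk : ∀ k, (F k * ((F k)ᵀ * h * F k)⁻¹ * (F k)ᵀ * h).trace = Fintype.card (ι k) := by
    intro k
    rw [Matrix.mul_assoc, Matrix.mul_assoc, trace_mul_comm, Matrix.mul_assoc,
      nonsing_inv_mul _ (isUnit_iff_ne_zero.2 (posDef_compress (hEF k) hh).det_pos.ne'), trace_one]
  rw [hW] at htr
  simp only [add_mul, Matrix.sum_mul, trace_add, trace_sum, Matrix.smul_mul, trace_smul,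
    smul_eq_mul,
      sub_mul, Matrix.one_mul, trace_sub, hk, hinv, trace_one, Fintype.card_fin, htot,
        zero_add] at htr
  rcases mul_eq_zero.1 htr with h0 | h0
  · exact absurd h0 hε.ne'
  · linarith

end CriticalPoint

section FlagWeights

variable {m : ℕ}

theorem sum_eq_sum_gap_mul_card (x : Fin (m + 1) → ℝ) :
    ∑ l, x l = ∑ i : Fin m, (x i.castSucc - x i.succ) *
      (Fintype.card {l : Fin (m + 1) // l ≤ i.castSucc} : ℝ) + x (Fin.last m) * (m + 1) := by
  rw [Finset.sum_congr rfl fun p _ => eq_last_add_sum_gaps x p, Finset.sum_add_distrib,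
    Finset.sum_comm, add_comm]
  congr 1
  · refine Finset.sum_congr rfl fun i _ => ?_
    rw [← Finset.sum_filter, Finset.sum_const, nsmul_eq_mul, mul_comm, Fintype.card_subtype]
  · simp [mul_comm]

/-- The symmetric matrix with weights `α` along the flag spanned by the columns of `g * G`. -/
noncomputable def flagMatrix (α : Fin (m + 1) → ℝ) (G g : Matrix (Fin (m + 1)) (Fin (m + 1)) ℝ) :
    Matrix (Fin (m + 1)) (Fin (m + 1)) ℝ :=
  ∑ i : Fin m, (α i.castSucc - α i.succ) • (g * (flagFrame G i *
    ((flagFrame G i)ᵀ * (gᵀ * g) * flagFrame G i)⁻¹ * (flagFrame G i)ᵀ) * gᵀ) + α (Fin.last m) • 1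

theorem isSymm_flagMatrix (α : Fin (m + 1) → ℝ) (G g : Matrix (Fin (m + 1)) (Fin (m + 1)) ℝ) :
    (flagMatrix α G g).IsSymm := by
  rw [IsSymm, flagMatrix]
  simp only [transpose_add, transpose_sum, transpose_smul, transpose_one,
    transpose_nonsing_inv, transpose_mul, transpose_transpose, Matrix.mul_assoc]

theorem leftInverse_flagFrame {G : Matrix (Fin (m + 1)) (Fin (m + 1)) ℝ} (hG : G.det ≠ 0)
    (i : Fin m) : (flagFrame 1 i)ᵀ * G⁻¹ * flagFrame G i = 1 := by
  have h : G⁻¹ * flagFrame G i = flagFrame (G⁻¹ * G) i := rfl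
  have h2 : (flagFrame 1 i)ᵀ * flagFrame 1 i =
      ((1 : Matrix (Fin (m + 1)) (Fin (m + 1)) ℝ)ᵀ * 1).submatrix Subtype.val Subtype.val := rfl
  rw [Matrix.mul_assoc, h, nonsing_inv_mul _ (isUnit_iff_ne_zero.2 hG), h2, transpose_one,
    Matrix.mul_one, submatrix_one _ Subtype.val_injective]

/-- The leading principal block of size `i + 1`. -/
def leadingBlock (S : Matrix (Fin (m + 1)) (Fin (m + 1)) ℝ) (i : Fin m) :
    Matrix {l : Fin (m + 1) // l ≤ i.castSucc} {l : Fin (m + 1) // l ≤ i.castSucc} ℝ :=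
  S.submatrix Subtype.val Subtype.val

theorem flag_projection_apply {S : Matrix (Fin (m + 1)) (Fin (m + 1)) ℝ} (i : Fin m)
    (hS : (leadingBlock S i).det ≠ 0)
    {p q : Fin (m + 1)} (hqp : q ≤ p) :
    (flagFrame 1 i * ((leadingBlock S i)⁻¹ *
      (flagFrame Sᵀ i)ᵀ)) p q = if p ≤ i.castSucc then (1 : Matrix _ _ ℝ) p q else 0 := by
  rw [mul_apply]
  split_ifs with hp
  · rw [Finset.sum_eq_single ⟨p, hp⟩]
    · have h : ((leadingBlock S i)⁻¹ *
          (flagFrame Sᵀ i)ᵀ) ⟨p, hp⟩ q =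
          ((leadingBlock S i)⁻¹ *
          leadingBlock S i) ⟨p, hp⟩ ⟨q, hqp.trans hp⟩ := rfl
      rw [h, nonsing_inv_mul _ (isUnit_iff_ne_zero.2 hS)]
      simp [flagFrame, one_apply]
    · intro x _ hx
      have : p ≠ x.1 := fun h => hx (Subtype.ext h.symm)
      simp [flagFrame, this]
    · simp
  · refine Finset.sum_eq_zero fun x _ => ?_
    have : p ≠ x.1 := fun h => hp (h ▸ x.2)
    simp [flagFrame, this]

theorem charpoly_flagMatrix (α : Fin (m + 1) → ℝ) {G g : Matrix (Fin (m + 1)) (Fin (m + 1)) ℝ}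
    (hG : G.det ≠ 0) (hg : g.det ≠ 0) :
    (flagMatrix α G g).charpoly = ∏ l, (Polynomial.X - Polynomial.C (α l)) := by
  set M := g * G with hM
  set S := Mᵀ * M with hS
  have hMdet : M.det ≠ 0 := by rw [hM, det_mul]; exact mul_ne_zero hg hG
  have hpd : (gᵀ * g).PosDef := by
    rw [← conjTranspose_eq_transpose_of_trivial]
    exact PosDef.conjTranspose_mul_self _ (mulVec_injective_of_isUnit
      ((Matrix.isUnit_iff_isUnit_det _).2 (isUnit_iff_ne_zero.2 hg)))
  have hSi : ∀ i : Fin m, (flagFrame G i)ᵀ * (gᵀ * g) * flagFrame G i =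
      leadingBlock S i := by
    intro i
    have : S = Gᵀ * (gᵀ * g) * G := by
      rw [hS, hM, transpose_mul]; simp only [Matrix.mul_assoc]
    rw [this]
    rfl
  have hSdet : ∀ i : Fin m,
      (leadingBlock S i).det ≠ 0 := fun i => by
    rw [← hSi]
    exact (posDef_compress (leftInverse_flagFrame hG i) hpd).det_pos.ne'
  let U : Fin m → Matrix (Fin (m + 1)) (Fin (m + 1)) ℝ := fun i =>
    flagFrame 1 i * ((leadingBlock S i)⁻¹ *
      (flagFrame Sᵀ i)ᵀ)
  let T : Matrix (Fin (m + 1)) (Fin (m + 1)) ℝ :=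
    ∑ i, (α i.castSucc - α i.succ) • U i + α (Fin.last m) • 1
  have hT : ∀ {p q}, q ≤ p → T p q = (1 : Matrix _ _ ℝ) p q * α p := by
    intro p q hqp
    have h1 : T p q = ∑ i : Fin m, (α i.castSucc - α i.succ) * U i p q +
        α (Fin.last m) * (1 : Matrix _ _ ℝ) p q := by
      simp only [T, Matrix.add_apply, Matrix.sum_apply, Matrix.smul_apply, smul_eq_mul]
    rw [h1, eq_last_add_sum_gaps α p, mul_add, Finset.mul_sum, add_comm, mul_comm]
    congr 1
    refine Finset.sum_congr rfl fun i _ => ?_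
    have hU : U i p q = _ := flag_projection_apply i (hSdet i) hqp
    rw [hU]
    split_ifs <;> ring
  have hconj : flagMatrix α G g * M = M * T := by
    have hi : ∀ i, g * (flagFrame G i * ((flagFrame G i)ᵀ * (gᵀ * g) * flagFrame G i)⁻¹ *
        (flagFrame G i)ᵀ) * gᵀ * M = M * U i := by
      intro i
      have h1 : G * flagFrame 1 i = flagFrame G i := by
        have : G * flagFrame 1 i = (G * 1).submatrix id Subtype.val := rfl
        rw [this, Matrix.mul_one]; rfl
      have h2 : (flagFrame G i)ᵀ * gᵀ * M = (flagFrame Sᵀ i)ᵀ := by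
        have h3 : flagFrame Sᵀ i = Mᵀ * g * flagFrame G i := by
          have : Sᵀ = Mᵀ * g * G := by
            rw [hS, transpose_mul, transpose_transpose, Matrix.mul_assoc]
          rw [this]; rfl
        rw [h3, transpose_mul, transpose_mul, transpose_transpose, Matrix.mul_assoc]
      simp only [U]
      rw [hSi, ← h2, ← h1]
      simp only [hM, Matrix.mul_assoc]
    simp only [flagMatrix, T, Matrix.add_mul, Matrix.mul_add, Matrix.sum_mul, Matrix.mul_sum,
      Matrix.smul_mul, Matrix.mul_smul, hi, Matrix.mul_one, Matrix.one_mul]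
  obtain ⟨V, hV⟩ := (Matrix.isUnit_iff_isUnit_det M).2 (isUnit_iff_ne_zero.2 hMdet)
  have h3 : flagMatrix α G g = V.val * T * V.val⁻¹ := by
    rw [hV, ← hconj, mul_nonsing_inv_cancel_right _ _ (isUnit_iff_ne_zero.2 hMdet)]
  rw [h3, charpoly_units_conj, charpoly_of_isUpperTriangular]
  · refine Finset.prod_congr rfl fun l _ => ?_
    rw [hT le_rfl, one_apply_eq, one_mul]
  · intro p q hqp
    change q < p at hqp
    rw [hT hqp.le, one_apply_ne hqp.ne', zero_mul]

theorem abs_mul_transpose_apply_le {n : ℕ} (g : Matrix (Fin n) (Fin n) ℝ) (p q : Fin n) :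
    |(g * gᵀ) p q| ≤ (gᵀ * g).trace := by
  have htr : (gᵀ * g).trace = ∑ a, ∑ b, g a b ^ 2 := by
    rw [trace_mul_comm]
    simp [trace, mul_apply, sq]
  have hrow : ∀ a, ∑ b, g a b ^ 2 ≤ (gᵀ * g).trace := fun a => by
    rw [htr]
    exact Finset.single_le_sum (f := fun a => ∑ b, g a b ^ 2)
      (fun _ _ => Finset.sum_nonneg fun _ _ => sq_nonneg _) (Finset.mem_univ a)
  calc |(g * gᵀ) p q| ≤ ∑ b, |g p b * g q b| := by
        rw [mul_apply]; exact Finset.abs_sum_le_sum_abs _ _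
    _ ≤ ∑ b, (g p b ^ 2 + g q b ^ 2) / 2 := by
        refine Finset.sum_le_sum fun b _ => ?_
        rw [abs_mul]
        nlinarith [sq_nonneg (|g p b| - |g q b|), sq_abs (g p b), sq_abs (g q b)]
    _ ≤ _ := by
        rw [← Finset.sum_div, Finset.sum_add_distrib]
        linarith [hrow p, hrow q]

variable {J : Type*} [Fintype J]

theorem exists_small_sum {α : J → Fin (m + 1) → ℝ} (hα : ∀ j, Antitone (α j))
    {G : J → Matrix (Fin (m + 1)) (Fin (m + 1)) ℝ} (hG : ∀ j, (G j).det ≠ 0)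
    (hrank : ∀ u : Matrix (Fin (m + 1)) (Fin (m + 1)) ℝ, uᵀ * u = 1 → ∀ r (hr : r ≤ m + 1),
      0 ≤ ∑ j, (∑ i : Fin m, (α j i.castSucc - α j i.succ) *
        ((((flagFrame (G j) i)ᵀ * u).submatrix id (Fin.castLE hr)).rank : ℝ) +
          α j (Fin.last m) * r))
    (htot : ∑ j, ∑ l, α j l = 0) {ε : ℝ} (hε : 0 < ε) :
    ∃ u : J → Matrix (Fin (m + 1)) (Fin (m + 1)) ℝ, (∀ j, (u j)ᵀ * u j = 1) ∧
      ∀ p q, |(∑ j, u j * diagonal (α j) * (u j)ᵀ) p q| ≤ ε * (m + 2) := by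
  let w : J × Fin m → ℝ := fun k => α k.1 k.2.castSucc - α k.1 k.2.succ
  let c : ℝ := ∑ j, α j (Fin.last m)
  have hw : ∀ k, 0 ≤ w k := fun k => sub_nonneg.2 (hα k.1 (Fin.castSucc_lt_succ).le)
  have htot' : ∑ k : J × Fin m, w k * (Fintype.card {l : Fin (m + 1) // l ≤ k.2.castSucc} : ℝ) +
      c * (m + 1) = 0 := by
    rw [← htot, Fintype.sum_prod_type, Finset.sum_mul, ← Finset.sum_add_distrib]
    exact Finset.sum_congr rfl fun j _ => (sum_eq_sum_gap_mul_card (α j)).symm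
  obtain ⟨C, hC⟩ := exists_le_logPotential (w := w) hw (c := c)
    (F := fun k : J × Fin m => flagFrame (G k.1) k.2)
    (fun k => leftInverse_flagFrame (hG k.1) k.2) (fun u hu r hr => by
      rw [Fintype.sum_prod_type, Finset.sum_mul, ← Finset.sum_add_distrib]
      exact hrank u hu r hr) htot'
  obtain ⟨h, hh, htr, hW⟩ := exists_critical_point (w := w) (c := c)
    (F := fun k : J × Fin m => flagFrame (G k.1) k.2)
    (fun k => leftInverse_flagFrame (hG k.1) k.2) (by push_cast; exact htot') (C := C)
    (fun h hh => by
      obtain ⟨u, d, hu, hd, hd0, rfl⟩ := exists_sorted_diagonalization hh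
      exact hC u d hu hd hd0) hε
  obtain ⟨g, hg, rfl⟩ := exists_eq_transpose_mul_self hh
  have hsum : ∑ j, flagMatrix (α j) (G j) g = ε • (1 - g * gᵀ) := by
    have hcong := congrArg (fun W => g * W * gᵀ) hW
    have hinv : g * (gᵀ * g)⁻¹ * gᵀ = 1 := by
      rw [Matrix.mul_inv_rev, ← Matrix.mul_assoc, mul_nonsing_inv _ (isUnit_iff_ne_zero.2 hg),
        Matrix.one_mul, nonsing_inv_mul _ (by rw [det_transpose]; exact isUnit_iff_ne_zero.2 hg)]
    simp only [Matrix.mul_add, Matrix.add_mul, Matrix.mul_sum, Matrix.sum_mul, Matrix.mul_smul,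
      Matrix.smul_mul, Matrix.mul_sub, Matrix.sub_mul, Matrix.mul_one, hinv, Matrix.mul_zero,
      Matrix.zero_mul, Fintype.sum_prod_type] at hcong
    rw [← sub_eq_zero, ← hcong]
    simp only [flagMatrix, Finset.sum_add_distrib, Finset.sum_smul, w, c, smul_sub]
    abel
  choose u hu hua using fun j => exists_orthogonal_of_charpoly_eq (isSymm_flagMatrix (α j) (G j) g)
    (charpoly_flagMatrix (α j) (hG j) hg)
  refine ⟨u, hu, fun p q => ?_⟩
  simp only [← hua, hsum, Matrix.smul_apply, smul_eq_mul, abs_mul, abs_of_pos hε]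
  gcongr
  have h1 := abs_mul_transpose_apply_le g p q
  have h2 : |(1 : Matrix (Fin (m + 1)) (Fin (m + 1)) ℝ) p q| ≤ 1 := by
    rw [one_apply]; split_ifs <;> simp
  rw [htr] at h1
  push_cast at h1
  rw [Matrix.sub_apply]
  linarith [abs_sub ((1 : Matrix (Fin (m + 1)) (Fin (m + 1)) ℝ) p q) ((g * gᵀ) p q)]

theorem exists_orthogonal_sum_eq_zero {n : ℕ} {α : J → Fin n → ℝ} {B : ℝ}
    (h : ∀ ε > 0, ∃ u : J → Matrix (Fin n) (Fin n) ℝ, (∀ j, (u j)ᵀ * u j = 1) ∧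
      ∀ p q, |(∑ j, u j * diagonal (α j) * (u j)ᵀ) p q| ≤ ε * B) :
    ∃ u : J → Matrix (Fin n) (Fin n) ℝ, (∀ j, (u j)ᵀ * u j = 1) ∧
      ∑ j, u j * diagonal (α j) * (u j)ᵀ = 0 := by
  let f : (J → Matrix (Fin n) (Fin n) ℝ) → ℝ := fun u =>
    ∑ p, ∑ q, |(∑ j, u j * diagonal (α j) * (u j)ᵀ) p q|
  have hf : Continuous f := by
    refine continuous_finsetSum _ fun p _ => continuous_finsetSum _ fun q _ => ?_
    have : Continuous fun u : J → Matrix (Fin n) (Fin n) ℝ =>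
      ∑ j, u j * diagonal (α j) * (u j)ᵀ := by fun_prop
    exact (this.matrix_elem p q).abs
  have hK : IsCompact (Set.univ.pi fun _ : J => {u : Matrix (Fin n) (Fin n) ℝ | uᵀ * u = 1}) :=
    isCompact_univ_pi fun _ => isCompact_orthogonal
  obtain ⟨u₁, hu₁, -⟩ := h 1 one_pos
  obtain ⟨u₀, hu₀, hmin⟩ := hK.exists_isMinOn ⟨u₁, fun j _ => hu₁ j⟩ hf.continuousOn
  refine ⟨u₀, fun j => hu₀ j trivial, ?_⟩
  have hle : ∀ ε > 0, f u₀ ≤ ε * ((n : ℝ) * (n * B)) := by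
    intro ε hε
    obtain ⟨u, hu, hub⟩ := h ε hε
    refine (hmin (fun j _ => hu j : u ∈ _)).trans ?_
    calc f u ≤ ∑ _p : Fin n, ∑ _q : Fin n, ε * B :=
          Finset.sum_le_sum fun p _ => Finset.sum_le_sum fun q _ => hub p q
      _ = _ := by simp; ring
  have h0 : f u₀ ≤ 0 := by
    have ht : Filter.Tendsto (fun ε : ℝ => ε * ((n : ℝ) * (n * B))) (nhdsWithin 0 (Set.Ioi 0))
        (nhds 0) := by
      have hc : Continuous fun ε : ℝ => ε * ((n : ℝ) * (n * B)) := by fun_prop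
      simpa using (hc.tendsto 0).mono_left nhdsWithin_le_nhds
    exact ge_of_tendsto ht (by filter_upwards [self_mem_nhdsWithin] with ε hε using hle ε hε)
  have hz : ∀ p q, |(∑ j, u₀ j * diagonal (α j) * (u₀ j)ᵀ) p q| ≤ 0 := fun p q => by
    refine le_trans ?_ h0
    refine le_trans (Finset.single_le_sum
      (f := fun q => |(∑ j, u₀ j * diagonal (α j) * (u₀ j)ᵀ) p q|)
      (fun _ _ => abs_nonneg _) (Finset.mem_univ q)) ?_
    exact Finset.single_le_sum
      (f := fun p => ∑ q, |(∑ j, u₀ j * diagonal (α j) * (u₀ j)ᵀ) p q|)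
      (fun _ _ => Finset.sum_nonneg fun _ _ => abs_nonneg _) (Finset.mem_univ p)
  ext p q
  exact abs_nonpos_iff.1 (hz p q)

end FlagWeights

section Convexity

theorem antitone_combination {n : ℕ} {x y : Fin n → ℝ} (hx : Antitone x) (hy : Antitone y) {s t : ℝ}
    (hs : 0 ≤ s) (ht : 0 ≤ t) : Antitone (s • x + t • y) := fun i j hij => by
  simp only [Pi.add_apply, Pi.smul_apply, smul_eq_mul]
  gcongr
  exacts [hx hij, hy hij]

theorem exists_orthogonal_sum_eq_zero_of_convex_combination {J : Type*} [Fintype J] {m : ℕ}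
    {α β : J → Fin (m + 1) → ℝ} (hα : ∀ j, Antitone (α j)) (hβ : ∀ j, Antitone (β j))
    {u v : J → Matrix (Fin (m + 1)) (Fin (m + 1)) ℝ} (hu : ∀ j, (u j)ᵀ * u j = 1)
    (hv : ∀ j, (v j)ᵀ * v j = 1) (hus : ∑ j, u j * diagonal (α j) * (u j)ᵀ = 0)
    (hvs : ∑ j, v j * diagonal (β j) * (v j)ᵀ = 0) {s t : ℝ} (hs : 0 ≤ s) (ht : 0 ≤ t) :
    ∃ z : J → Matrix (Fin (m + 1)) (Fin (m + 1)) ℝ, (∀ j, (z j)ᵀ * z j = 1) ∧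
      ∑ j, z j * diagonal (s • α j + t • β j) * (z j)ᵀ = 0 := by
  obtain ⟨G, hG, hgen⟩ := exists_common_generic (m + 1) (G₀ := u) (G₁ := v) (fun j h0 => by
    have := det_sq_of_orthogonal (hu j)
    simp [h0] at this)
  have hanti : ∀ j, Antitone (s • α j + t • β j) := fun j =>
    antitone_combination (hα j) (hβ j) hs ht
  refine exists_orthogonal_sum_eq_zero (B := m + 2) fun ε hε =>
    exists_small_sum hanti hG (fun y hy r hr => ?_) ?_ hε
  · have h₀ := sum_gap_mul_rank_nonneg hr (fun S hS => (hgen r hr S hS).1) hu hα hus hy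
    have h₁ := sum_gap_mul_rank_nonneg hr (fun S hS => (hgen r hr S hS).2) hv hβ hvs hy
    refine (add_nonneg (mul_nonneg hs h₀) (mul_nonneg ht h₁)).trans_eq ?_
    rw [Finset.mul_sum, Finset.mul_sum, ← Finset.sum_add_distrib]
    refine Finset.sum_congr rfl fun j _ => ?_
    simp only [Pi.add_apply, Pi.smul_apply, smul_eq_mul]
    rw [mul_add, mul_add, Finset.mul_sum, Finset.mul_sum, add_add_add_comm,
      ← Finset.sum_add_distrib]
    congr 1
    · exact Finset.sum_congr rfl fun i _ => by ring
    · ring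
  · simp only [Pi.add_apply, Pi.smul_apply, smul_eq_mul, Finset.sum_add_distrib, ← Finset.mul_sum,
      sum_conj_diagonal_trace hu hus, sum_conj_diagonal_trace hv hvs]
    ring

theorem neg_conj_diagonal {n : ℕ} (u : Matrix (Fin n) (Fin n) ℝ) (d : Fin n → ℝ) :
    u * diagonal (-d) * uᵀ = -(u * diagonal d * uᵀ) := by
  have h : diagonal (-d) = -diagonal d := (Matrix.diagonal_neg d).symm
  rw [h, Matrix.mul_neg, Matrix.neg_mul]

/-- Spectra of summands `a`, `b` and of `-(a + b)`, as a zero sum problem. -/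
theorem exists_sum_charpoly_iff {n : ℕ} (α β ν : Fin n → ℝ) :
    (∃ a b : Matrix (Fin n) (Fin n) ℝ, a.IsSymm ∧ b.IsSymm ∧
      a.charpoly = ∏ i, (Polynomial.X - Polynomial.C (α i)) ∧
      b.charpoly = ∏ i, (Polynomial.X - Polynomial.C (β i)) ∧
      (a + b).charpoly = ∏ i, (Polynomial.X - Polynomial.C (ν i))) ↔
    ∃ u : Fin 3 → Matrix (Fin n) (Fin n) ℝ, (∀ j, (u j)ᵀ * u j = 1) ∧
      ∑ j, u j * diagonal ((![α, β, -ν ∘ Fin.rev] : Fin 3 → Fin n → ℝ) j) * (u j)ᵀ = 0 := by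
  constructor
  · rintro ⟨a, b, ha, hb, hca, hcb, hcs⟩
    obtain ⟨u, hu, rfl⟩ := exists_orthogonal_of_charpoly_eq ha hca
    obtain ⟨v, hv, rfl⟩ := exists_orthogonal_of_charpoly_eq hb hcb
    obtain ⟨w, hw, hs⟩ := exists_orthogonal_of_charpoly_eq (ha.add hb) hcs
    refine ⟨![u, v, w.submatrix id Fin.rev], ?_, ?_⟩
    · rw [Fin.forall_fin_succ, Fin.forall_fin_two]
      exact ⟨hu, hv, orthogonal_reindex hw Fin.revPerm⟩
    · have h := conj_diagonal_reindex w (-ν) Fin.revPerm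
      rw [neg_conj_diagonal, ← hs] at h
      rw [Fin.sum_univ_three]
      exact (congrArg (u * diagonal α * uᵀ + v * diagonal β * vᵀ + ·) h).trans (add_neg_cancel _)
  · rintro ⟨u, hu, hsum⟩
    rw [Fin.sum_univ_three] at hsum
    refine ⟨u 0 * diagonal α * (u 0)ᵀ, u 1 * diagonal β * (u 1)ᵀ, isSymm_conj_diagonal _ _,
      isSymm_conj_diagonal _ _, charpoly_orthogonal_conj (hu 0) α,
      charpoly_orthogonal_conj (hu 1) β, ?_⟩
    have h := eq_neg_of_add_eq_zero_left hsum
    have h2 : (![α, β, -ν ∘ Fin.rev] : Fin 3 → Fin n → ℝ) 2 = -(ν ∘ Fin.rev) := rfl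
    rw [h2, neg_conj_diagonal, neg_neg] at h
    change u 0 * diagonal α * (u 0)ᵀ + u 1 * diagonal β * (u 1)ᵀ = _ at h
    rw [h, charpoly_orthogonal_conj (hu 2)]
    exact Equiv.prod_comp Fin.revPerm fun i => Polynomial.X - Polynomial.C (ν i)

end Convexity

end HornConvexity

/-- convexity of the Horn set. For fixed decreasing `p`-tuples `α`
and `β`, the set of decreasing `p`-tuples `ν` arising as the ordered spectrum of a sum
`a + b` of real symmetric `p × p` matrices with ordered spectra `α` and `β`
respectively is a convex subset of `ℝ^p`. -/
theorem horn_set_convex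
    (p : ℕ) (hp : 1 ≤ p)
    (α β : Fin p → ℝ) (hα : Antitone α) (hβ : Antitone β) :
    Convex ℝ {ν : Fin p → ℝ | Antitone ν ∧
      ∃ a b : Matrix (Fin p) (Fin p) ℝ, a.IsSymm ∧ b.IsSymm ∧
        a.charpoly = ∏ i : Fin p, (Polynomial.X - Polynomial.C (α i)) ∧
        b.charpoly = ∏ i : Fin p, (Polynomial.X - Polynomial.C (β i)) ∧
        (a + b).charpoly = ∏ i : Fin p, (Polynomial.X - Polynomial.C (ν i))} := by
  rintro ν₀ ⟨hν₀, h₀⟩ ν₁ ⟨hν₁, h₁⟩ s t hs ht hst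
  refine ⟨HornConvexity.antitone_combination hν₀ hν₁ hs ht, ?_⟩
  obtain ⟨m, rfl⟩ : ∃ m, p = m + 1 := ⟨p - 1, by omega⟩
  rw [HornConvexity.exists_sum_charpoly_iff] at h₀ h₁ ⊢
  obtain ⟨u, hu, hus⟩ := h₀
  obtain ⟨v, hv, hvs⟩ := h₁
  have hanti : ∀ ν : Fin (m + 1) → ℝ, Antitone ν →
      ∀ j, Antitone ((![α, β, -ν ∘ Fin.rev] : Fin 3 → Fin (m + 1) → ℝ) j) := by
    intro ν hν
    rw [Fin.forall_fin_succ, Fin.forall_fin_two]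
    exact ⟨hα, hβ, fun i j hij => neg_le_neg (hν (Fin.rev_le_rev.2 hij))⟩
  obtain ⟨z, hz, hzs⟩ := HornConvexity.exists_orthogonal_sum_eq_zero_of_convex_combination
    (hanti _ hν₀)
    (hanti _ hν₁) hu hv hus hvs hs ht
  refine ⟨z, hz, ?_⟩
  rw [← hzs]
  refine Finset.sum_congr rfl fun j _ => ?_
  congr 3
  fin_cases j
  · exact (Convex.combo_self hst α).symm
  · exact (Convex.combo_self hst β).symm
  · ext i
    simp
    ring
end

section
/- Let p ≥ 1 and let A and B be complex Hermitian p×p matrices. Let σ₁ ≥ σ₂ ≥ … ≥ σ_{2p} be the 2p eigenvalues of A and B together (the multiset union of the spectrum of A and the spectrum of B, with multiplicity), arranged in decreasing order. Then there exist complex Hermitian p×p matrices Ã and B̃ with ordered spectra (σ₁, σ₃, …, σ_{2p−1}) and (σ₂, σ₄, …, σ_{2p}) respectively, such that à + B̃ = A + B. -/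
open Matrix

section ParametricIntegral

open MeasureTheory Topology

variable {K : Type*} [TopologicalSpace K] [CompactSpace K] [T2Space K]
  [MeasurableSpace K] [BorelSpace K]

theorem integrable_of_continuous_compactSpace {E : Type*} [NormedAddCommGroup E]
    (μ : Measure K) [IsFiniteMeasure μ] {f : K → E} (hf : Continuous f) : Integrable f μ := by
  rw [← integrableOn_univ]
  exact hf.continuousOn.integrableOn_compact isCompact_univ

theorem hasFDerivAt_integral_of_compactSpace (μ : Measure K) [IsFiniteMeasure μ]
    {H : Type*} [NormedAddCommGroup H] [NormedSpace ℝ H] [ProperSpace H]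
    {F : H → K → ℂ} {F' : H → K → H →L[ℝ] ℂ} (hF : ∀ x, Continuous (F x))
    (hF' : Continuous (Function.uncurry F'))
    (h : ∀ x k, HasFDerivAt (fun y => F y k) (F' x k) x) (x₀ : H) :
    HasFDerivAt (fun x => ∫ k, F x k ∂μ) (∫ k, F' x₀ k ∂μ) x₀ := by
  obtain ⟨C, hC⟩ := ((isCompact_closedBall x₀ 1).prod (isCompact_univ (X := K))).exists_bound_of_continuousOn
    hF'.continuousOn
  refine hasFDerivAt_integral_of_dominated_of_fderiv_le (bound := fun _ => C)
    (Metric.closedBall_mem_nhds x₀ one_pos) (Filter.Eventually.of_forall fun x => ?_) ?_ ?_ ?_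
    (integrable_const C) (Filter.Eventually.of_forall fun k x _ => h x k)
  · exact (integrable_of_continuous_compactSpace μ (hF x)).aestronglyMeasurable
  · exact integrable_of_continuous_compactSpace μ (hF x₀)
  · refine (integrable_of_continuous_compactSpace μ ?_).aestronglyMeasurable
    exact hF'.comp (by fun_prop : Continuous fun k : K => (x₀, k))
  · exact Filter.Eventually.of_forall fun k x hx => hC (x, k) ⟨hx, trivial⟩

theorem hasDerivAt_integral_of_compactSpace (μ : Measure K) [IsFiniteMeasure μ]
    {F F' : ℝ → K → ℂ} (hF : ∀ x, Continuous (F x))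
    (hF' : Continuous (Function.uncurry F'))
    (h : ∀ x k, HasDerivAt (fun y => F y k) (F' x k) x) (x₀ : ℝ) :
    HasDerivAt (fun x => ∫ k, F x k ∂μ) (∫ k, F' x₀ k ∂μ) x₀ := by
  obtain ⟨C, hC⟩ := ((isCompact_closedBall x₀ 1).prod (isCompact_univ (X := K))).exists_bound_of_continuousOn
    hF'.continuousOn
  refine (hasDerivAt_integral_of_dominated_loc_of_deriv_le (bound := fun _ => C)
    (Metric.closedBall_mem_nhds x₀ one_pos) (Filter.Eventually.of_forall fun x => ?_) ?_ ?_ ?_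
    (integrable_const C) (Filter.Eventually.of_forall fun k x _ => h x k)).2
  · exact (integrable_of_continuous_compactSpace μ (hF x)).aestronglyMeasurable
  · exact integrable_of_continuous_compactSpace μ (hF x₀)
  · refine (integrable_of_continuous_compactSpace μ ?_).aestronglyMeasurable
    exact hF'.comp (by fun_prop : Continuous fun k : K => (x₀, k))
  · exact Filter.Eventually.of_forall fun k x hx => hC (x, k) ⟨hx, trivial⟩

end ParametricIntegral

section UnitaryGroup

variable {n : Type*} [Fintype n] [DecidableEq n]

instance unitaryGroup_compactSpace : CompactSpace (unitaryGroup n ℂ) := by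
  have hemb : Topology.IsEmbedding (fun U : unitaryGroup n ℂ => (Matrix.of.symm (U : Matrix n n ℂ))) :=
    ⟨⟨rfl⟩, fun U V h => Subtype.ext h⟩
  have hrange : Set.range (fun U : unitaryGroup n ℂ => Matrix.of.symm (U : Matrix n n ℂ)) =
      {M : n → n → ℂ | of M * star (of M) = 1 ∧ star (of M) * of M = 1} := by
    ext M
    constructor
    · rintro ⟨U, rfl⟩
      exact ⟨(mem_unitaryGroup_iff).1 U.2, (mem_unitaryGroup_iff').1 U.2⟩
    · rintro ⟨h, -⟩
      exact ⟨⟨of M, mem_unitaryGroup_iff.2 h⟩, rfl⟩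
  refine (hemb.isCompact_iff (s := Set.univ)).2 ?_ |> fun h => ⟨h⟩
  rw [Set.image_univ]
  refine (isCompact_closedBall (0 : n → n → ℂ) 1).of_isClosed_subset ?_ ?_
  · rw [hrange]
    have hc : Continuous fun M : n → n → ℂ => (of M : Matrix n n ℂ) := continuous_id
    exact (isClosed_eq (by fun_prop) continuous_const).inter
      (isClosed_eq (by fun_prop) continuous_const)
  · rintro _ ⟨U, rfl⟩
    rw [mem_closedBall_zero_iff, pi_norm_le_iff_of_nonneg zero_le_one]
    intro i
    rw [pi_norm_le_iff_of_nonneg zero_le_one]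
    exact fun j => entry_norm_bound_of_unitary U.2 i j

instance unitaryGroup_secondCountableTopology : SecondCountableTopology (unitaryGroup n ℂ) :=
  haveI : SecondCountableTopology (Matrix n n ℂ) :=
    inferInstanceAs (SecondCountableTopology (n → n → ℂ))
  TopologicalSpace.Subtype.secondCountableTopology _

noncomputable instance unitaryGroup_measurableSpace : MeasurableSpace (unitaryGroup n ℂ) := borel _

instance unitaryGroup_borelSpace : BorelSpace (unitaryGroup n ℂ) := ⟨rfl⟩

noncomputable def unitaryHaar (n : Type*) [Fintype n] [DecidableEq n] :
    MeasureTheory.Measure (unitaryGroup n ℂ) :=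
  MeasureTheory.Measure.haar

instance : (unitaryHaar n).IsHaarMeasure :=
  inferInstanceAs (MeasureTheory.Measure.IsHaarMeasure MeasureTheory.Measure.haar)

instance : MeasureTheory.IsFiniteMeasure (unitaryHaar n) := inferInstance

end UnitaryGroup

section HaarIntegrationByParts

open MeasureTheory

variable {n : Type*} [Fintype n] [DecidableEq n]

/-- The conjugate `U M U⋆` of a matrix by a unitary matrix. -/
noncomputable def unitaryConj (M : Matrix n n ℂ) (U : unitaryGroup n ℂ) : Matrix n n ℂ :=
  (U : Matrix n n ℂ) * M * star (U : Matrix n n ℂ)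

/-- The exponential weight `exp (∑ a_l (U Y U⋆)_{ll})`. -/
noncomputable def expWeight (Y : Matrix n n ℂ) (a : n → ℝ) (U : unitaryGroup n ℂ) : ℂ :=
  Complex.exp (∑ l, (a l : ℂ) * unitaryConj Y U l l)

@[fun_prop]
theorem continuous_unitaryConj (M : Matrix n n ℂ) : Continuous (unitaryConj M) := by
  unfold unitaryConj
  fun_prop

@[fun_prop]
theorem continuous_unitaryConj_apply (M : Matrix n n ℂ) (i j : n) :
    Continuous fun U => unitaryConj M U i j :=
  (continuous_unitaryConj M).matrix_elem i j

@[fun_prop]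
theorem continuous_expWeight (Y : Matrix n n ℂ) (a : n → ℝ) : Continuous (expWeight Y a) := by
  unfold expWeight
  fun_prop

/-- The conjugate of `M` by the unitary `1 + (exp (I s) - 1) Q` attached to a projection `Q`. -/
noncomputable def projPath (Q M : Matrix n n ℂ) (s : ℝ) : Matrix n n ℂ :=
  M + (Complex.exp (Complex.I * s) - 1) • (Q * M) + (Complex.exp (-(Complex.I * s)) - 1) • (M * Q)
    + (2 - Complex.exp (Complex.I * s) - Complex.exp (-(Complex.I * s))) • (Q * M * Q)

noncomputable def projPathDeriv (Q M : Matrix n n ℂ) (s : ℝ) : Matrix n n ℂ :=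
  (Complex.I * Complex.exp (Complex.I * s)) • (Q * M)
    - (Complex.I * Complex.exp (-(Complex.I * s))) • (M * Q)
    + (Complex.I * Complex.exp (-(Complex.I * s)) - Complex.I * Complex.exp (Complex.I * s)) •
      (Q * M * Q)

omit [DecidableEq n] in
theorem hasDerivAt_projPath (Q M : Matrix n n ℂ) (i j : n) (s : ℝ) :
    HasDerivAt (fun s => projPath Q M s i j) (projPathDeriv Q M s i j) s := by
  have h0 : HasDerivAt (fun s : ℝ => Complex.I * (s : ℂ)) Complex.I s := by
    simpa using (Complex.ofRealCLM.hasDerivAt (x := s)).const_mul Complex.I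
  have h1 := h0.cexp
  have h2 : HasDerivAt (fun s : ℝ => Complex.exp (-(Complex.I * s)))
      (Complex.exp (-(Complex.I * s)) * -Complex.I) s := h0.neg.cexp
  have := ((((h1.sub_const 1).mul_const ((Q * M) i j)).const_add (M i j)).add
    ((h2.sub_const 1).mul_const ((M * Q) i j))).add
    (((h1.const_sub 2).sub h2).mul_const ((Q * M * Q) i j))
  refine this.congr_deriv ?_
  simp only [projPathDeriv, Matrix.add_apply, Matrix.sub_apply, Matrix.smul_apply, smul_eq_mul]
  ring

omit [DecidableEq n] in
theorem projPathDeriv_zero (Q M : Matrix n n ℂ) :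
    projPathDeriv Q M 0 = Complex.I • (Q * M - M * Q) := by
  simp [projPathDeriv, smul_sub]

theorem exists_unitary_projPath {Q : Matrix n n ℂ} (hQ : Q * Q = Q) (hQ' : star Q = Q) (s : ℝ) :
    ∃ T : unitaryGroup n ℂ, ∀ (M : Matrix n n ℂ) (U : unitaryGroup n ℂ),
      unitaryConj M (T * U) = projPath Q (unitaryConj M U) s := by
  set e := Complex.exp (Complex.I * s) with he
  set e' := Complex.exp (-(Complex.I * s)) with he'
  have hee : e * e' = 1 := by rw [he, he', ← Complex.exp_add]; simp
  have hstar : star e = e' := by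
    rw [he, he', Complex.star_def, ← Complex.exp_conj]; simp
  have hTs : star (1 + (e - 1) • Q) = 1 + (e' - 1) • Q := by
    rw [star_add, star_smul, hQ', star_one, star_sub, hstar, star_one]
  have key : (e - 1) + (e' - 1) + (e - 1) * (e' - 1) = 0 := by linear_combination hee
  have hT : 1 + (e - 1) • Q ∈ unitaryGroup n ℂ := by
    rw [mem_unitaryGroup_iff, hTs]
    have : (1 + (e - 1) • Q) * (1 + (e' - 1) • Q) =
        1 + ((e - 1) + (e' - 1) + (e - 1) * (e' - 1)) • Q := by
      simp only [mul_add, add_mul, one_mul, mul_one, smul_mul_smul_comm, hQ]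
      module
    rw [this, key, zero_smul, add_zero]
  refine ⟨⟨1 + (e - 1) • Q, hT⟩, fun M U => ?_⟩
  have : unitaryConj M (⟨1 + (e - 1) • Q, hT⟩ * U) =
      (1 + (e - 1) • Q) * unitaryConj M U * (1 + (e' - 1) • Q) := by
    simp only [unitaryConj, Submonoid.coe_mul, star_mul, hTs, mul_assoc]
  rw [this, projPath]
  generalize unitaryConj M U = W
  have h2 : (2 - e - e') = (e - 1) * (e' - 1) := by linear_combination -hee
  rw [← he, ← he', h2]
  simp only [mul_add, add_mul, one_mul, mul_one, smul_mul_assoc, mul_smul_comm, mul_assoc]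
  module

omit [DecidableEq n] in
theorem hasDerivAt_integral_mul_exp {K : Type*} [TopologicalSpace K] [CompactSpace K] [T2Space K]
    [MeasurableSpace K] [BorelSpace K] (μ : Measure K) [IsFiniteMeasure μ]
    {p p' : ℝ → K → ℂ} {m m' : n → ℝ → K → ℂ} (a : n → ℝ)
    (hp : Continuous (Function.uncurry p)) (hp' : Continuous (Function.uncurry p'))
    (hm : ∀ l, Continuous (Function.uncurry (m l)))
    (hm' : ∀ l, Continuous (Function.uncurry (m' l)))
    (dp : ∀ s k, HasDerivAt (fun s => p s k) (p' s k) s)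
    (dm : ∀ l s k, HasDerivAt (fun s => m l s k) (m' l s k) s) (s₀ : ℝ) :
    HasDerivAt (fun s => ∫ k, p s k * Complex.exp (∑ l, (a l : ℂ) * m l s k) ∂μ)
      (∫ k, (p' s₀ k * Complex.exp (∑ l, (a l : ℂ) * m l s₀ k) + p s₀ k *
        (Complex.exp (∑ l, (a l : ℂ) * m l s₀ k) * ∑ l, (a l : ℂ) * m' l s₀ k)) ∂μ) s₀ := by
  refine hasDerivAt_integral_of_compactSpace μ
    (F := fun s k => p s k * Complex.exp (∑ l, (a l : ℂ) * m l s k))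
    (F' := fun s k => p' s k * Complex.exp (∑ l, (a l : ℂ) * m l s k) + p s k *
        (Complex.exp (∑ l, (a l : ℂ) * m l s k) * ∑ l, (a l : ℂ) * m' l s k)) (fun s => ?_) ?_
    (fun s k => (dp s k).mul (HasDerivAt.fun_sum fun l _ => (dm l s k).const_mul _).cexp) s₀
  · have h1 : Continuous fun k => p s k := hp.comp (Continuous.prodMk_right s)
    have h2 : ∀ l, Continuous fun k => m l s k := fun l => (hm l).comp (Continuous.prodMk_right s)
    fun_prop
  · simp only [Function.uncurry_def] at *
    fun_prop

omit [DecidableEq n] in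
theorem continuous_projPath (Q : Matrix n n ℂ) {K : Type*} [TopologicalSpace K]
    {W : K → Matrix n n ℂ} (hW : Continuous W) (i j : n) :
    Continuous fun q : ℝ × K => projPath Q (W q.2) q.1 i j := by
  have hW' : Continuous fun q : ℝ × K => W q.2 := hW.comp continuous_snd
  unfold projPath
  refine Continuous.matrix_elem ?_ i j
  generalize (fun q : ℝ × K => W q.2) = V at hW'
  fun_prop

omit [DecidableEq n] in
theorem continuous_projPathDeriv (Q : Matrix n n ℂ) {K : Type*} [TopologicalSpace K]
    {W : K → Matrix n n ℂ} (hW : Continuous W) (i j : n) :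
    Continuous fun q : ℝ × K => projPathDeriv Q (W q.2) q.1 i j := by
  have hW' : Continuous fun q : ℝ × K => W q.2 := hW.comp continuous_snd
  unfold projPathDeriv
  refine Continuous.matrix_elem ?_ i j
  fun_prop

theorem integral_projection_commutator {Q : Matrix n n ℂ} (hQ : Q * Q = Q) (hQ' : star Q = Q)
    (Y P : Matrix n n ℂ) (a : n → ℝ) (i j : n) :
    ∫ U, ((∑ l, (a l : ℂ) * (Q * unitaryConj Y U - unitaryConj Y U * Q) l l) * unitaryConj P U i j
      + (Q * unitaryConj P U - unitaryConj P U * Q) i j) * expWeight Y a U ∂(unitaryHaar n) = 0 := by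
  have hd := hasDerivAt_integral_mul_exp (unitaryHaar n)
    (p := fun s U => projPath Q (unitaryConj P U) s i j)
    (p' := fun s U => projPathDeriv Q (unitaryConj P U) s i j)
    (m := fun l s U => projPath Q (unitaryConj Y U) s l l)
    (m' := fun l s U => projPathDeriv Q (unitaryConj Y U) s l l) a
    (continuous_projPath Q (continuous_unitaryConj P) i j)
    (continuous_projPathDeriv Q (continuous_unitaryConj P) i j)
    (fun l => continuous_projPath Q (continuous_unitaryConj Y) l l)
    (fun l => continuous_projPathDeriv Q (continuous_unitaryConj Y) l l)
    (fun s U => hasDerivAt_projPath Q _ i j s) (fun l s U => hasDerivAt_projPath Q _ l l s) 0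
  have hconst : (fun s => ∫ U, projPath Q (unitaryConj P U) s i j *
      Complex.exp (∑ l, (a l : ℂ) * projPath Q (unitaryConj Y U) s l l) ∂(unitaryHaar n)) =
      fun _ => ∫ U, unitaryConj P U i j * expWeight Y a U ∂(unitaryHaar n) := by
    funext s
    obtain ⟨T, hT⟩ := exists_unitary_projPath hQ hQ' s
    rw [← integral_mul_left_eq_self (fun U => unitaryConj P U i j * expWeight Y a U) T]
    simp only [expWeight, hT]
  rw [hconst] at hd
  have h0 := hd.unique (hasDerivAt_const _ _)
  have h1 : ∀ M : Matrix n n ℂ, projPath Q M 0 = M := fun M => by simp [projPath]; norm_num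
  simp only [h1, projPathDeriv_zero] at h0
  have h2 : Complex.I * ∫ U, ((∑ l, (a l : ℂ) * (Q * unitaryConj Y U - unitaryConj Y U * Q) l l) *
      unitaryConj P U i j + (Q * unitaryConj P U - unitaryConj P U * Q) i j) *
      expWeight Y a U ∂(unitaryHaar n) = 0 := by
    rw [← h0, ← integral_const_mul]
    refine integral_congr_ae (Filter.Eventually.of_forall fun U => ?_)
    simp only [expWeight, Matrix.smul_apply, smul_eq_mul, mul_left_comm _ Complex.I,
      ← Finset.mul_sum]
    ring
  simpa using h2

theorem integral_commutator (Y P : Matrix n n ℂ) (a : n → ℝ) {i j : n} (hij : i ≠ j) :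
    ((a i : ℂ) - a j) * ∫ U, unitaryConj Y U j i * unitaryConj P U i j * expWeight Y a U
        ∂(unitaryHaar n) =
      (∫ U, unitaryConj P U i i * expWeight Y a U ∂(unitaryHaar n)) -
        ∫ U, unitaryConj P U j j * expWeight Y a U ∂(unitaryHaar n) := by
  set f : Matrix n n ℂ → unitaryGroup n ℂ → ℂ := fun Q U =>
    ((∑ l, (a l : ℂ) * (Q * unitaryConj Y U - unitaryConj Y U * Q) l l) * unitaryConj P U i j
      + (Q * unitaryConj P U - unitaryConj P U * Q) i j) * expWeight Y a U with hf
  have hcont : ∀ Q, Continuous (f Q) := fun Q => by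
    have h : ∀ (M : Matrix n n ℂ) (k l : n), Continuous fun U =>
        (Q * unitaryConj M U - unitaryConj M U * Q) k l := fun M k l =>
      Continuous.matrix_elem (by fun_prop) k l
    simp only [hf]
    fun_prop
  have hfint : ∀ Q, Integrable (f Q) (unitaryHaar n) := fun Q =>
    integrable_of_continuous_compactSpace _ (hcont Q)
  have hadd : ∀ Q R U, f (Q + R) U = f Q U + f R U := fun Q R U => by
    simp only [hf, add_mul, mul_add, Matrix.add_apply, Matrix.sub_apply, mul_sub,
      Finset.sum_add_distrib, Finset.sum_sub_distrib]
    ring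
  have hsmul : ∀ (c : ℂ) Q U, f (c • Q) U = c * f Q U := fun c Q U => by
    simp only [hf, smul_mul_assoc, mul_smul_comm, Matrix.smul_apply, Matrix.sub_apply,
      mul_sub, Finset.sum_sub_distrib, smul_eq_mul, mul_left_comm _ c,
      ← Finset.mul_sum]
    ring
  set L : Matrix n n ℂ →ₗ[ℂ] ℂ :=
    { toFun := fun Q => ∫ U, f Q U ∂(unitaryHaar n)
      map_add' := fun Q R => by simp only [hadd]; exact integral_add (hfint Q) (hfint R)
      map_smul' := fun c Q => by simp only [hsmul]; exact integral_const_mul c _ } with hL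
  have hL0 : ∀ Q : Matrix n n ℂ, Q * Q = Q → star Q = Q → L Q = 0 := fun Q h h' =>
    integral_projection_commutator h h' Y P a i j
  set R : ℂ → Matrix n n ℂ := fun w => (1 / 2 : ℂ) •
    (single i i 1 + single j j 1 + star w • single i j 1 + w • single j i 1) with hR
  have hR0 : ∀ w : ℂ, w * star w = 1 → L (R w) = 0 := fun w hw => by
    refine hL0 _ ?_ ?_
    · simp only [hR, mul_add, add_mul, smul_mul_assoc, mul_smul_comm,
        single_mul_single_same, single_mul_single_of_ne _ _ _ _ hij,
        single_mul_single_of_ne _ _ _ _ hij.symm, smul_smul]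
      simp only [mul_one, smul_zero, add_zero, zero_add, smul_add]
      match_scalars <;> first | ring1 | linear_combination (1 / 4) * hw
    · simp only [hR, star_smul, star_add, star_eq_conjTranspose, conjTranspose_single, star_one,
        star_star]
      simp only [smul_add, star_div₀, star_one, star_ofNat]
      module
  have hE : single i j (1 : ℂ) = (1 / 2 : ℂ) • (R 1 - R (-1)) +
      (Complex.I / 2) • (R Complex.I - R (-Complex.I)) := by
    simp only [hR, Complex.star_def, Complex.conj_I]
    match_scalars <;> ring_nf <;> simp <;> norm_num
  have h0 : L (single i j 1) = 0 := by
    rw [hE, map_add, map_smul, map_smul, map_sub, map_sub, hR0, hR0, hR0, hR0] <;> simp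
  have hpt : ∀ U, f (single i j 1) U = ((a i : ℂ) - a j) *
      (unitaryConj Y U j i * unitaryConj P U i j * expWeight Y a U) -
      (unitaryConj P U i i * expWeight Y a U - unitaryConj P U j j * expWeight Y a U) := fun U => by
    have h1 : (single i j (1 : ℂ) * unitaryConj P U - unitaryConj P U * single i j 1 : Matrix n n ℂ) i j =
      unitaryConj P U j j - unitaryConj P U i i := by simp
    have h2 : ∑ l, (a l : ℂ) *
        (single i j 1 * unitaryConj Y U - unitaryConj Y U * single i j 1 : Matrix n n ℂ) l l =
        ((a i : ℂ) - a j) * unitaryConj Y U j i := by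
      simp only [Matrix.sub_apply, mul_sub, Finset.sum_sub_distrib]
      rw [Finset.sum_eq_single i, Finset.sum_eq_single j]
      · simp [sub_mul]
      · intro l _ hl; simp [hl]
      · simp
      · intro l _ hl; simp [hl]
      · simp
    simp only [hf, h1, h2]
    ring
  have hN : ∀ k, Integrable (fun U => unitaryConj P U k k * expWeight Y a U) (unitaryHaar n) :=
    fun k => integrable_of_continuous_compactSpace _ (by fun_prop)
  have h3 : L (single i j 1) = ∫ U, f (single i j 1) U ∂(unitaryHaar n) := rfl
  rw [h0] at h3
  simp only [hpt] at h3
  rw [integral_sub, integral_sub (hN i) (hN j), integral_const_mul] at h3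
  · linear_combination -h3
  · exact integrable_of_continuous_compactSpace _ (by fun_prop)
  · exact integrable_of_continuous_compactSpace _ (by fun_prop)

end HaarIntegrationByParts

section SmoothFunctions

open scoped ContDiff

variable {n : Type*} [Fintype n]

/-- The algebra of smooth complex valued functions on `n → ℝ`. -/
def smoothFun (n : Type*) [Fintype n] : Subalgebra ℂ ((n → ℝ) → ℂ) where
  carrier := {f | ContDiff ℝ ∞ f}
  mul_mem' {f g} (hf : ContDiff ℝ ∞ f) (hg : ContDiff ℝ ∞ g) := hf.mul hg
  add_mem' {f g} (hf : ContDiff ℝ ∞ f) (hg : ContDiff ℝ ∞ g) := hf.add hg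
  algebraMap_mem' c := show ContDiff ℝ ∞ (fun _ => c) from contDiff_const

theorem smoothFun.contDiff (f : smoothFun n) : ContDiff ℝ ∞ f.1 := f.2

theorem smoothFun.differentiable (f : smoothFun n) : Differentiable ℝ f.1 :=
  (smoothFun.contDiff f).differentiable (by simp)

/-- The partial derivative as a derivation on smooth functions. -/
noncomputable def smoothFun.partialDeriv [DecidableEq n] (i : n) :
    Derivation ℂ (smoothFun n) (smoothFun n) where
  toFun f := ⟨fun a => fderiv ℝ f.1 a (Pi.single i 1),
    show ContDiff ℝ ∞ (fun a => fderiv ℝ f.1 a (Pi.single i 1)) from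
      ((smoothFun.contDiff f).fderiv_right (m := ∞) le_rfl).clm_apply contDiff_const⟩
  map_add' f g := by
    refine Subtype.ext (funext fun a => ?_)
    change fderiv ℝ (f.1 + g.1) a _ = _
    rw [fderiv_add (smoothFun.differentiable f a) (smoothFun.differentiable g a)]
    rfl
  map_smul' c f := by
    refine Subtype.ext (funext fun a => ?_)
    change fderiv ℝ (c • f.1) a _ = _
    rw [fderiv_const_smul (smoothFun.differentiable f a)]
    rfl
  map_one_eq_zero' := by
    refine Subtype.ext (funext fun a => ?_)
    change fderiv ℝ (fun _ => (1 : ℂ)) a _ = _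
    simp
  leibniz' f g := by
    refine Subtype.ext (funext fun a => ?_)
    change fderiv ℝ (f.1 * g.1) a _ = _
    rw [fderiv_mul (smoothFun.differentiable f a) (smoothFun.differentiable g a)]
    simp

theorem smoothFun.partialDeriv_apply [DecidableEq n] (i : n) (f : smoothFun n) (a : n → ℝ) :
    (smoothFun.partialDeriv i f).1 a = fderiv ℝ f.1 a (Pi.single i 1) := rfl

theorem smoothFun.partialDeriv_comm [DecidableEq n] (i j : n) (f : smoothFun n) :
    smoothFun.partialDeriv i (smoothFun.partialDeriv j f) =
      smoothFun.partialDeriv j (smoothFun.partialDeriv i f) := by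
  refine Subtype.ext (funext fun a => ?_)
  have hs : IsSymmSndFDerivAt ℝ f.1 a :=
    (smoothFun.contDiff f).contDiffAt.isSymmSndFDerivAt (by
      simpa using WithTop.coe_le_coe.2 (le_top : (2 : ℕ∞) ≤ ⊤))
  have key : ∀ k l : n, (smoothFun.partialDeriv k (smoothFun.partialDeriv l f)).1 a =
      fderiv ℝ (fderiv ℝ f.1) a (Pi.single k 1) (Pi.single l 1) := fun k l => by
    have hd : DifferentiableAt ℝ (fderiv ℝ f.1) a :=
      (((smoothFun.contDiff f).fderiv_right (m := ∞) le_rfl).differentiable (by simp)) a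
    change fderiv ℝ (fun a => fderiv ℝ f.1 a (Pi.single l 1)) a (Pi.single k 1) = _
    rw [fderiv_clm_apply hd (differentiableAt_const _)]
    simp
  rw [key, key]
  exact hs _ _

/-- The coordinate functions. -/
noncomputable def smoothFun.coord (j : n) : smoothFun n :=
  ⟨fun a => (a j : ℂ), show ContDiff ℝ ∞ (fun a : n → ℝ => (a j : ℂ)) from
    Complex.ofRealCLM.contDiff.comp (contDiff_apply ℝ ℝ j)⟩

theorem smoothFun.partialDeriv_coord [DecidableEq n] (i j : n) :
    smoothFun.partialDeriv i (smoothFun.coord j) = if i = j then 1 else 0 := by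
  refine Subtype.ext (funext fun a => ?_)
  rw [smoothFun.partialDeriv_apply]
  have : (smoothFun.coord j).1 = (Complex.ofRealCLM.comp (ContinuousLinearMap.proj (R := ℝ)
    (φ := fun _ : n => ℝ) j) : (n → ℝ) →L[ℝ] ℂ) := rfl
  rw [this, ContinuousLinearMap.fderiv]
  split_ifs with h
  · subst h; simp
  · simp [Ne.symm h]

theorem smoothFun.eq_zero_of_coord_sub_mul {i j : n} (hij : i ≠ j) {f : smoothFun n}
    (h : (smoothFun.coord i - smoothFun.coord j) * f = 0) : f = 0 := by
  classical
  have hne : ∀ a : n → ℝ, a i ≠ a j → f.1 a = 0 := fun a ha => by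
    have := congrFun (congrArg Subtype.val h) a
    have h2 : ((a i : ℂ) - a j) * f.1 a = 0 := this
    rcases mul_eq_zero.1 h2 with h3 | h3
    · exact absurd (by exact_mod_cast sub_eq_zero.1 h3) ha
    · exact h3
  refine Subtype.ext (funext fun a => ?_)
  by_cases ha : a i = a j
  · have hc : Continuous fun t : ℝ => f.1 (a + t • Pi.single i 1) :=
      (smoothFun.contDiff f).continuous.comp (by fun_prop)
    have hz : Set.EqOn (fun t : ℝ => f.1 (a + t • Pi.single i 1)) (fun _ => 0) {0}ᶜ := by
      intro t ht
      refine hne _ ?_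
      have : t ≠ 0 := ht
      simpa [Pi.single_apply, hij.symm, ha] using this
    have := Continuous.ext_on (dense_compl_singleton (0 : ℝ)) hc continuous_const hz
    simpa using congrFun this 0
  · exact hne a ha

/-- A smooth function with logarithmic gradient `y` is a multiple of an exponential. -/
theorem smoothFun.eq_const_mul_exp [DecidableEq n] {f : smoothFun n} {y : n → ℂ}
    (h : ∀ i, smoothFun.partialDeriv i f = y i • f) (a : n → ℝ) :
    f.1 a = f.1 0 * Complex.exp (∑ i, y i * a i) := by
  set E : (n → ℝ) → ℂ := fun a => Complex.exp (-∑ i, y i * a i) with hE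
  set L : (n → ℝ) →L[ℝ] ℂ := -∑ i, y i • (Complex.ofRealCLM.comp
    (ContinuousLinearMap.proj (R := ℝ) (φ := fun _ : n => ℝ) i)) with hL
  have hLa : ∀ a, L a = -∑ i, y i * a i := fun a => by simp [hL]
  have hEd : ∀ a, HasFDerivAt E (E a • L) a := fun a => by
    have := (L.hasFDerivAt (x := a)).cexp
    simpa only [hLa] using this
  have hfd : ∀ a, fderiv ℝ f.1 a = -(f.1 a • L) := fun a => by
    refine ContinuousLinearMap.coe_injective (LinearMap.pi_ext' fun i => ?_)
    ext
    have h1 := congrFun (congrArg Subtype.val (h i)) a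
    rw [smoothFun.partialDeriv_apply] at h1
    have h2 : L (Pi.single i 1) = - y i := by simp [hLa, Pi.single_apply, apply_ite (fun r : ℝ => (r : ℂ))]
    have h3 : ((y i • f : smoothFun n)).1 a = y i * f.1 a := rfl
    simp [h1, h2, h3, mul_comm]
  have hprod : ∀ a, HasFDerivAt (fun a => f.1 a * E a) (0 : (n → ℝ) →L[ℝ] ℂ) a := fun a => by
    have := ((smoothFun.differentiable f a).hasFDerivAt).mul (hEd a)
    refine this.congr_fderiv ?_
    rw [hfd]
    ext v
    simp
    ring
  have hconst := is_const_of_fderiv_eq_zero (𝕜 := ℝ) (f := fun a => f.1 a * E a)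
    (fun a => (hprod a).differentiableAt) (fun a => (hprod a).fderiv) a 0
  have hE0 : E 0 = 1 := by simp [hE]
  rw [hE0, mul_one] at hconst
  rw [← hconst, hE, mul_assoc, ← Complex.exp_add]
  simp

end SmoothFunctions

section LaplaceTransform

open MeasureTheory
open scoped ContDiff

variable {n : Type*} [Fintype n] {K : Type*} [TopologicalSpace K] [CompactSpace K] [T2Space K]
    [MeasurableSpace K] [BorelSpace K] (μ : Measure K) [IsFiniteMeasure μ]

theorem hasFDerivAt_integral_mul_exp {ζ : n → K → ℂ} (hζ : ∀ i, Continuous (ζ i)) {w : K → ℂ}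
    (hw : Continuous w) (a : n → ℝ) :
    HasFDerivAt (fun a : n → ℝ => ∫ k, w k * Complex.exp (∑ i, (a i : ℂ) * ζ i k) ∂μ)
      (∫ k, ∑ i, (ζ i k * w k * Complex.exp (∑ i, (a i : ℂ) * ζ i k)) • (Complex.ofRealCLM.comp
    (ContinuousLinearMap.proj (R := ℝ) (φ := fun _ : n => ℝ) i)) ∂μ) a := by
  refine hasFDerivAt_integral_of_compactSpace μ
    (F := fun a k => w k * Complex.exp (∑ i, (a i : ℂ) * ζ i k))
    (F' := fun a k => ∑ i, (ζ i k * w k * Complex.exp (∑ i, (a i : ℂ) * ζ i k)) •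
      (Complex.ofRealCLM.comp (ContinuousLinearMap.proj (R := ℝ) (φ := fun _ : n => ℝ) i)))
    (fun a => by fun_prop) ?_ (fun a k => ?_) a
  · simp only [Function.uncurry_def]
    fun_prop
  · have h1 : ∀ i, HasFDerivAt (fun a : n → ℝ => (a i : ℂ) * ζ i k)
        (ζ i k • Complex.ofRealCLM.comp
          (ContinuousLinearMap.proj (R := ℝ) (φ := fun _ : n => ℝ) i)) a := fun i =>
      (ContinuousLinearMap.hasFDerivAt (Complex.ofRealCLM.comp
          (ContinuousLinearMap.proj (R := ℝ) (φ := fun _ : n => ℝ) i))).mul_const (ζ i k)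
    refine ((HasFDerivAt.fun_sum fun i _ => h1 i).cexp.const_mul (w k)).congr_fderiv ?_
    rw [Finset.smul_sum, Finset.smul_sum]
    refine Finset.sum_congr rfl fun i _ => ?_
    rw [smul_smul, smul_smul]
    congr 1
    ring

theorem fderiv_integral_mul_exp {ζ : n → K → ℂ} (hζ : ∀ i, Continuous (ζ i)) {w : K → ℂ}
    (hw : Continuous w) (a v : n → ℝ) :
    fderiv ℝ (fun a : n → ℝ => ∫ k, w k * Complex.exp (∑ i, (a i : ℂ) * ζ i k) ∂μ) a v =
      ∑ i, (v i : ℂ) * ∫ k, ζ i k * w k * Complex.exp (∑ i, (a i : ℂ) * ζ i k) ∂μ := by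
  rw [(hasFDerivAt_integral_mul_exp μ hζ hw a).fderiv, ContinuousLinearMap.integral_apply]
  · simp only [← integral_const_mul]
    rw [← integral_finsetSum]
    · refine integral_congr_ae (Filter.Eventually.of_forall fun k => ?_)
      simp [mul_comm]
    · exact fun i _ => integrable_of_continuous_compactSpace _ (by fun_prop)
  · exact integrable_of_continuous_compactSpace _ (by fun_prop)

theorem contDiff_integral_mul_exp {ζ : n → K → ℂ} (hζ : ∀ i, Continuous (ζ i)) {w : K → ℂ}
    (hw : Continuous w) :
    ContDiff ℝ ∞ (fun a : n → ℝ => ∫ k, w k * Complex.exp (∑ i, (a i : ℂ) * ζ i k) ∂μ) := by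
  rw [contDiff_infty]
  intro m
  induction m generalizing w with
  | zero =>
    exact contDiff_zero.2 (Differentiable.continuous (𝕜 := ℝ) fun a =>
      (hasFDerivAt_integral_mul_exp μ hζ hw a).differentiableAt)
  | succ m ih =>
    have := (contDiff_succ_iff_fderiv_apply (𝕜 := ℝ) (n := m)
      (f := fun a : n → ℝ => ∫ k, w k * Complex.exp (∑ i, (a i : ℂ) * ζ i k) ∂μ)).2
      ⟨fun a => (hasFDerivAt_integral_mul_exp μ hζ hw a).differentiableAt, by simp, fun v => by
        simp only [fderiv_integral_mul_exp μ hζ hw]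
        exact ContDiff.sum fun i _ => contDiff_const.mul (ih ((hζ i).mul hw))⟩
    exact_mod_cast this

/-- The Laplace-type transform of the measure `w μ` along the map `ζ`, as a smooth function. -/
noncomputable def laplaceTransform {ζ : n → K → ℂ} (hζ : ∀ i, Continuous (ζ i)) :
    C(K, ℂ) →ₗ[ℂ] smoothFun n where
  toFun w := ⟨_, contDiff_integral_mul_exp μ hζ w.continuous⟩
  map_add' w w' := by
    refine Subtype.ext (funext fun a => ?_)
    change ∫ k, (w k + w' k) * Complex.exp (∑ i, (a i : ℂ) * ζ i k) ∂μ =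
      (∫ k, w k * Complex.exp (∑ i, (a i : ℂ) * ζ i k) ∂μ) +
        ∫ k, w' k * Complex.exp (∑ i, (a i : ℂ) * ζ i k) ∂μ
    simp only [add_mul]
    exact integral_add (integrable_of_continuous_compactSpace μ (by fun_prop))
      (integrable_of_continuous_compactSpace μ (by fun_prop))
  map_smul' c w := by
    refine Subtype.ext (funext fun a => ?_)
    change ∫ k, (c * w k) * Complex.exp (∑ i, (a i : ℂ) * ζ i k) ∂μ =
      c * ∫ k, w k * Complex.exp (∑ i, (a i : ℂ) * ζ i k) ∂μ
    simp only [mul_assoc]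
    exact integral_const_mul c _

theorem laplaceTransform_apply {ζ : n → K → ℂ} (hζ : ∀ i, Continuous (ζ i)) (w : C(K, ℂ))
    (a : n → ℝ) : (laplaceTransform μ hζ w).1 a =
      ∫ k, w k * Complex.exp (∑ i, (a i : ℂ) * ζ i k) ∂μ := rfl

theorem partialDeriv_laplaceTransform [DecidableEq n] {ζ : n → K → ℂ}
    (hζ : ∀ i, Continuous (ζ i)) (w : C(K, ℂ)) (i : n) :
    smoothFun.partialDeriv i (laplaceTransform μ hζ w) =
      laplaceTransform μ hζ (⟨ζ i, hζ i⟩ * w) := by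
  refine Subtype.ext (funext fun a => ?_)
  rw [smoothFun.partialDeriv_apply]
  refine (fderiv_integral_mul_exp μ hζ w.continuous a _).trans ?_
  simp only [Pi.single_apply]
  rw [Finset.sum_eq_single i]
  · simp [laplaceTransform]
  · intro b _ hb
    simp [hb]
  · simp

end LaplaceTransform

section VandermondeDerivation

open Finset Polynomial

variable {k V : Type*} [Field k] [CommRing V] [Algebra k V]

theorem Derivation.mul_apply_prod {ι : Type*} (D : Derivation k V V) {q : V} {f g : ι → V}
    (S : Finset ι) (h : ∀ x ∈ S, q * D (f x) = f x * g x) :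
    q * D (∏ x ∈ S, f x) = (∏ x ∈ S, f x) * ∑ x ∈ S, g x := by
  classical
  induction S using Finset.induction_on with
  | empty => simp
  | insert x S hx ih =>
    have h1 := h x (mem_insert_self _ _)
    have h2 := ih fun y hy => h y (mem_insert_of_mem hy)
    rw [prod_insert hx, sum_insert hx, D.leibniz, smul_eq_mul, smul_eq_mul]
    linear_combination (f x) * h2 + (∏ x ∈ S, f x) * h1

theorem Derivation.sum_pow_mul_coeff (D : Derivation k V V) {x : V} (hx : D x = 1) {p : ℕ}
    {H : V[X]} (hH : H.natDegree < p) :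
    ∑ r ∈ range p, x ^ r * D (H.coeff r) = D (H.eval x) - H.derivative.eval x := by
  rw [derivative_eval, H.sum_over_range' (by simp) p hH, eval_eq_sum_range' hH, map_sum,
    ← sum_sub_distrib]
  refine sum_congr rfl fun r _ => ?_
  rw [D.leibniz, D.leibniz_pow, hx]
  simp
  ring

variable {n : Type*} [Fintype n] [DecidableEq n]

theorem eval_prod_erase (a : n → V) (i j : n) :
    (∏ l ∈ univ.erase j, (X - C (a l))).eval (a i) =
      if i = j then ∏ l ∈ univ.erase i, (a i - a l) else 0 := by
  rw [eval_prod]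
  split_ifs with h
  · subst h; simp
  · exact prod_eq_zero (mem_erase.2 ⟨h, mem_univ i⟩) (by simp)

theorem eval_derivative_prod_erase (a : n → V) (i j : n) :
    (derivative (∏ l ∈ univ.erase j, (X - C (a l)))).eval (a i) =
      if i = j then ∑ l ∈ univ.erase i, ∏ m ∈ (univ.erase i).erase l, (a i - a m)
      else ∏ m ∈ (univ.erase i).erase j, (a i - a m) := by
  rw [derivative_prod_finset, eval_finsetSum]
  split_ifs with h
  · subst h
    refine sum_congr rfl fun l _ => ?_
    simp [eval_prod]
  · rw [sum_eq_single i]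
    · rw [erase_right_comm]; simp [eval_prod]
    · intro b hb hbi
      rw [eval_mul, eval_prod, prod_eq_zero (i := i), zero_mul]
      · exact mem_erase.2 ⟨Ne.symm hbi, mem_erase.2 ⟨h, mem_univ i⟩⟩
      · simp
    · exact fun hi => absurd (mem_erase.2 ⟨h, mem_univ i⟩) hi

theorem Derivation.apply_prod_erase (D : Derivation k V V) {a : n → V} {i : n}
    (hD : ∀ j, D (a j) = if i = j then 1 else 0) :
    D (∏ l ∈ univ.erase i, (a i - a l)) =
      ∑ l ∈ univ.erase i, ∏ m ∈ (univ.erase i).erase l, (a i - a m) := by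
  have h : ∀ S : Finset n, i ∉ S → D (∏ l ∈ S, (a i - a l)) =
      ∑ l ∈ S, ∏ m ∈ S.erase l, (a i - a m) := by
    intro S
    induction S using Finset.induction_on with
    | empty => simp
    | insert x S hx ih =>
      intro hi
      have hix : i ≠ x := fun h => hi (h ▸ mem_insert_self _ _)
      rw [prod_insert hx, sum_insert hx, D.leibniz, ih fun h => hi (mem_insert_of_mem h),
        map_sub, hD, hD, if_pos rfl, if_neg hix, erase_insert hx, smul_eq_mul, smul_eq_mul,
        mul_sum, sub_zero, mul_one, add_comm]
      congr 1
      refine sum_congr rfl fun l hl => ?_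
      have hlx : x ≠ l := fun h => hx (h ▸ hl)
      rw [erase_insert_of_ne hlx, prod_insert fun h => hx (mem_of_mem_erase h)]
  exact h _ (notMem_erase i _)

variable {p : ℕ}

theorem Derivation.mul_apply_vandermonde (D : Derivation k V V) {a : Fin p → V} {i : Fin p}
    (hD : ∀ j, D (a j) = if i = j then 1 else 0) :
    (∏ l ∈ univ.erase i, (a i - a l)) * D (∏ j : Fin p, ∏ l ∈ Ioi j, (a l - a j)) =
      (∏ j : Fin p, ∏ l ∈ Ioi j, (a l - a j)) *
        ∑ l ∈ univ.erase i, ∏ m ∈ (univ.erase i).erase l, (a i - a m) := by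
  set r : Fin p → V := fun l => ∏ m ∈ (univ.erase i).erase l, (a i - a m) with hr
  have hqr : ∀ l, i ≠ l → ∏ l ∈ univ.erase i, (a i - a l) = (a i - a l) * r l := fun l hl =>
    (mul_prod_erase _ _ (mem_erase.2 ⟨hl.symm, mem_univ l⟩)).symm
  rw [D.mul_apply_prod univ (g := fun j => ∑ l ∈ Ioi j,
    if i = j then r l else if i = l then r j else 0)]
  · congr 1
    have : ∀ l ∈ univ.erase i, r l = (if i < l then r l else 0) + if l < i then r l else 0 := by
      intro l hl
      rcases lt_or_gt_of_ne (ne_of_mem_erase hl) with h | h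
      · simp [h, h.not_gt]
      · simp [h, h.not_gt]
    rw [sum_congr rfl this, sum_add_distrib]
    have h2 : ∀ j, (∑ l ∈ Ioi j, if i = j then r l else if i = l then r j else 0) =
        (if i = j then ∑ l ∈ Ioi i, r l else 0) + if j < i then r j else 0 := by
      intro j
      by_cases h : i = j
      · subst h; simp
      · simp [h]
    rw [sum_congr rfl fun j _ => h2 j, sum_add_distrib]
    congr 1
    · simp only [sum_ite_eq, mem_univ, if_true]
      rw [← sum_filter]
      refine sum_congr ?_ fun _ _ => rfl
      ext l
      simp only [mem_Ioi, mem_filter, mem_erase, mem_univ, and_true]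
      exact ⟨fun h => ⟨h.ne', h⟩, fun h => h.2⟩
    · symm
      refine sum_subset (erase_subset _ _) fun l _ hl => ?_
      have : l = i := by simpa using hl
      simp [this]
  · intro j _
    refine D.mul_apply_prod _ fun l hl => ?_
    have hjl : j < l := mem_Ioi.1 hl
    rw [map_sub, hD, hD]
    by_cases h1 : i = j
    · subst h1
      rw [if_neg hjl.ne, if_pos rfl, if_pos rfl, hqr l hjl.ne]; ring
    · by_cases h2 : i = l
      · subst h2
        rw [if_pos rfl, if_neg h1, if_neg h1, if_pos rfl, hqr j h1]; ring
      · simp [h1, h2]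

/-- The polynomial whose values at the nodes `a i` are the multiples `Δ M_i ∏_{l ≠ i} (a_i - a_l)`
of the Vandermonde product `Δ`. -/
noncomputable def vandermondeInterpolant (a M : Fin p → V) : V[X] :=
  ∑ j, C ((∏ j : Fin p, ∏ l ∈ Ioi j, (a l - a j)) * M j) * ∏ l ∈ univ.erase j, (X - C (a l))

theorem natDegree_vandermondeInterpolant_lt (hp : 0 < p) (a M : Fin p → V) :
    (vandermondeInterpolant a M).natDegree < p := by
  refine lt_of_le_of_lt (natDegree_sum_le_of_forall_le (n := p - 1) _ _ fun j _ => ?_) (by omega)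
  refine (natDegree_C_mul_le _ _).trans ((natDegree_prod_le _ _).trans ?_)
  refine (sum_le_card_nsmul _ _ 1 fun l _ => natDegree_X_sub_C_le _).trans ?_
  simp [card_erase_of_mem]

theorem coeff_vandermondeInterpolant (a M : Fin p → V) :
    (vandermondeInterpolant a M).coeff (p - 1) =
      (∏ j : Fin p, ∏ l ∈ Ioi j, (a l - a j)) * ∑ j, M j := by
  rw [vandermondeInterpolant, finsetSum_coeff, mul_sum]
  refine sum_congr rfl fun j _ => ?_
  rw [coeff_C_mul]
  have hc : (univ.erase j).card = p - 1 := by simp [card_erase_of_mem]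
  have h1 : (∏ l ∈ univ.erase j, (X - C (a l))).coeff (p - 1) = 1 := by
    nontriviality V
    have hm : (∏ l ∈ univ.erase j, (X - C (a l))).Monic := monic_prod_X_sub_C _ _
    have hd : (∏ l ∈ univ.erase j, (X - C (a l))).natDegree = p - 1 := by
      rw [natDegree_prod_of_monic _ _ fun l _ => monic_X_sub_C _]; simp [hc]
    rw [← hd]; exact hm
  rw [h1, mul_one]

theorem Derivation.sum_pow_mul_coeff_vandermondeInterpolant (hp : 0 < p) (D : Derivation k V V)
    {a M Q : Fin p → V} {i : Fin p} (y : k) (hD : ∀ j, D (a j) = if i = j then 1 else 0)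
    (hM : D (M i) = y • M i - ∑ j ∈ univ.erase i, Q j)
    (hQ : ∀ j, i ≠ j → (a i - a j) * Q j = M i - M j) :
    ∑ r ∈ range p, a i ^ r * (D ((vandermondeInterpolant a M).coeff r) -
      y • (vandermondeInterpolant a M).coeff r) = 0 := by
  have hN := natDegree_vandermondeInterpolant_lt hp a M
  have hii : D (a i) = 1 := by rw [hD, if_pos rfl]
  set H := vandermondeInterpolant a M with hH
  simp only [mul_sub, sum_sub_distrib, mul_smul_comm]
  rw [D.sum_pow_mul_coeff hii hN, ← smul_sum]
  have he : ∑ r ∈ range p, a i ^ r * H.coeff r = H.eval (a i) := by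
    rw [eval_eq_sum_range' hN]; exact sum_congr rfl fun r _ => mul_comm _ _
  rw [he]
  have h1 := D.mul_apply_vandermonde hD
  have h2 := D.apply_prod_erase hD
  set Δ := ∏ j : Fin p, ∏ l ∈ Ioi j, (a l - a j) with hΔ
  set q := ∏ l ∈ univ.erase i, (a i - a l) with hq
  set r : Fin p → V := fun l => ∏ m ∈ (univ.erase i).erase l, (a i - a m) with hr
  have hqr : ∀ l, i ≠ l → q = (a i - a l) * r l := fun l hl =>
    (mul_prod_erase _ _ (mem_erase.2 ⟨hl.symm, mem_univ l⟩)).symm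
  have h3 : H.eval (a i) = Δ * M i * q := by
    rw [hH, vandermondeInterpolant, eval_finsetSum, sum_eq_single i]
    · rw [eval_mul, eval_C, eval_prod_erase, if_pos rfl]
    · intro j _ hj
      rw [eval_mul, eval_prod_erase, if_neg hj.symm, mul_zero]
    · simp
  have h4 : H.derivative.eval (a i) =
      Δ * M i * (∑ l ∈ univ.erase i, r l) + ∑ j ∈ univ.erase i, Δ * M j * r j := by
    rw [hH, vandermondeInterpolant, derivative_sum, eval_finsetSum,
      ← add_sum_erase _ _ (mem_univ i)]
    congr 1
    · rw [derivative_C_mul, eval_mul, eval_C, eval_derivative_prod_erase, if_pos rfl]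
    · refine sum_congr rfl fun j hj => ?_
      rw [derivative_C_mul, eval_mul, eval_C, eval_derivative_prod_erase,
        if_neg (ne_of_mem_erase hj).symm]
  have h5 : ∑ j ∈ univ.erase i, ((M i - M j) * r j - Q j * q) = 0 := by
    refine sum_eq_zero fun j hj => ?_
    have hij := (ne_of_mem_erase hj).symm
    rw [← hQ j hij, hqr j hij]; ring
  have h6 : ∑ j ∈ univ.erase i, ((M i - M j) * r j - Q j * q) =
      M i * ∑ j ∈ univ.erase i, r j - ∑ j ∈ univ.erase i, M j * r j
        - (∑ j ∈ univ.erase i, Q j) * q := by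
    simp only [sub_mul, sum_sub_distrib, mul_sum, sum_mul]
  rw [h6] at h5
  rw [h3, h4, D.leibniz, D.leibniz, hM, h2]
  simp only [smul_eq_mul, mul_assoc, ← mul_sum, Algebra.smul_def] at *
  linear_combination (M i) * h1 + Δ * h5

end VandermondeDerivation

section CommutingDerivations

open Finset

variable {k V : Type*} [Field k] [CommRing V] [Algebra k V] {n : Type*} [Fintype n] [DecidableEq n]

open scoped IsMulCommutative in
omit [Fintype n] [DecidableEq n] in
theorem exists_mvPolynomial_action (D : n → Derivation k V V)
    (hD : ∀ i j f, D i (D j f) = D j (D i f)) :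
    ∃ φ : MvPolynomial n k →ₐ[k] Module.End k V, ∀ i f, φ (MvPolynomial.X i) f = D i f := by
  set S : Set (Module.End k V) := Set.range fun i => (D i : V →ₗ[k] V)
  have hcomm : ∀ a ∈ S, ∀ b ∈ S, a * b = b * a := by
    rintro _ ⟨i, rfl⟩ _ ⟨j, rfl⟩
    exact LinearMap.ext fun f => hD i j f
  have := Algebra.isMulCommutative_adjoin k hcomm
  refine ⟨(Subalgebra.val _).comp (MvPolynomial.aeval fun i =>
    (⟨_, Algebra.subset_adjoin ⟨i, rfl⟩⟩ : Algebra.adjoin k S)), fun i f => ?_⟩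
  rw [AlgHom.comp_apply, MvPolynomial.aeval_X]
  rfl

variable {φ : MvPolynomial n k →ₐ[k] Module.End k V} {D : n → Derivation k V V}

omit [Fintype n] [DecidableEq n] in
theorem mvPolynomial_action_X_sub_C (hφ : ∀ i f, φ (MvPolynomial.X i) f = D i f) (i : n) (y : k)
    (f : V) : φ (MvPolynomial.X i - MvPolynomial.C y) f = D i f - y • f := by
  have : φ (MvPolynomial.C y) = algebraMap k (Module.End k V) y := φ.commutes y
  rw [map_sub, LinearMap.sub_apply, hφ, this, Module.algebraMap_end_apply]

omit [Fintype n] in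
theorem mvPolynomial_action_prod_mul (hφ : ∀ i f, φ (MvPolynomial.X i) f = D i f) (y : k)
    (S : Finset n) {x : V} (hx : ∀ j ∈ S, D j x = 0) (f : V) :
    φ (∏ j ∈ S, (MvPolynomial.X j - MvPolynomial.C y)) (x * f) =
      x * φ (∏ j ∈ S, (MvPolynomial.X j - MvPolynomial.C y)) f := by
  induction S using Finset.induction_on generalizing f with
  | empty => simp
  | insert j S hj ih =>
    rw [prod_insert hj, map_mul φ, Module.End.mul_apply, Module.End.mul_apply,
      ih fun l hl => hx l (mem_insert_of_mem hl), mvPolynomial_action_X_sub_C hφ,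
      mvPolynomial_action_X_sub_C hφ, (D j).leibniz, hx j (mem_insert_self _ _)]
    simp only [mul_zero, add_zero, smul_eq_mul, mul_sub, mul_smul_comm]

theorem mvPolynomial_action_vandermonde {p : ℕ} (hp : 0 < p)
    {φ : MvPolynomial (Fin p) k →ₐ[k] Module.End k V} {D : Fin p → Derivation k V V}
    (hφ : ∀ i f, φ (MvPolynomial.X i) f = D i f) {a M : Fin p → V} {Q : Fin p → Fin p → V} (y : k)
    (hD : ∀ i j, D i (a j) = if i = j then 1 else 0)
    (hreg : ∀ i j, i ≠ j → ∀ f, (a i - a j) * f = 0 → f = 0)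
    (hM : ∀ i, D i (M i) = y • M i - ∑ j ∈ univ.erase i, Q i j)
    (hQ : ∀ i j, i ≠ j → (a i - a j) * Q i j = M i - M j) :
    φ (∏ j, (MvPolynomial.X j - MvPolynomial.C y))
      ((∏ j : Fin p, ∏ l ∈ Ioi j, (a l - a j)) * ∑ j, M j) = 0 := by
  set E := φ (∏ j, (MvPolynomial.X j - MvPolynomial.C y)) with hE
  set h : ℕ → V := (vandermondeInterpolant a M).coeff with hh
  have h1 : ∀ i, ∑ r ∈ range p, a i ^ r * E (h r) = 0 := by
    intro i
    have key := (D i).sum_pow_mul_coeff_vandermondeInterpolant hp y (hD i) (hM i) (hQ i)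
    have := congrArg (φ (∏ j ∈ univ.erase i, (MvPolynomial.X j - MvPolynomial.C y))) key
    rw [map_zero, map_sum] at this
    rw [← this]
    refine sum_congr rfl fun r _ => ?_
    rw [mvPolynomial_action_prod_mul hφ y (univ.erase i), hE,
      ← prod_erase_mul _ _ (mem_univ i), map_mul, Module.End.mul_apply,
      mvPolynomial_action_X_sub_C hφ]
    intro j hj
    rw [(D j).leibniz_pow, hD, if_neg (ne_of_mem_erase hj)]
    simp
  have h2 : vandermonde a *ᵥ (fun r : Fin p => E (h r)) = 0 := by
    funext i
    rw [Pi.zero_apply, ← h1 i, ← Fin.sum_univ_eq_sum_range fun r => a i ^ r * E (h r)]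
    rfl
  have h3 : ∀ r : Fin p, (∏ j : Fin p, ∏ l ∈ Ioi j, (a l - a j)) * E (h r) = 0 := by
    intro r
    have := congrFun (congrArg (fun v => (vandermonde a).adjugate *ᵥ v) h2) r
    simpa [mulVec_mulVec, adjugate_mul, smul_mulVec, det_vandermonde] using this
  have hprod : ∀ (S : Finset (Fin p)) (T : Fin p → Finset (Fin p)), (∀ j ∈ S, ∀ l ∈ T j, l ≠ j) →
      ∀ f, (∏ j ∈ S, ∏ l ∈ T j, (a l - a j)) * f = 0 → f = 0 := by
    intro S T hST f
    rw [prod_sigma']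
    have : ∀ x ∈ S.sigma T, x.2 ≠ x.1 := fun x hx =>
      hST x.1 (mem_sigma.1 hx).1 x.2 (mem_sigma.1 hx).2
    generalize S.sigma T = W at this
    induction W using Finset.induction_on with
    | empty => simp
    | insert x W hx ih =>
      intro hf
      rw [prod_insert hx, mul_assoc] at hf
      exact ih (fun x hx => this x (mem_insert_of_mem hx))
        (hreg _ _ (this x (mem_insert_self _ _)) _ hf)
  have h4 := hprod univ (fun j => Ioi j) (fun j _ l hl => (mem_Ioi.1 hl).ne') _
    (h3 ⟨p - 1, by omega⟩)
  rw [← coeff_vandermondeInterpolant]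
  exact h4

end CommutingDerivations

section ProductAnnihilator

open Finset Polynomial

variable {k : Type*} [Field k] {n : Type*} [Fintype n]

theorem prod_sub_algebraMap_eq_zero {R : Type*} [CommRing R] [Algebra k R] {d : n → R} {y : n → k}
    (hy : Function.Injective y) (h : ∀ l, ∏ i, (d i - algebraMap k R (y l)) = 0) (j : n) :
    ∏ l, (d j - algebraMap k R (y l)) = 0 := by
  nontriviality R
  have hdvd : (∏ l, (X - C (algebraMap k R (y l)))) ∣ ∏ i, (X - C (d i)) := by
    refine Finset.prod_dvd_of_coprime (fun l _ m _ hlm => ?_) fun l _ => ?_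
    · have hu : y m - y l ≠ 0 := sub_ne_zero.2 fun h => hlm (hy h.symm)
      refine ⟨C (algebraMap k R (y m - y l)⁻¹), -C (algebraMap k R (y m - y l)⁻¹), ?_⟩
      have : C (algebraMap k R (y m - y l)⁻¹) * (C (algebraMap k R (y m)) - C (algebraMap k R (y l)))
          = 1 := by
        rw [← C_sub, ← C_mul, ← map_sub, ← map_mul, inv_mul_cancel₀ hu, map_one, C_1]
      linear_combination this
    · rw [dvd_iff_isRoot, IsRoot.def, eval_prod]
      have : ∏ i, (d i - algebraMap k R (y l)) * (-1 : R) = 0 := by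
        rw [prod_mul_distrib, h l, zero_mul]
      rw [← this]
      exact prod_congr rfl fun i _ => by simp
  have heq := eq_of_monic_of_dvd_of_natDegree_le (monic_prod_X_sub_C _ _)
    (monic_prod_X_sub_C _ _) hdvd (by simp)
  have := congrArg (eval (d j)) heq
  rw [eval_prod, eval_prod, prod_eq_zero (i := j) (mem_univ j) (by simp)] at this
  simpa using this.symm

theorem exists_sum_eigenvectors [DecidableEq n] {V : Type*} [AddCommGroup V] [Module k V]
    (φ : MvPolynomial n k →ₐ[k] Module.End k V) {y : n → k} (hy : Function.Injective y) (f : V)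
    (h : ∀ l, φ (∏ i, (MvPolynomial.X i - MvPolynomial.C (y l))) f = 0) :
    ∃ g : (n → n) → V, f = ∑ τ, g τ ∧
      ∀ τ j, φ (MvPolynomial.X j - MvPolynomial.C (y (τ j))) (g τ) = 0 := by
  set J : Ideal (MvPolynomial n k) :=
    { carrier := {q | φ q f = 0}
      add_mem' := fun {a b} ha hb => by
        change φ (a + b) f = 0
        rw [map_add, LinearMap.add_apply, ha, hb, add_zero]
      zero_mem' := by change φ 0 f = 0; simp
      smul_mem' := fun c q hq => by
        change φ (c * q) f = 0
        rw [map_mul, Module.End.mul_apply, hq, map_zero] } with hJ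
  have hmem : ∀ q, q ∈ J ↔ φ q f = 0 := fun q => Iff.rfl
  have hC : ∀ c, Ideal.Quotient.mk J (MvPolynomial.C c) = algebraMap k _ c := fun c => rfl
  have h1 : ∀ j, (∏ l, (MvPolynomial.X j - MvPolynomial.C (y l)) : MvPolynomial n k) ∈ J := by
    intro j
    have := prod_sub_algebraMap_eq_zero (R := MvPolynomial n k ⧸ J)
      (d := fun i => Ideal.Quotient.mk J (MvPolynomial.X i)) hy (fun l => by
        have h2 := Ideal.Quotient.eq_zero_iff_mem.2 ((hmem _).2 (h l))
        rw [map_prod] at h2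
        simpa only [map_sub, hC] using h2) j
    rw [← Ideal.Quotient.eq_zero_iff_mem, map_prod]
    simpa only [map_sub, hC] using this
  have hsum : (∑ τ : n → n, ∏ j, aeval (MvPolynomial.X j : MvPolynomial n k)
      (Lagrange.basis univ y (τ j))) = 1 := by
    have := (prod_univ_sum (fun _ : n => (univ : Finset n)) fun j l =>
      aeval (MvPolynomial.X j : MvPolynomial n k) (Lagrange.basis univ y l)).symm
    rw [Fintype.piFinset_univ] at this
    rw [this]
    refine prod_eq_one fun j _ => ?_
    have : Nonempty n := ⟨j⟩
    rw [← map_sum, Lagrange.sum_basis hy.injOn univ_nonempty, map_one]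
  refine ⟨fun τ => φ (∏ j, aeval (MvPolynomial.X j : MvPolynomial n k)
      (Lagrange.basis univ y (τ j))) f, ?_, fun τ j => ?_⟩
  · rw [← LinearMap.sum_apply, ← map_sum, hsum, map_one, Module.End.one_apply]
  · rw [← Module.End.mul_apply, ← map_mul, ← hmem]
    have hdvd : (∏ l, (X - C (y l))) ∣ (X - C (y (τ j))) * Lagrange.basis univ y (τ j) := by
      rw [Lagrange.basis, ← mul_prod_erase univ _ (mem_univ (τ j))]
      refine mul_dvd_mul_left _ (prod_dvd_prod_of_dvd _ _ fun l _ => ?_)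
      rw [Lagrange.basisDivisor]
      exact dvd_mul_left _ _
    have h2 := map_dvd (aeval (MvPolynomial.X j : MvPolynomial n k)) hdvd
    rw [map_prod, map_mul] at h2
    simp only [map_sub, aeval_X, aeval_C, MvPolynomial.algebraMap_eq] at h2
    rw [← mul_prod_erase univ _ (mem_univ j), ← mul_assoc]
    exact J.mul_mem_right _ (J.mem_of_dvd h2 (h1 j))

end ProductAnnihilator

section DeterminantFormula

open Finset MeasureTheory

variable {p : ℕ}

theorem exists_vandermonde_mul_integral_eq_sum (hp : 0 < p) {Y : Matrix (Fin p) (Fin p) ℂ}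
    {P : Fin p → Matrix (Fin p) (Fin p) ℂ} {y : Fin p → ℂ} (hy : Function.Injective y)
    (hYP : ∀ k, Y * P k = y k • P k) (htr : ∀ k, (P k).trace = 1) :
    ∃ c : (Fin p → Fin p) → ℂ, ∀ a : Fin p → ℝ,
      (∏ j : Fin p, ∏ l ∈ Ioi j, ((a l : ℂ) - a j)) * ∫ U, expWeight Y a U ∂(unitaryHaar (Fin p)) =
        ∑ τ, c τ * ∏ j, Complex.exp (y (τ j) * a j) := by
  have hζ : ∀ j, Continuous fun U : unitaryGroup (Fin p) ℂ => unitaryConj Y U j j :=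
    fun j => by fun_prop
  set L := laplaceTransform (unitaryHaar (Fin p)) hζ with hL
  let N : Fin p → Fin p → Fin p → C(unitaryGroup (Fin p) ℂ, ℂ) :=
    fun k i j => ⟨fun U => unitaryConj (P k) U i j, by fun_prop⟩
  let M : Fin p → Fin p → C(unitaryGroup (Fin p) ℂ, ℂ) :=
    fun i j => ⟨fun U => unitaryConj Y U i j, by fun_prop⟩
  obtain ⟨φ, hφ⟩ := exists_mvPolynomial_action (smoothFun.partialDeriv (n := Fin p))
    smoothFun.partialDeriv_comm
  set Δ : smoothFun (Fin p) :=
    ∏ j : Fin p, ∏ l ∈ Ioi j, (smoothFun.coord l - smoothFun.coord j) with hΔ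
  have hMN : ∀ k i, ∑ j, M i j * N k j i = y k • N k i i := by
    intro k i
    ext U
    have h1 : unitaryConj Y U * unitaryConj (P k) U = y k • unitaryConj (P k) U := by
      have : star (U : Matrix (Fin p) (Fin p) ℂ) * U = 1 := Unitary.coe_star_mul_self U
      calc unitaryConj Y U * unitaryConj (P k) U
          = (U : Matrix (Fin p) (Fin p) ℂ) * Y * (star (U : Matrix (Fin p) (Fin p) ℂ) * (U : Matrix (Fin p) (Fin p) ℂ)) * P k * star (U : Matrix _ _ ℂ) := by
            simp only [unitaryConj, mul_assoc]
        _ = y k • unitaryConj (P k) U := by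
            rw [this, mul_one, mul_assoc _ Y, hYP]
            simp [unitaryConj]
    have h2 := congrFun (congrFun h1 i) i
    rw [Matrix.mul_apply] at h2
    simpa [M, N, ContinuousMap.sum_apply] using h2
  have hN : ∀ k, ∑ i, N k i i = 1 := by
    intro k
    ext U
    have h1 : (unitaryConj (P k) U).trace = 1 := by
      have : star (U : Matrix (Fin p) (Fin p) ℂ) * U = 1 := Unitary.coe_star_mul_self U
      rw [unitaryConj, trace_mul_comm, ← mul_assoc, this, one_mul, htr]
    simpa [N, ContinuousMap.sum_apply, Matrix.trace] using h1
  have hvan : ∀ k, φ (∏ j, (MvPolynomial.X j - MvPolynomial.C (y k))) (Δ * L 1) = 0 := by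
    intro k
    have := mvPolynomial_action_vandermonde hp hφ (a := smoothFun.coord)
      (M := fun i => L (N k i i)) (Q := fun i j => L (M i j * N k j i)) (y k)
      smoothFun.partialDeriv_coord (fun i j hij f => smoothFun.eq_zero_of_coord_sub_mul hij)
      (fun i => by
        rw [partialDeriv_laplaceTransform, ← map_smul, ← hMN, map_sum,
          ← add_sum_erase univ _ (mem_univ i), add_sub_cancel_right])
      (fun i j hij => by
        refine Subtype.ext (funext fun a => ?_)
        have := integral_commutator Y (P k) a hij.symm
        change ((a i : ℂ) - a j) * ∫ U, unitaryConj Y U i j * unitaryConj (P k) U j i *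
          expWeight Y a U ∂(unitaryHaar (Fin p)) =
          (∫ U, unitaryConj (P k) U i i * expWeight Y a U ∂(unitaryHaar (Fin p))) -
            ∫ U, unitaryConj (P k) U j j * expWeight Y a U ∂(unitaryHaar (Fin p))
        linear_combination -this)
    rwa [← map_sum, hN] at this
  obtain ⟨g, hg, hge⟩ := exists_sum_eigenvectors φ hy _ hvan
  refine ⟨fun τ => (g τ).1 0, fun a => ?_⟩
  have h1 : (Δ * L 1).1 a = ∑ τ, (g τ).1 a := by
    rw [hg]
    simp
  have h2 : (Δ * L 1).1 a =
      (∏ j : Fin p, ∏ l ∈ Ioi j, ((a l : ℂ) - a j)) *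
        ∫ U, expWeight Y a U ∂(unitaryHaar (Fin p)) := by
    have h3 : Δ.1 a = ∏ j : Fin p, ∏ l ∈ Ioi j, ((a l : ℂ) - a j) := by
      rw [hΔ]
      simp [smoothFun.coord]
    have h4 : (L 1).1 a = ∫ U, expWeight Y a U ∂(unitaryHaar (Fin p)) := by
      rw [hL, laplaceTransform_apply]
      simp [expWeight]
    rw [← h3, ← h4]
    rfl
  rw [← h2, h1]
  refine sum_congr rfl fun τ _ => ?_
  rw [smoothFun.eq_const_mul_exp (y := fun j => y (τ j)) (fun j => ?_) a, Complex.exp_sum]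
  have := hge τ j
  rwa [mvPolynomial_action_X_sub_C hφ, sub_eq_zero] at this

theorem exists_det_submatrix_eq_mul {n : Type*} [Fintype n] [DecidableEq n] {R : Type*} [CommRing R]
    (τ : n → n) : ∃ ε : R, ∀ A : Matrix n n R, (A.submatrix id τ).det = ε * A.det := by
  by_cases hτ : Function.Injective τ
  · refine ⟨((Equiv.Perm.sign (Equiv.ofBijective τ (Finite.injective_iff_bijective.1 hτ)) : ℤ) : R),
      fun A => ?_⟩
    rw [← det_permute']
    rfl
  · obtain ⟨i, j, h, hij⟩ := Function.not_injective_iff.1 hτ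
    exact ⟨0, fun A => by rw [zero_mul, det_zero_of_column_eq hij fun k => by simp [h]]⟩

theorem integral_expWeight_comp_perm (Y : Matrix (Fin p) (Fin p) ℂ) (a : Fin p → ℝ)
    (s : Equiv.Perm (Fin p)) :
    ∫ U, expWeight Y (a ∘ s) U ∂(unitaryHaar (Fin p)) =
      ∫ U, expWeight Y a U ∂(unitaryHaar (Fin p)) := by
  have hs : ∀ s : Equiv.Perm (Fin p),
      star (s.toPEquiv.toMatrix : Matrix (Fin p) (Fin p) ℂ) = s.symm.toPEquiv.toMatrix := by
    intro s
    rw [star_eq_conjTranspose, Equiv.toPEquiv_symm, PEquiv.toMatrix_symm]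
    ext i j
    simp [PEquiv.toMatrix_apply, apply_ite]
  let T : unitaryGroup (Fin p) ℂ := ⟨s.symm.toPEquiv.toMatrix, by
    rw [mem_unitaryGroup_iff, hs, PEquiv.toMatrix_toPEquiv_mul]
    ext i j
    simp [PEquiv.toMatrix_apply, Matrix.one_apply]⟩
  rw [← integral_mul_left_eq_self (fun U => expWeight Y a U) T]
  refine integral_congr_ae (Filter.Eventually.of_forall fun U => ?_)
  have h1 : ∀ l, unitaryConj Y (T * U) l l = unitaryConj Y U (s.symm l) (s.symm l) := by
    intro l
    have : unitaryConj Y (T * U) = (unitaryConj Y U).submatrix s.symm s.symm := by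
      have h2 : ((T * U : unitaryGroup (Fin p) ℂ) : Matrix (Fin p) (Fin p) ℂ) =
        s.symm.toPEquiv.toMatrix * (U : Matrix (Fin p) (Fin p) ℂ) := rfl
      rw [unitaryConj, h2, star_mul, hs]
      simp only [PEquiv.mul_toMatrix_toPEquiv, PEquiv.toMatrix_toPEquiv_mul]
      rfl
    rw [this, submatrix_apply]
  simp only [expWeight, h1]
  rw [← Equiv.sum_comp s fun l => (a l : ℂ) * unitaryConj Y U (s.symm l) (s.symm l)]
  simp

theorem exists_vandermonde_mul_integral_eq_det (hp : 0 < p) {Y : Matrix (Fin p) (Fin p) ℂ}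
    {P : Fin p → Matrix (Fin p) (Fin p) ℂ} {y : Fin p → ℂ} (hy : Function.Injective y)
    (hYP : ∀ k, Y * P k = y k • P k) (htr : ∀ k, (P k).trace = 1) :
    ∃ c : ℂ, ∀ a : Fin p → ℝ,
      (vandermonde fun j => (a j : ℂ)).det * ∫ U, expWeight Y a U ∂(unitaryHaar (Fin p)) =
        c * (of fun j k => Complex.exp (y k * a j)).det := by
  obtain ⟨c, hc⟩ := exists_vandermonde_mul_integral_eq_sum hp hy hYP htr
  choose ε hε using fun τ : Fin p → Fin p => exists_det_submatrix_eq_mul (R := ℂ) τ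
  have hf : (p.factorial : ℂ) ≠ 0 := Nat.cast_ne_zero.2 p.factorial_ne_zero
  refine ⟨(p.factorial : ℂ)⁻¹ * ∑ τ, c τ * ε τ, fun a => ?_⟩
  rw [mul_assoc, eq_inv_mul_iff_mul_eq₀ hf, sum_mul]
  have h1 : ∀ s : Equiv.Perm (Fin p),
      (vandermonde fun j => (a j : ℂ)).det * ∫ U, expWeight Y a U ∂(unitaryHaar (Fin p)) =
        ((Equiv.Perm.sign s : ℤ) : ℂ) * ∑ τ, c τ * ∏ j, Complex.exp (y (τ j) * a (s j)) := by
    intro s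
    have h2 := hc (a ∘ s)
    rw [integral_expWeight_comp_perm, ← det_vandermonde (fun j => ((a ∘ s) j : ℂ))] at h2
    have h3 : (vandermonde fun j => ((a ∘ s) j : ℂ)) =
      (vandermonde fun j => (a j : ℂ)).submatrix s id := rfl
    rw [h3, det_permute] at h2
    have h4 : ((Equiv.Perm.sign s : ℤ) : ℂ) * ((Equiv.Perm.sign s : ℤ) : ℂ) = 1 := by
      rw [← Int.cast_mul, ← Units.val_mul, Int.units_mul_self]
      simp
    simp only [Function.comp_apply] at h2
    rw [← h2, ← mul_assoc, ← mul_assoc, h4, one_mul]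
  calc (p.factorial : ℂ) * _ = ∑ s : Equiv.Perm (Fin p), _ := by
        rw [sum_const, card_univ, Fintype.card_perm, Fintype.card_fin, nsmul_eq_mul]
    _ = ∑ s : Equiv.Perm (Fin p), ((Equiv.Perm.sign s : ℤ) : ℂ) *
          ∑ τ, c τ * ∏ j, Complex.exp (y (τ j) * a (s j)) := sum_congr rfl fun s _ => h1 s
    _ = ∑ τ, c τ * ε τ * (of fun j k => Complex.exp (y k * a j)).det := by
        simp only [mul_sum]
        rw [sum_comm]
        refine sum_congr rfl fun τ _ => ?_
        rw [mul_assoc, ← hε, det_apply', mul_sum]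
        refine sum_congr rfl fun s _ => ?_
        simp only [submatrix_apply, of_apply, id]
        ring

end DeterminantFormula

section DeterminantIdentity

open Finset

variable {n : Type*} [Fintype n] [DecidableEq n] {R : Type*} [CommRing R]

/-- The sign `(-1) ^ #{s | π (inr s) is on the right}` of a permutation of `n ⊕ n`. -/
def rightSign (R : Type*) [CommRing R] (π : Equiv.Perm (n ⊕ n)) : R :=
  ∏ s, Sum.elim (fun _ => (1 : R)) (fun _ => -1) (π (Sum.inr s))

theorem sum_sign_mul_rightSign_mul_det_mul_det (v : n ⊕ n → n → R) :
    ∑ π : Equiv.Perm (n ⊕ n), ((Equiv.Perm.sign π : ℤ) : R) * rightSign R π *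
      ((of fun j => v (π (Sum.inl j))).det * (of fun j => v (π (Sum.inr j))).det) =
    ((Fintype.card n).factorial : R) ^ 2 * (-2) ^ Fintype.card n *
      ((of fun j => v (Sum.inl j)).det * (of fun j => v (Sum.inr j)).det) := by
  set β : n ⊕ n → R := Sum.elim (fun _ => (1 : R)) (fun _ => -1) with hβ
  set G : Matrix (n ⊕ n) (n ⊕ n) R :=
    of fun x => Sum.elim (fun k => v x k) (fun k => β x * v x k) with hG
  have hdet : G.det = (-2) ^ Fintype.card n *
      ((of fun j => v (Sum.inl j)).det * (of fun j => v (Sum.inr j)).det) := by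
    have h1 : G = fromBlocks (of fun j => v (Sum.inl j)) 0 0 (of fun j => v (Sum.inr j)) *
        fromBlocks 1 1 1 (-1) := by
      rw [fromBlocks_multiply]
      ext (i | i) (j | j) <;> simp [hG, hβ]
    have h2 : (-1 - 1 * 1 : Matrix n n R) = (-2 : R) • (1 : Matrix n n R) := by
      rw [mul_one, ← one_smul R (1 : Matrix n n R), ← neg_smul, ← sub_smul]
      norm_num
    rw [h1, det_mul, det_fromBlocks_zero₁₂, det_fromBlocks_one₁₁, h2, det_smul, det_one]
    ring
  have hexp : ∀ π : Equiv.Perm (n ⊕ n), ∏ x, G (π x) x =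
      rightSign R π * ((∏ k, v (π (Sum.inl k)) k) * ∏ k, v (π (Sum.inr k)) k) := by
    intro π
    rw [Fintype.prod_sum_type]
    simp only [hG, of_apply, Sum.elim_inl, Sum.elim_inr, prod_mul_distrib, rightSign]
    ring
  have hshift : ∀ s t : Equiv.Perm n, ∑ π : Equiv.Perm (n ⊕ n),
      ((Equiv.Perm.sign π : ℤ) : R) * rightSign R π * (((Equiv.Perm.sign s : ℤ) : R) *
        (∏ k, v (π (Sum.inl (s k))) k) * (((Equiv.Perm.sign t : ℤ) : R) *
        ∏ k, v (π (Sum.inr (t k))) k)) = G.det := by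
    intro s t
    rw [det_apply', ← Equiv.sum_comp (Equiv.mulRight (Equiv.Perm.sumCongr s t))
      fun π => ((Equiv.Perm.sign π : ℤ) : R) * ∏ x, G (π x) x]
    refine sum_congr rfl fun π _ => ?_
    have hw : rightSign R (π * Equiv.Perm.sumCongr s t) = rightSign R π := by
      simp only [rightSign]
      exact Equiv.prod_comp t fun k =>
        Sum.elim (fun _ => (1 : R)) (fun _ => -1) (π (Sum.inr k))
    rw [Equiv.coe_mulRight, hexp, hw, Equiv.Perm.sign_mul, Equiv.Perm.sign_sumCongr]
    simp only [Equiv.Perm.mul_apply, Equiv.Perm.sumCongr_apply, Sum.map_inl, Sum.map_inr,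
      Units.val_mul, Int.cast_mul]
    ring
  calc _ = ∑ π : Equiv.Perm (n ⊕ n), ∑ s : Equiv.Perm n, ∑ t : Equiv.Perm n,
        ((Equiv.Perm.sign π : ℤ) : R) * rightSign R π * (((Equiv.Perm.sign s : ℤ) : R) *
        (∏ k, v (π (Sum.inl (s k))) k) * (((Equiv.Perm.sign t : ℤ) : R) *
        ∏ k, v (π (Sum.inr (t k))) k)) := by
        refine sum_congr rfl fun π _ => ?_
        rw [det_apply', det_apply', sum_mul_sum, mul_sum]
        exact sum_congr rfl fun s _ => mul_sum _ _ _
    _ = ∑ s : Equiv.Perm n, ∑ t : Equiv.Perm n, G.det := by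
        rw [sum_comm]
        refine sum_congr rfl fun s _ => ?_
        rw [sum_comm]
        exact sum_congr rfl fun t _ => hshift s t
    _ = _ := by
        rw [sum_const, sum_const, card_univ, Fintype.card_perm, hdet]
        simp only [nsmul_eq_mul]
        ring

end DeterminantIdentity

section HermitianIdentity

open Finset MeasureTheory Filter Topology

variable {p : ℕ}

/-- The coefficient attached to a redistribution `π` of the values `σ`. -/
noncomputable def redistributionCoeff (σ : Fin p ⊕ Fin p → ℝ) (π : Equiv.Perm (Fin p ⊕ Fin p)) :
    ℝ :=
  ((Equiv.Perm.sign π : ℤ) : ℝ) * rightSign ℝ π *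
    ((vandermonde fun j => σ (π (Sum.inl j))).det * (vandermonde fun j => σ (π (Sum.inr j))).det)

theorem rightSign_ofReal (π : Equiv.Perm (Fin p ⊕ Fin p)) :
    ((rightSign ℝ π : ℝ) : ℂ) = rightSign ℂ π := by
  rw [rightSign, rightSign, Complex.ofReal_prod]
  refine prod_congr rfl fun s _ => ?_
  rcases π (Sum.inr s) with x | x <;> simp

theorem vandermonde_det_ofReal (v : Fin p → ℝ) :
    (((vandermonde v).det : ℝ) : ℂ) = (vandermonde fun j => (v j : ℂ)).det := by
  simp [det_vandermonde]

theorem sum_redistributionCoeff_mul_of_injective (hp : 0 < p) {Y : Matrix (Fin p) (Fin p) ℂ}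
    {P : Fin p → Matrix (Fin p) (Fin p) ℂ} {y : Fin p → ℂ} (hy : Function.Injective y)
    (hYP : ∀ k, Y * P k = y k • P k) (htr : ∀ k, (P k).trace = 1) (σ : Fin p ⊕ Fin p → ℝ) :
    ∑ π, (redistributionCoeff σ π : ℂ) *
      ((∫ U, expWeight Y (fun j => σ (π (Sum.inl j))) U ∂(unitaryHaar (Fin p))) *
        ∫ U, expWeight Y (fun j => σ (π (Sum.inr j))) U ∂(unitaryHaar (Fin p))) =
    ((p.factorial : ℂ) ^ 2 * (-2) ^ p * ((vandermonde fun j => σ (Sum.inl j)).det *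
      (vandermonde fun j => σ (Sum.inr j)).det : ℝ)) *
      ((∫ U, expWeight Y (fun j => σ (Sum.inl j)) U ∂(unitaryHaar (Fin p))) *
        ∫ U, expWeight Y (fun j => σ (Sum.inr j)) U ∂(unitaryHaar (Fin p))) := by
  obtain ⟨c, hc⟩ := exists_vandermonde_mul_integral_eq_det hp hy hYP htr
  have key := sum_sign_mul_rightSign_mul_det_mul_det
    (fun (x : Fin p ⊕ Fin p) (k : Fin p) => Complex.exp (y k * σ x))
  rw [Fintype.card_fin] at key
  have h1 := hc fun j => σ (Sum.inl j)
  have h2 := hc fun j => σ (Sum.inr j)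
  simp only [redistributionCoeff, Complex.ofReal_mul, rightSign_ofReal, vandermonde_det_ofReal,
    Complex.ofReal_intCast]
  calc _ = c ^ 2 * ∑ π : Equiv.Perm (Fin p ⊕ Fin p),
        ((Equiv.Perm.sign π : ℤ) : ℂ) * rightSign ℂ π *
        ((of fun j k => Complex.exp (y k * σ (π (Sum.inl j)))).det *
          (of fun j k => Complex.exp (y k * σ (π (Sum.inr j)))).det) := by
        rw [mul_sum]
        refine sum_congr rfl fun π _ => ?_
        have h3 := hc fun j => σ (π (Sum.inl j))
        have h4 := hc fun j => σ (π (Sum.inr j))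
        linear_combination ((Equiv.Perm.sign π : ℤ) : ℂ) * rightSign ℂ π *
          (h3 * (vandermonde fun j => (σ (π (Sum.inr j)) : ℂ)).det *
          (∫ U, expWeight Y (fun j => σ (π (Sum.inr j))) U ∂(unitaryHaar (Fin p))) +
          c * (of fun j k => Complex.exp (y k * σ (π (Sum.inl j)))).det * h4)
    _ = _ := by
        rw [key]
        linear_combination -(p.factorial : ℂ) ^ 2 * (-2) ^ p *
          (h1 * (vandermonde fun j => (σ (Sum.inr j) : ℂ)).det *
          (∫ U, expWeight Y (fun j => σ (Sum.inr j)) U ∂(unitaryHaar (Fin p))) +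
          c * (of fun j k => Complex.exp (y k * σ (Sum.inl j))).det * h2)

theorem continuous_integral_expWeight {T : Type*} [TopologicalSpace T] [FirstCountableTopology T]
    [LocallyCompactSpace T] {Y : T → Matrix (Fin p) (Fin p) ℂ}
    (hY : Continuous Y) (a : Fin p → ℝ) :
    Continuous fun t => ∫ U, expWeight (Y t) a U ∂(unitaryHaar (Fin p)) := by
  have : Continuous (Function.uncurry fun t U => expWeight (Y t) a U) := by
    unfold Function.uncurry expWeight unitaryConj
    refine Complex.continuous_exp.comp (continuous_finsetSum _ fun l _ => continuous_const.mul
      (Continuous.matrix_elem ?_ l l))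
    have hY' : Continuous fun q : T × unitaryGroup (Fin p) ℂ => Y q.1 := hY.comp continuous_fst
    fun_prop
  have := continuous_parametric_integral_of_continuous (μ := unitaryHaar (Fin p)) this
    isCompact_univ
  simpa using this

theorem sum_redistributionCoeff_mul (hp : 0 < p) {X : Matrix (Fin p) (Fin p) ℂ}
    (hX : X.IsHermitian) (σ : Fin p ⊕ Fin p → ℝ) :
    ∑ π, (redistributionCoeff σ π : ℂ) *
      ((∫ U, expWeight (Complex.I • X) (fun j => σ (π (Sum.inl j))) U ∂(unitaryHaar (Fin p))) *
        ∫ U, expWeight (Complex.I • X) (fun j => σ (π (Sum.inr j))) U ∂(unitaryHaar (Fin p))) =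
    ((p.factorial : ℂ) ^ 2 * (-2) ^ p * ((vandermonde fun j => σ (Sum.inl j)).det *
      (vandermonde fun j => σ (Sum.inr j)).det : ℝ)) *
      ((∫ U, expWeight (Complex.I • X) (fun j => σ (Sum.inl j)) U ∂(unitaryHaar (Fin p))) *
        ∫ U, expWeight (Complex.I • X) (fun j => σ (Sum.inr j)) U ∂(unitaryHaar (Fin p))) := by
  set W : Matrix (Fin p) (Fin p) ℂ := (hX.eigenvectorUnitary : Matrix (Fin p) (Fin p) ℂ) with hW
  have hWW : star W * W = 1 := Unitary.coe_star_mul_self hX.eigenvectorUnitary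
  set Y : ℝ → Matrix (Fin p) (Fin p) ℂ := fun t =>
    W * diagonal (fun k => Complex.I * ((hX.eigenvalues k + t * (k : ℕ) : ℝ) : ℂ)) * star W with hYdef
  have hY0 : Y 0 = Complex.I • X := by
    conv_rhs => rw [hX.spectral_theorem]
    rw [hYdef, Unitary.conjStarAlgAut_apply, ← smul_mul_assoc, ← mul_smul_comm]
    simp only [zero_mul, add_zero]
    congr 2
    ext i j
    simp [diagonal_apply]
  have hYc : Continuous Y := by
    simp only [hYdef]
    fun_prop
  have hgood : ∀ᶠ t in 𝓝[≠] (0 : ℝ), Function.Injective fun k : Fin p =>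
      Complex.I * ((hX.eigenvalues k + t * (k : ℕ) : ℝ) : ℂ) := by
    have h1 : ∀ k l : Fin p, ∀ᶠ t in 𝓝[≠] (0 : ℝ),
        hX.eigenvalues k + t * (k : ℕ) = hX.eigenvalues l + t * (l : ℕ) → k = l := by
      intro k l
      by_cases hkl : hX.eigenvalues k = hX.eigenvalues l
      · filter_upwards [self_mem_nhdsWithin] with t ht h
        rw [hkl, add_right_inj] at h
        exact Fin.ext (Nat.cast_injective (mul_left_cancel₀ ht h))
      · have h2 : ∀ᶠ t in 𝓝 (0 : ℝ),
            hX.eigenvalues k + t * (k : ℕ) ≠ hX.eigenvalues l + t * (l : ℕ) := by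
          refine (isOpen_ne_fun (by fun_prop) (by fun_prop)).mem_nhds ?_
          simpa using hkl
        filter_upwards [nhdsWithin_le_nhds h2] with t ht h
        exact absurd h ht
    filter_upwards [eventually_all.2 fun k => eventually_all.2 (h1 k)] with t ht k l hkl
    exact ht k l (Complex.ofReal_injective (mul_left_cancel₀ Complex.I_ne_zero hkl))
  have hall : ∀ᶠ t in 𝓝[≠] (0 : ℝ), ∑ π, (redistributionCoeff σ π : ℂ) *
      ((∫ U, expWeight (Y t) (fun j => σ (π (Sum.inl j))) U ∂(unitaryHaar (Fin p))) *
        ∫ U, expWeight (Y t) (fun j => σ (π (Sum.inr j))) U ∂(unitaryHaar (Fin p))) =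
    ((p.factorial : ℂ) ^ 2 * (-2) ^ p * ((vandermonde fun j => σ (Sum.inl j)).det *
      (vandermonde fun j => σ (Sum.inr j)).det : ℝ)) *
      ((∫ U, expWeight (Y t) (fun j => σ (Sum.inl j)) U ∂(unitaryHaar (Fin p))) *
        ∫ U, expWeight (Y t) (fun j => σ (Sum.inr j)) U ∂(unitaryHaar (Fin p))) := by
    filter_upwards [hgood] with t ht
    refine sum_redistributionCoeff_mul_of_injective hp ht
      (P := fun k => W * single k k 1 * star W) (fun k => ?_) (fun k => ?_) σ
    · simp only [hYdef]
      calc _ = W * diagonal (fun k => Complex.I * ((hX.eigenvalues k + t * (k : ℕ) : ℝ) : ℂ)) *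
            (star W * W) * single k k 1 * star W := by simp only [mul_assoc]
        _ = _ := by
          rw [hWW, mul_one, mul_assoc W, ← smul_mul_assoc, ← mul_smul_comm]
          congr 2
          ext i j
          simp only [diagonal_mul, Matrix.smul_apply, single_apply, smul_eq_mul]
          split_ifs with h
          · rw [h.1]
          · simp
    · rw [trace_mul_comm, ← mul_assoc, hWW, one_mul]
      simp
  rw [← hY0]
  refine tendsto_nhds_unique_of_eventuallyEq (l := 𝓝[≠] (0 : ℝ)) ?_ ?_ hall
  · refine Continuous.tendsto' ?_ 0 _ rfl |>.mono_left nhdsWithin_le_nhds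
    exact continuous_finsetSum _ fun π _ => continuous_const.mul
      ((continuous_integral_expWeight hYc _).mul (continuous_integral_expWeight hYc _))
  · refine Continuous.tendsto' ?_ 0 _ rfl |>.mono_left nhdsWithin_le_nhds
    exact continuous_const.mul
      ((continuous_integral_expWeight hYc _).mul (continuous_integral_expWeight hYc _))

end HermitianIdentity

section Interlacing

open Finset

variable {p : ℕ}

theorem det_vandermonde_finSumFinEquiv {R : Type*} [CommRing R] (τ : Fin p ⊕ Fin p → R) :
    (vandermonde fun i => τ (finSumFinEquiv.symm i)).det =
      (vandermonde fun i => τ (Sum.inl i)).det * (vandermonde fun i => τ (Sum.inr i)).det *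
        ∏ s, ∏ r, (τ (Sum.inr s) - τ (Sum.inl r)) := by
  have h : ∀ (m : ℕ) (v : Fin m → R),
      (vandermonde v).det = ∏ i, ∏ j, if i < j then v j - v i else 1 := by
    intro m v
    rw [det_vandermonde]
    refine prod_congr rfl fun i _ => ?_
    rw [← prod_filter]
    exact prod_congr (by ext; simp) fun _ _ => rfl
  simp only [h, Fin.prod_univ_add, finSumFinEquiv_symm_apply_castAdd,
    finSumFinEquiv_symm_apply_natAdd, prod_mul_distrib]
  have h1 : ∀ i j : Fin p, Fin.castAdd p i < Fin.natAdd p j := fun i j => by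
    rw [Fin.lt_def]; simp; omega
  have h2 : ∀ i j : Fin p, ¬ Fin.natAdd p i < Fin.castAdd p j := fun i j => (h1 j i).not_gt
  have h3 : ∀ i j : Fin p, Fin.castAdd p i < Fin.castAdd p j ↔ i < j := fun i j => Iff.rfl
  have h4 : ∀ i j : Fin p, Fin.natAdd p i < Fin.natAdd p j ↔ i < j := fun i j => by
    simp
  simp only [h1, h2, h3, h4, if_true, if_false, prod_const_one]
  rw [prod_comm (f := fun s r => τ (Sum.inr s) - τ (Sum.inl r))]
  ring

theorem sum_elim_mul_self {R : Type*} [CommRing R] {n : Type*} (x : n ⊕ n) :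
    Sum.elim (fun _ => (1 : R)) (fun _ => -1) x * Sum.elim (fun _ => (1 : R)) (fun _ => -1) x
      = 1 := by
  rcases x with x | x <;> simp

theorem redistributionCoeff_mul_prod (σ : Fin p ⊕ Fin p → ℝ) (π : Equiv.Perm (Fin p ⊕ Fin p)) :
    redistributionCoeff σ π * (rightSign ℝ π *
      ∏ s, ∏ r, (σ (π (Sum.inr s)) - σ (π (Sum.inl r)))) =
    (vandermonde fun i => σ (finSumFinEquiv.symm i)).det := by
  have h1 := det_vandermonde_finSumFinEquiv fun x => σ (π x)
  have h2 : (vandermonde fun i => σ (π (finSumFinEquiv.symm i))) =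
      (vandermonde fun i => σ (finSumFinEquiv.symm i)).submatrix
        (finSumFinEquiv.permCongr π) id := by
    ext i j
    simp [vandermonde_apply]
  rw [h2, det_permute, Equiv.Perm.sign_permCongr] at h1
  have h3 : rightSign ℝ π * rightSign ℝ π = 1 := by
    rw [rightSign, ← prod_mul_distrib]
    exact prod_eq_one fun s _ => sum_elim_mul_self _
  have h4 : ((Equiv.Perm.sign π : ℤ) : ℝ) * ((Equiv.Perm.sign π : ℤ) : ℝ) = 1 := by
    rw [← Int.cast_mul, ← Units.val_mul, Int.units_mul_self]
    simp
  rw [redistributionCoeff]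
  set V := (vandermonde fun i => σ (finSumFinEquiv.symm i)).det
  linear_combination -((Equiv.Perm.sign π : ℤ) : ℝ) * h1 + V * h4 +
    ((Equiv.Perm.sign π : ℤ) : ℝ) * ((vandermonde fun i => σ (π (Sum.inl i))).det *
      (vandermonde fun i => σ (π (Sum.inr i))).det *
        ∏ s, ∏ r, (σ (π (Sum.inr s)) - σ (π (Sum.inl r)))) * h3

theorem prod_off_diag_mul_pos {τ τ' : Fin p → ℝ} (hτ : Function.Injective τ)
    (hτ' : Function.Injective τ') :
    0 < (∏ i, ∏ j ∈ {i}ᶜ, (τ i - τ j)) * ∏ i, ∏ j ∈ {i}ᶜ, (τ' i - τ' j) := by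
  simp only [← prod_mul_distrib]
  rw [← prod_prod_Ioi_mul_eq_prod_prod_off_diag fun j i => (τ i - τ j) * (τ' i - τ' j)]
  refine prod_pos fun i _ => prod_pos fun j hj => ?_
  have hij : i ≠ j := (mem_Ioi.1 hj).ne
  have h := mul_ne_zero (sub_ne_zero.2 (hτ.ne hij)) (sub_ne_zero.2 (hτ'.ne hij))
  have := pow_pos (abs_pos.2 h) 2
  rw [sq_abs] at this
  linarith

/-- The value families with `σ (inl 0) > σ (inr 0) > σ (inl 1) > σ (inr 1) > ⋯`. -/
structure StrictlyInterlaced (σ : Fin p ⊕ Fin p → ℝ) : Prop where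
  inr_lt_inl : ∀ j, σ (Sum.inr j) < σ (Sum.inl j)
  inl_lt_inr : ∀ i j, i < j → σ (Sum.inl j) < σ (Sum.inr i)

namespace StrictlyInterlaced

variable {σ : Fin p ⊕ Fin p → ℝ} (h : StrictlyInterlaced σ)
include h

theorem injective : Function.Injective σ := by
  have h1 : ∀ i j, i ≠ j → σ (Sum.inl i) ≠ σ (Sum.inl j) ∧ σ (Sum.inr i) ≠ σ (Sum.inr j) ∧
      σ (Sum.inl i) ≠ σ (Sum.inr j) := by
    intro i j hij
    have a := h.inr_lt_inl i
    have b := h.inr_lt_inl j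
    rcases hij.lt_or_gt with hij | hij
    · have := h.inl_lt_inr i j hij
      exact ⟨by linarith, by linarith, by linarith⟩
    · have := h.inl_lt_inr j i hij
      exact ⟨by linarith, by linarith, by linarith⟩
  rintro (i | i) (j | j) hij
  · by_contra hne
    exact (h1 i j fun h => hne (h ▸ rfl)).1 hij
  · by_cases hne : i = j
    · subst hne
      exact absurd hij (h.inr_lt_inl i).ne'
    · exact absurd hij (h1 i j hne).2.2
  · by_cases hne : j = i
    · subst hne
      exact absurd hij (h.inr_lt_inl j).ne
    · exact absurd hij.symm (h1 j i hne).2.2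
  · by_contra hne
    exact (h1 i j fun h => hne (h ▸ rfl)).2.1 hij

theorem elim_mul_prod_pos (l : Fin p ⊕ Fin p) :
    0 < Sum.elim (fun _ => (1 : ℝ)) (fun _ => -1) l * ∏ k ∈ {l}ᶜ, (σ l - σ k) := by
  have h1 : ∏ k ∈ {l}ᶜ, (σ l - σ k) = ∏ k, if k = l then 1 else σ l - σ k := by
    rw [prod_ite, prod_const_one, one_mul]
    exact prod_congr (by ext; simp) fun _ _ => rfl
  have h2 : ∀ r j, r ≠ j → 0 < (σ (Sum.inl j) - σ (Sum.inl r)) * (σ (Sum.inl j) - σ (Sum.inr r)) ∧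
      0 < (σ (Sum.inr j) - σ (Sum.inl r)) * (σ (Sum.inr j) - σ (Sum.inr r)) := by
    intro r j hrj
    have a := h.inr_lt_inl r
    have b := h.inr_lt_inl j
    rcases hrj.lt_or_gt with hrj | hrj
    · have := h.inl_lt_inr r j hrj
      exact ⟨mul_pos_of_neg_of_neg (by linarith) (by linarith),
        mul_pos_of_neg_of_neg (by linarith) (by linarith)⟩
    · have := h.inl_lt_inr j r hrj
      exact ⟨mul_pos (by linarith) (by linarith), mul_pos (by linarith) (by linarith)⟩
  rw [h1, Fintype.prod_sum_type, ← prod_mul_distrib]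
  rcases l with j | j
  · rw [← mul_prod_erase univ _ (mem_univ j), ← mul_assoc]
    refine mul_pos ?_ (prod_pos fun r hr => ?_)
    · simpa using h.inr_lt_inl j
    · simpa [ne_of_mem_erase hr] using (h2 r j (ne_of_mem_erase hr)).1
  · rw [← mul_prod_erase univ _ (mem_univ j), ← mul_assoc]
    refine mul_pos ?_ (prod_pos fun r hr => ?_)
    · simpa using h.inr_lt_inl j
    · simpa [ne_of_mem_erase hr] using (h2 r j (ne_of_mem_erase hr)).2

theorem rightSign_mul_prod_mul_pos (π : Equiv.Perm (Fin p ⊕ Fin p)) :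
    0 < rightSign ℝ π * (∏ s, ∏ r, (σ (π (Sum.inr s)) - σ (π (Sum.inl r)))) *
      ∏ s, ∏ s' ∈ {s}ᶜ, (σ (π (Sum.inr s)) - σ (π (Sum.inr s'))) := by
  rw [rightSign, ← prod_mul_distrib, ← prod_mul_distrib]
  refine prod_pos fun s _ => ?_
  have h1 := h.elim_mul_prod_pos (π (Sum.inr s))
  have h2 : ∏ k ∈ {π (Sum.inr s)}ᶜ, (σ (π (Sum.inr s)) - σ k) =
      (∏ r, (σ (π (Sum.inr s)) - σ (π (Sum.inl r)))) *
      ∏ s' ∈ {s}ᶜ, (σ (π (Sum.inr s)) - σ (π (Sum.inr s'))) := by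
    have h3 : ∏ k ∈ {π (Sum.inr s)}ᶜ, (σ (π (Sum.inr s)) - σ k) =
        ∏ x, if x = Sum.inr s then 1 else σ (π (Sum.inr s)) - σ (π x) := by
      rw [← Equiv.prod_comp π.symm, prod_ite, prod_const_one, one_mul]
      refine prod_congr (by ext; simp [Equiv.symm_apply_eq]) fun _ _ => by simp
    have h4 : ∏ s' ∈ {s}ᶜ, (σ (π (Sum.inr s)) - σ (π (Sum.inr s'))) =
        ∏ s', if s' = s then 1 else σ (π (Sum.inr s)) - σ (π (Sum.inr s')) := by
      rw [prod_ite, prod_const_one, one_mul]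
      exact prod_congr (by ext; simp) fun _ _ => rfl
    rw [h3, h4, Fintype.prod_sum_type]
    simp
  rw [h2] at h1
  linarith

theorem redistributionCoeff_mul_pos (π π' : Equiv.Perm (Fin p ⊕ Fin p)) :
    0 < redistributionCoeff σ π * redistributionCoeff σ π' := by
  have hinj : ∀ π : Equiv.Perm (Fin p ⊕ Fin p), Function.Injective fun s => σ (π (Sum.inr s)) :=
    fun π => h.injective.comp (π.injective.comp Sum.inr_injective)
  have h1 := h.rightSign_mul_prod_mul_pos π
  have h2 := h.rightSign_mul_prod_mul_pos π'
  have h3 := prod_off_diag_mul_pos (hinj π) (hinj π')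
  have h4 := redistributionCoeff_mul_prod σ π
  have h5 := redistributionCoeff_mul_prod σ π'
  have h6 : (vandermonde fun i => σ (finSumFinEquiv.symm i)).det ≠ 0 :=
    det_vandermonde_ne_zero_iff.2 (h.injective.comp finSumFinEquiv.symm.injective)
  set V := (vandermonde fun i => σ (finSumFinEquiv.symm i)).det
  set r := rightSign ℝ π * ∏ s, ∏ r, (σ (π (Sum.inr s)) - σ (π (Sum.inl r)))
  set r' := rightSign ℝ π' * ∏ s, ∏ r, (σ (π' (Sum.inr s)) - σ (π' (Sum.inl r)))
  set t := ∏ s, ∏ s' ∈ {s}ᶜ, (σ (π (Sum.inr s)) - σ (π (Sum.inr s')))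
  set t' := ∏ s, ∏ s' ∈ {s}ᶜ, (σ (π' (Sum.inr s)) - σ (π' (Sum.inr s')))
  have h7 : 0 < r * r' := by
    have := mul_pos h1 h2
    have h8 : 0 < (r * r') * (t * t') := by linarith
    exact (pos_iff_pos_of_mul_pos h8).2 h3
  have h9 : 0 < (redistributionCoeff σ π * redistributionCoeff σ π') * (r * r') := by
    have : (redistributionCoeff σ π * redistributionCoeff σ π') * (r * r') = V ^ 2 := by
      linear_combination h4 * (redistributionCoeff σ π' * r') + V * h5
    rw [this]
    positivity
  exact (pos_iff_pos_of_mul_pos h9).2 h7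

end StrictlyInterlaced

end Interlacing

section RangeOfCharacteristicFunctions

open MeasureTheory
open scoped NNReal

theorem range_subset_range_of_sum_integral_exp_eq {K V W ι : Type*} [Fintype ι]
    [TopologicalSpace K] [CompactSpace K] [T2Space K] [MeasurableSpace K] [BorelSpace K]
    [NormedAddCommGroup V] [NormedSpace ℝ V] [MeasurableSpace V] [BorelSpace V]
    [CompleteSpace V] [SecondCountableTopology V]
    [AddCommGroup W] [Module ℝ W] [TopologicalSpace W]
    (L : V →ₗ[ℝ] W →ₗ[ℝ] ℝ) (hL' : ∀ v ≠ 0, L v ≠ 0) (hL : Continuous fun q : V × W => L q.1 q.2)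
    (μ : Measure K) [IsFiniteMeasure μ] [μ.IsOpenPosMeasure]
    {f : ι → K → V} (hf : ∀ i, Continuous (f i)) {g : K → V} (hg : Continuous g)
    {c : ι → ℝ} {d : ℝ} (hc : ∀ i, 0 < c i) (hd : 0 ≤ d)
    (h : ∀ w, ∑ i, (c i : ℂ) * ∫ k, Complex.exp (L (f i k) w * Complex.I) ∂μ =
      d * ∫ k, Complex.exp (L (g k) w * Complex.I) ∂μ) (i : ι) :
    Set.range (f i) ⊆ Set.range g := by
  lift c to ι → ℝ≥0 using fun i => (hc i).le
  lift d to ℝ≥0 using hd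
  have hchar : ∀ (w : W) {F : K → V}, Continuous F →
      ∫ v, (BoundedContinuousFunction.char Real.continuous_probChar hL w v : ℂ) ∂(μ.map F) =
        ∫ k, Complex.exp (L (F k) w * Complex.I) ∂μ := by
    intro w F hF
    rw [integral_map hF.measurable.aemeasurable
      (BoundedContinuousFunction.continuous _).aestronglyMeasurable]
    simp [BoundedContinuousFunction.char_apply, Real.probChar_apply]
  have heq : ∑ i, c i • μ.map (f i) = d • μ.map g := by
    refine ext_of_integral_char_eq Real.continuous_probChar Real.probChar_ne_one hL' hL
      fun w => ?_
    rw [integral_finsetSum_measure fun i _ => BoundedContinuousFunction.integrable _ _,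
      integral_smul_nnreal_measure, hchar w hg]
    simp_rw [integral_smul_nnreal_measure, hchar w (hf _)]
    simpa [NNReal.smul_def] using h w
  have hclosed : IsClosed (Set.range g) := (isCompact_range hg).isClosed
  have hnull : (d • μ.map g) (Set.range g)ᶜ = 0 := by
    rw [Measure.smul_apply, Measure.map_apply hg.measurable hclosed.measurableSet.compl]
    simp
  rw [← heq, Measure.finsetSum_apply, Finset.sum_eq_zero_iff] at hnull
  have hi := hnull i (Finset.mem_univ i)
  rw [Measure.smul_apply, Measure.map_apply (hf i).measurable hclosed.measurableSet.compl,
    smul_eq_zero_iff_right (NNReal.coe_pos.1 (hc i)).ne'] at hi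
  rw [(hclosed.isOpen_compl.preimage (hf i)).measure_eq_zero_iff μ] at hi
  rintro _ ⟨k, rfl⟩
  by_contra hk
  exact (Set.eq_empty_iff_forall_notMem.1 hi k) hk

end RangeOfCharacteristicFunctions

section OrbitSum

open MeasureTheory

variable {n : Type*} [Fintype n] [DecidableEq n]

/-- The sum `U⋆ diag(a) U + V⋆ diag(b) V`, as a function of the pair `(U, V)`. -/
noncomputable def orbitSum (a b : n → ℝ) (q : unitaryGroup n ℂ × unitaryGroup n ℂ) :
    Matrix n n ℂ :=
  star (q.1 : Matrix n n ℂ) * diagonal (fun l => (a l : ℂ)) * (q.1 : Matrix n n ℂ) +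
    star (q.2 : Matrix n n ℂ) * diagonal (fun l => (b l : ℂ)) * (q.2 : Matrix n n ℂ)

theorem continuous_orbitSum (a b : n → ℝ) : Continuous (orbitSum a b) := by
  unfold orbitSum
  fun_prop

theorem trace_conj_diagonal_mul (a : n → ℝ) (X : Matrix n n ℂ) (U : unitaryGroup n ℂ) :
    (star (U : Matrix n n ℂ) * diagonal (fun l => (a l : ℂ)) * (U : Matrix n n ℂ) * X).trace =
      ∑ l, (a l : ℂ) * unitaryConj X U l l := by
  rw [mul_assoc, mul_assoc, trace_mul_comm, mul_assoc]
  simp only [trace, diag_apply, diagonal_mul]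
  rfl

theorem exp_trace_orbitSum_mul (a b : n → ℝ) (X : Matrix n n ℂ)
    (q : unitaryGroup n ℂ × unitaryGroup n ℂ) :
    Complex.exp ((orbitSum a b q * X).trace * Complex.I) =
      expWeight (Complex.I • X) a q.1 * expWeight (Complex.I • X) b q.2 := by
  rw [orbitSum, add_mul, trace_add, trace_conj_diagonal_mul, trace_conj_diagonal_mul, expWeight,
    expWeight, ← Complex.exp_add, add_mul, Finset.sum_mul, Finset.sum_mul]
  congr 2 <;> refine Finset.sum_congr rfl fun l _ => ?_ <;>
  · simp only [unitaryConj, mul_smul_comm, smul_mul_assoc, Matrix.smul_apply, smul_eq_mul]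
    ring

theorem isHermitian_conj_diagonal (U : Matrix n n ℂ) (a : n → ℝ) :
    (star U * diagonal (fun l => (a l : ℂ)) * U).IsHermitian :=
  isHermitian_conjTranspose_mul_mul _ (isHermitian_diagonal_of_self_adjoint _ (by ext; simp))

theorem isHermitian_orbitSum (a b : n → ℝ) (q : unitaryGroup n ℂ × unitaryGroup n ℂ) :
    (orbitSum a b q).IsHermitian :=
  (isHermitian_conj_diagonal _ a).add (isHermitian_conj_diagonal _ b)

theorem Matrix.IsHermitian.re_trace_mul {C : Matrix n n ℂ} (hC : C.IsHermitian) (w : Matrix n n ℂ) :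
    (((C * w).trace.re : ℝ) : ℂ) = (C * ((2⁻¹ : ℂ) • (w + wᴴ))).trace := by
  have h : (C * wᴴ).trace = star (C * w).trace := by
    rw [← trace_conjTranspose, conjTranspose_mul, hC.eq, trace_mul_comm]
  rw [mul_smul_comm, mul_add, trace_smul, trace_add, h]
  apply Complex.ext <;> simp
  ring

/-- The real bilinear form `Re tr (v w)`. -/
noncomputable def reTraceForm (n : Type*) [Fintype n] :
    (n → n → ℂ) →ₗ[ℝ] (n → n → ℂ) →ₗ[ℝ] ℝ :=
  LinearMap.mk₂ ℝ (fun v w => (of v * of w).trace.re)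
    (fun v v' w => by rw [← Complex.add_re, ← trace_add, ← add_mul]; rfl)
    (fun c v w => by
      rw [← Complex.smul_re, ← trace_smul, ← smul_mul_assoc]; rfl)
    (fun v w w' => by rw [← Complex.add_re, ← trace_add, ← mul_add]; rfl)
    (fun c v w => by rw [← Complex.smul_re, ← trace_smul, ← mul_smul_comm]; rfl)

omit [DecidableEq n] in
theorem reTraceForm_apply (v w : n → n → ℂ) :
    reTraceForm n v w = (of v * of w).trace.re := rfl

theorem reTraceForm_ne_zero {v : n → n → ℂ} (hv : v ≠ 0) : reTraceForm n v ≠ 0 := by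
  intro h
  refine hv ?_
  ext i j
  have h1 : ∀ z : ℂ, (z * v i j).re = 0 := fun z => by
    have := LinearMap.congr_fun h (of.symm (single j i z))
    rw [reTraceForm_apply, Equiv.apply_symm_apply, trace_mul_comm, trace_single_mul] at this
    simpa using this
  apply Complex.ext
  · simpa using h1 1
  · simpa using h1 Complex.I

omit [DecidableEq n] in
theorem continuous_reTraceForm :
    Continuous fun q : (n → n → ℂ) × (n → n → ℂ) => reTraceForm n q.1 q.2 := by
  simp only [reTraceForm_apply, trace, diag_apply, mul_apply, of_apply]
  fun_prop

theorem integral_exp_reTraceForm_orbitSum (a b : n → ℝ) (w : n → n → ℂ) :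
    ∫ q, Complex.exp (reTraceForm n (of.symm (orbitSum a b q)) w * Complex.I)
        ∂((unitaryHaar n).prod (unitaryHaar n)) =
      (∫ U, expWeight (Complex.I • (2⁻¹ : ℂ) • (of w + (of w)ᴴ)) a U ∂(unitaryHaar n)) *
        ∫ U, expWeight (Complex.I • (2⁻¹ : ℂ) • (of w + (of w)ᴴ)) b U ∂(unitaryHaar n) := by
  rw [← integral_prod_mul]
  refine integral_congr_ae (Filter.Eventually.of_forall fun q => ?_)
  simp only
  rw [reTraceForm_apply, Equiv.apply_symm_apply, (isHermitian_orbitSum a b q).re_trace_mul,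
    exp_trace_orbitSum_mul]

end OrbitSum

section InterlacedRange

open MeasureTheory

variable {p : ℕ}

theorem StrictlyInterlaced.range_orbitSum_subset (hp : 0 < p) {σ : Fin p ⊕ Fin p → ℝ}
    (h : StrictlyInterlaced σ) (π : Equiv.Perm (Fin p ⊕ Fin p)) :
    Set.range (orbitSum (fun j => σ (π (Sum.inl j))) fun j => σ (π (Sum.inr j))) ⊆
      Set.range (orbitSum (fun j => σ (Sum.inl j)) fun j => σ (Sum.inr j)) := by
  set D : ℝ := (vandermonde fun j => σ (Sum.inl j)).det * (vandermonde fun j => σ (Sum.inr j)).det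
    with hD
  have hcoeff : redistributionCoeff σ 1 = (-1) ^ p * D := by
    simp [redistributionCoeff, rightSign, hD]
  have hd : (0 : ℝ) ≤ p.factorial ^ 2 * (-2) ^ p * D * redistributionCoeff σ 1 := by
    rw [hcoeff, neg_pow]
    have : (p.factorial : ℝ) ^ 2 * ((-1) ^ p * 2 ^ p) * D * ((-1) ^ p * D) =
      ((-1) ^ p) ^ 2 * (p.factorial ^ 2 * 2 ^ p * D ^ 2) := by ring
    rw [this]
    positivity
  have key := range_subset_range_of_sum_integral_exp_eq (reTraceForm (Fin p))
    (fun v => reTraceForm_ne_zero) continuous_reTraceForm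
    ((unitaryHaar (Fin p)).prod (unitaryHaar (Fin p)))
    (f := fun τ : Equiv.Perm (Fin p ⊕ Fin p) => fun q => of.symm
      (orbitSum (fun j => σ (τ (Sum.inl j))) (fun j => σ (τ (Sum.inr j))) q))
    (fun τ => continuous_orbitSum _ _)
    (g := fun q => of.symm
      (orbitSum (fun j => σ (Sum.inl j)) (fun j => σ (Sum.inr j)) q)) (continuous_orbitSum _ _)
    (fun τ => h.redistributionCoeff_mul_pos τ 1) hd (fun w => ?_) π
  · rintro _ ⟨q, rfl⟩
    obtain ⟨q', hq'⟩ := key ⟨q, rfl⟩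
    exact ⟨q', of.symm.injective hq'⟩
  · simp only [integral_exp_reTraceForm_orbitSum]
    have hX : ((2⁻¹ : ℂ) • (of w + (of w)ᴴ)).IsHermitian := by
      rw [IsHermitian, conjTranspose_smul, conjTranspose_add, conjTranspose_conjTranspose,
        add_comm]
      simp
    have := congrArg (· * (redistributionCoeff σ 1 : ℂ)) (sum_redistributionCoeff_mul hp hX σ)
    simp only [Finset.sum_mul] at this
    convert this using 1
    · refine Finset.sum_congr rfl fun τ _ => ?_
      push_cast
      ring
    · push_cast [hD]
      ring

end InterlacedRange

section EqualSpectra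

open Polynomial

theorem exists_perm_of_map_univ_eq {ι α : Type*} [Fintype ι] {f g : ι → α}
    (h : Finset.univ.val.map f = Finset.univ.val.map g) :
    ∃ π : Equiv.Perm ι, ∀ i, g (π i) = f i := by
  classical
  have hcard : ∀ c, Nonempty ({i // f i = c} ≃ {i // g i = c}) := fun c => by
    rw [← Fintype.card_eq, Fintype.card_subtype, Fintype.card_subtype]
    have := congrArg (Multiset.count c) h
    rw [Multiset.count_map, Multiset.count_map] at this
    simp only [eq_comm (a := c)] at this
    exact this
  exact ⟨Equiv.ofFiberEquiv fun c => (hcard c).some, Equiv.ofFiberEquiv_map _⟩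

theorem exists_perm_of_prod_X_sub_C_eq {ι R : Type*} [Fintype ι] [CommRing R] [IsDomain R]
    {f g : ι → R} (h : ∏ i, (X - C (f i)) = ∏ i, (X - C (g i))) :
    ∃ π : Equiv.Perm ι, ∀ i, g (π i) = f i := by
  refine exists_perm_of_map_univ_eq ?_
  have hroots : ∀ f : ι → R, (∏ i, (X - C (f i))).roots = Finset.univ.val.map f := fun f => by
    rw [← roots_multiset_prod_X_sub_C (Finset.univ.val.map f), Multiset.map_map]
    rfl
  rw [← hroots, ← hroots, h]

end EqualSpectra

section WeakInterlacing

variable {p : ℕ}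

theorem range_orbitSum_subset_of_interlaced (hp : 0 < p) {σ : Fin p ⊕ Fin p → ℝ}
    (h₁ : ∀ j, σ (Sum.inr j) ≤ σ (Sum.inl j))
    (h₂ : ∀ i j, i < j → σ (Sum.inl j) ≤ σ (Sum.inr i)) (π : Equiv.Perm (Fin p ⊕ Fin p)) :
    Set.range (orbitSum (fun j => σ (π (Sum.inl j))) fun j => σ (π (Sum.inr j))) ⊆
      Set.range (orbitSum (fun j => σ (Sum.inl j)) fun j => σ (Sum.inr j)) := by
  rintro _ ⟨q, rfl⟩
  let δ : Fin p ⊕ Fin p → ℝ := Sum.elim (fun j => 2 * (j : ℕ)) (fun j => 2 * (j : ℕ) + 1)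
  let F : Equiv.Perm (Fin p ⊕ Fin p) →
      ℝ × (unitaryGroup (Fin p) ℂ × unitaryGroup (Fin p) ℂ) → Matrix (Fin p) (Fin p) ℂ :=
    fun π s => orbitSum (fun j => σ (π (Sum.inl j)) - s.1 * δ (π (Sum.inl j)))
      (fun j => σ (π (Sum.inr j)) - s.1 * δ (π (Sum.inr j))) s.2
  have hF : ∀ π, Continuous (F π) := fun π => by
    simp only [F, orbitSum]
    fun_prop
  have hclosed : IsClosed (Prod.fst '' {s | F 1 s = F π (s.1, q)}) :=
    isClosedMap_fst_of_compactSpace _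
      (isClosed_eq (hF 1) ((hF π).comp (by fun_prop)))
  have hmem : Set.Ioi (0 : ℝ) ⊆ Prod.fst '' {s | F 1 s = F π (s.1, q)} := by
    intro t (ht : 0 < t)
    have hstrict : StrictlyInterlaced fun x => σ x - t * δ x := by
      refine ⟨fun j => ?_, fun i j hij => ?_⟩
      · simp only [δ, Sum.elim_inl, Sum.elim_inr]
        linarith [h₁ j]
      · have : ((i : ℕ) : ℝ) + 1 ≤ (j : ℕ) := by exact_mod_cast hij
        simp only [δ, Sum.elim_inl, Sum.elim_inr]
        nlinarith [h₂ i j hij]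
    obtain ⟨q', hq'⟩ := hstrict.range_orbitSum_subset hp π ⟨q, rfl⟩
    exact ⟨(t, q'), hq', rfl⟩
  have h0 : (0 : ℝ) ∈ Prod.fst '' {s | F 1 s = F π (s.1, q)} :=
    closure_minimal hmem hclosed (by simp [closure_Ioi])
  obtain ⟨⟨t, q'⟩, hq', rfl : t = 0⟩ := h0
  refine ⟨q', ?_⟩
  simpa [F] using hq'

end WeakInterlacing

section Spectra

variable {n : Type*} [Fintype n] [DecidableEq n]

theorem Matrix.IsHermitian.exists_unitary_conj_diagonal {A : Matrix n n ℂ} (hA : A.IsHermitian) :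
    ∃ U : unitaryGroup n ℂ, A = star (U : Matrix n n ℂ) *
      diagonal (fun l => (hA.eigenvalues l : ℂ)) * (U : Matrix n n ℂ) := by
  refine ⟨star hA.eigenvectorUnitary, ?_⟩
  conv_lhs => rw [hA.spectral_theorem, Unitary.conjStarAlgAut_apply]
  rw [Unitary.coe_star, star_star]
  rfl

theorem charpoly_unitary_conj_diagonal (U : unitaryGroup n ℂ) (a : n → ℂ) :
    (star (U : Matrix n n ℂ) * diagonal a * (U : Matrix n n ℂ)).charpoly =
      ∏ l, (Polynomial.X - Polynomial.C (a l)) := by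
  rw [charpoly_mul_comm, ← mul_assoc, mem_unitaryGroup_iff.1 U.2, one_mul, charpoly_diagonal]

end Spectra

theorem Fin.two_mul_val_lt {p : ℕ} (i : Fin p) : 2 * i.val < 2 * p :=
  Nat.mul_lt_mul_of_pos_left i.isLt two_pos

theorem Fin.two_mul_val_add_one_lt {p : ℕ} (i : Fin p) : 2 * i.val + 1 < 2 * p := by
  have := i.isLt
  omega

/-- The parity splitting of `Fin (2 * p)`: even positions on the left, odd ones on the right. -/
noncomputable def finParityEquiv (p : ℕ) : Fin p ⊕ Fin p ≃ Fin (2 * p) :=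
  Equiv.ofBijective
    (Sum.elim (fun i => ⟨2 * i.val, i.two_mul_val_lt⟩)
      (fun i => ⟨2 * i.val + 1, i.two_mul_val_add_one_lt⟩)) <| by
    rw [Fintype.bijective_iff_injective_and_card]
    refine ⟨?_, by simp; omega⟩
    rintro (i | i) (j | j) h <;> simp [Fin.ext_iff] at h ⊢ <;> omega

/-- Fomin–Fulton–Li–Poon, Proposition 2.2. Let `A`, `B` be complex
Hermitian `p × p` matrices and let `σ₁ ≥ ⋯ ≥ σ_{2p}` be the eigenvalues of `A` and `B`
together (with multiplicity), in decreasing order; i.e. the product of the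
characteristic polynomials of `A` and `B` is `∏_{i=1}^{2p} (X - σᵢ)`.  Then there are
Hermitian matrices `A'` and `B'` with ordered spectra `(σ₁, σ₃, …, σ_{2p-1})` and
`(σ₂, σ₄, …, σ_{2p})` respectively such that `A' + B' = A + B`. -/
theorem fflp_redistribution
    (p : ℕ) (hp : 1 ≤ p)
    (A B : Matrix (Fin p) (Fin p) ℂ) (hA : A.IsHermitian) (hB : B.IsHermitian)
    (σ : Fin (2 * p) → ℝ) (hσ : Antitone σ)
    (hspec : A.charpoly * B.charpoly =
      ∏ i : Fin (2 * p), (Polynomial.X - Polynomial.C ((σ i : ℂ)))) :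
    ∃ A' B' : Matrix (Fin p) (Fin p) ℂ,
      A'.IsHermitian ∧ B'.IsHermitian ∧ A' + B' = A + B ∧
      A'.charpoly = ∏ i : Fin p,
        (Polynomial.X - Polynomial.C ((σ ⟨2 * i.val, by have := i.isLt; omega⟩ : ℝ) : ℂ)) ∧
      B'.charpoly = ∏ i : Fin p,
        (Polynomial.X - Polynomial.C ((σ ⟨2 * i.val + 1, by have := i.isLt; omega⟩ : ℝ) : ℂ)) := by
  obtain ⟨π, hπ⟩ : ∃ π : Equiv.Perm (Fin p ⊕ Fin p), ∀ x,
      (σ (finParityEquiv p (π x)) : ℂ) =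
        Sum.elim (fun l => (hA.eigenvalues l : ℂ)) (fun l => (hB.eigenvalues l : ℂ)) x := by
    refine exists_perm_of_prod_X_sub_C_eq (g := fun x => (σ (finParityEquiv p x) : ℂ)) ?_
    rw [(finParityEquiv p).prod_comp fun i => Polynomial.X - Polynomial.C (σ i : ℂ), ← hspec,
      hA.charpoly_eq, hB.charpoly_eq, Fintype.prod_sum_type]
    rfl
  obtain ⟨U, hU⟩ := hA.exists_unitary_conj_diagonal
  obtain ⟨V, hV⟩ := hB.exists_unitary_conj_diagonal
  have hsub := range_orbitSum_subset_of_interlaced hp (σ := fun x => σ (finParityEquiv p x))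
    (fun j => hσ (Fin.mk_le_mk.2 (by omega)))
    (fun i j hij => hσ (Fin.mk_le_mk.2 (by have : i.val < j.val := hij; omega))) π
  obtain ⟨q, hq⟩ := hsub ⟨(U, V), rfl⟩
  refine ⟨_, _, isHermitian_conj_diagonal _ _, isHermitian_conj_diagonal _ _, hq.trans ?_,
    charpoly_unitary_conj_diagonal _ _, charpoly_unitary_conj_diagonal _ _⟩
  simp only [orbitSum, hπ, Sum.elim_inl, Sum.elim_inr, ← hU, ← hV]
end
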